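/- Let g : ℂᴺ → ℂʳ be entire and let X = {z ∈ ℂᴺ : g(z) = 0} (a closed Stein subvariety of ℂᴺ). Let S ⊆ ℂᴺ be compact, and assume S is O(Ω)-convex in some open Stein set Ω ⊆ ℂᴺ containing S, and that S ∩ X is O(ℂᴺ)-convex (equal to its hull with respect to entire functions on ℂᴺ; this hull automatically lies in X, so this is equivalent to S ∩ X being O(X)-convex). Then for every open set U ⊆ ℂᴺ containing S ∪ X there exists an open Stein set V ⊆ ℂᴺ such that S ∪ X ⊆ V ⊆ U and S is O(V)-convex. -/

import Mathlib

open Set Topology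

noncomputable section

/-- The `𝒪(Ω)`-hull of a set `K` inside `Ω`: points of `Ω` where every function
holomorphic on `Ω` is bounded by its sup over `K`. -/
def hullO {E : Type*} [NormedAddCommGroup E] [NormedSpace ℂ E] (Ω K : Set E) : Set E :=
  {z ∈ Ω | ∀ f : E → ℂ, DifferentiableOn ℂ f Ω → ‖f z‖ ≤ ⨆ w ∈ K, ‖f w‖}

/-- An open set is Stein if the `𝒪(Ω)`-hull of every compact subset is compact. -/
def IsSteinOpen {E : Type*} [NormedAddCommGroup E] [NormedSpace ℂ E] (Ω : Set E) : Prop :=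
  IsOpen Ω ∧ ∀ K : Set E, K ⊆ Ω → IsCompact K → IsCompact (hullO Ω K)

/-- A compact set is a Stein compactum if every open neighborhood contains a
Stein open neighborhood. -/
def IsSteinCompactum {E : Type*} [NormedAddCommGroup E] [NormedSpace ℂ E] (S : Set E) : Prop :=
  ∀ U : Set E, IsOpen U → S ⊆ U → ∃ Ω : Set E, IsSteinOpen Ω ∧ S ⊆ Ω ∧ Ω ⊆ U

/-- `ℝⁿ` viewed as the real subspace of `ℂⁿ`. -/
def realSlice (n : ℕ) : Set (EuclideanSpace ℂ (Fin n)) := {x | ∀ i, (x i).im = 0}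

/-- The fiber of a subset of a product over a point of the first factor. -/
def fiberOf {α β : Type*} (S : Set (α × β)) (u : α) : Set β := {z | (u, z) ∈ S}

/-- A subset of `ℝⁿ × ℂᵐ` that is open in the subspace topology of `ℝⁿ × ℂᵐ ⊆ ℂⁿ × ℂᵐ`. -/
def OpenInSlice {n m : ℕ}
    (U : Set (EuclideanSpace ℂ (Fin n) × EuclideanSpace ℂ (Fin m))) : Prop :=
  ∃ W, IsOpen W ∧ U = W ∩ (realSlice n ×ˢ (univ : Set (EuclideanSpace ℂ (Fin m))))

section ModuleA
open MeasureTheory Complex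

/-- Holomorphic Wirtinger derivative in direction `v`. -/
def dz {E : Type*} [NormedAddCommGroup E] [NormedSpace ℂ E] (v : E) (f : E → ℂ) (x : E) : ℂ :=
  (1 / 2 : ℂ) * (fderiv ℝ f x v - I * fderiv ℝ f x (I • v))

/-- Antiholomorphic Wirtinger derivative in direction `v`. -/
def db {E : Type*} [NormedAddCommGroup E] [NormedSpace ℂ E] (v : E) (f : E → ℂ) (x : E) : ℂ :=
  (1 / 2 : ℂ) * (fderiv ℝ f x v + I * fderiv ℝ f x (I • v))

section wirtinger
variable {E : Type*} [NormedAddCommGroup E] [NormedSpace ℂ E]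

lemma dz_add {f g : E → ℂ} {x : E} (v : E) (hf : DifferentiableAt ℝ f x)
    (hg : DifferentiableAt ℝ g x) : dz v (fun y => f y + g y) x = dz v f x + dz v g x := by
  simp only [dz, fderiv_fun_add hf hg, add_apply]; ring

lemma db_add {f g : E → ℂ} {x : E} (v : E) (hf : DifferentiableAt ℝ f x)
    (hg : DifferentiableAt ℝ g x) : db v (fun y => f y + g y) x = db v f x + db v g x := by
  simp only [db, fderiv_fun_add hf hg, add_apply]; ring

lemma dz_sub {f g : E → ℂ} {x : E} (v : E) (hf : DifferentiableAt ℝ f x)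
    (hg : DifferentiableAt ℝ g x) : dz v (fun y => f y - g y) x = dz v f x - dz v g x := by
  simp only [dz, fderiv_fun_sub hf hg, sub_apply]; ring

lemma db_sub {f g : E → ℂ} {x : E} (v : E) (hf : DifferentiableAt ℝ f x)
    (hg : DifferentiableAt ℝ g x) : db v (fun y => f y - g y) x = db v f x - db v g x := by
  simp only [db, fderiv_fun_sub hf hg, sub_apply]; ring

lemma dz_mul {f g : E → ℂ} {x : E} (v : E) (hf : DifferentiableAt ℝ f x)
    (hg : DifferentiableAt ℝ g x) :
    dz v (fun y => f y * g y) x = f x * dz v g x + g x * dz v f x := by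
  simp only [dz, fderiv_fun_mul hf hg, add_apply,
    smul_apply, smul_eq_mul]; ring

lemma db_mul {f g : E → ℂ} {x : E} (v : E) (hf : DifferentiableAt ℝ f x)
    (hg : DifferentiableAt ℝ g x) :
    db v (fun y => f y * g y) x = f x * db v g x + g x * db v f x := by
  simp only [db, fderiv_fun_mul hf hg, add_apply,
    smul_apply, smul_eq_mul]; ring

lemma db_const_mul {f : E → ℂ} {x : E} (v : E) (c : ℂ) (hf : DifferentiableAt ℝ f x) :
    db v (fun y => c * f y) x = c * db v f x := by
  rw [db_mul v (differentiableAt_const c) hf]; simp [db]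

lemma dz_const_mul {f : E → ℂ} {x : E} (v : E) (c : ℂ) (hf : DifferentiableAt ℝ f x) :
    dz v (fun y => c * f y) x = c * dz v f x := by
  rw [dz_mul v (differentiableAt_const c) hf]; simp [dz]

lemma fderiv_conj_apply {f : E → ℂ} {x : E} (hf : DifferentiableAt ℝ f x) (v : E) :
    fderiv ℝ (fun y => (starRingEnd ℂ) (f y)) x v = (starRingEnd ℂ) (fderiv ℝ f x v) := by
  have := (Complex.conjCLE.toContinuousLinearMap.hasFDerivAt.comp x hf.hasFDerivAt).fderiv
  have h2 : (fun y => (starRingEnd ℂ) (f y)) = (Complex.conjCLE.toContinuousLinearMap ∘ f) := by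
    ext y; simp
  rw [h2, this]; simp

lemma db_star {f : E → ℂ} {x : E} (hf : DifferentiableAt ℝ f x) (v : E) :
    db v (fun y => (starRingEnd ℂ) (f y)) x = (starRingEnd ℂ) (dz v f x) := by
  simp only [db, dz, fderiv_conj_apply hf]; simp [Complex.conj_ofNat]

lemma dz_star {f : E → ℂ} {x : E} (hf : DifferentiableAt ℝ f x) (v : E) :
    dz v (fun y => (starRingEnd ℂ) (f y)) x = (starRingEnd ℂ) (db v f x) := by
  simp only [db, dz, fderiv_conj_apply hf]; simp [Complex.conj_ofNat]; ring

lemma Filter.EventuallyEq.dz_eq {f g : E → ℂ} {x : E} (h : f =ᶠ[𝓝 x] g) (v : E) :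
    dz v f x = dz v g x := by simp only [dz, h.fderiv_eq]

lemma Filter.EventuallyEq.db_eq {f g : E → ℂ} {x : E} (h : f =ᶠ[𝓝 x] g) (v : E) :
    db v f x = db v g x := by simp only [db, h.fderiv_eq]

lemma contDiff_fderiv_apply {F : Type*} [NormedAddCommGroup F] [NormedSpace ℝ F]
    {f : E → F} {n : ℕ} (hf : ContDiff ℝ (n + 1 : ℕ) f) (v : E) :
    ContDiff ℝ n (fun x => fderiv ℝ f x v) :=
  (hf.fderiv_right (m := n) (by norm_cast)).clm_apply contDiff_const

lemma contDiff_dz {f : E → ℂ} {n : ℕ} (hf : ContDiff ℝ (n + 1 : ℕ) f) (v : E) :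
    ContDiff ℝ n (dz v f) :=
  contDiff_const.mul ((contDiff_fderiv_apply hf v).sub
    (contDiff_const.mul (contDiff_fderiv_apply hf _)))

lemma contDiff_db {f : E → ℂ} {n : ℕ} (hf : ContDiff ℝ (n + 1 : ℕ) f) (v : E) :
    ContDiff ℝ n (db v f) :=
  contDiff_const.mul ((contDiff_fderiv_apply hf v).add
    (contDiff_const.mul (contDiff_fderiv_apply hf _)))

lemma dz_support {f : E → ℂ} (v : E) : tsupport (dz v f) ⊆ tsupport f := by
  refine closure_minimal (fun x hx => ?_) (isClosed_tsupport f)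
  by_contra hx'
  have h0 : f =ᶠ[𝓝 x] fun _ => 0 := (notMem_tsupport_iff_eventuallyEq.mp hx')
  apply hx
  rw [h0.dz_eq]; simp [dz]

lemma db_support {f : E → ℂ} (v : E) : tsupport (db v f) ⊆ tsupport f := by
  refine closure_minimal (fun x hx => ?_) (isClosed_tsupport f)
  by_contra hx'
  have h0 : f =ᶠ[𝓝 x] fun _ => 0 := (notMem_tsupport_iff_eventuallyEq.mp hx')
  apply hx
  rw [h0.db_eq]; simp [db]

lemma HasCompactSupport.dz {f : E → ℂ} (hf : HasCompactSupport f) (v : E) :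
    HasCompactSupport (dz v f) := hf.mono' ((subset_tsupport _).trans (dz_support v))

lemma HasCompactSupport.db {f : E → ℂ} (hf : HasCompactSupport f) (v : E) :
    HasCompactSupport (db v f) := hf.mono' ((subset_tsupport _).trans (db_support v))

/-- second derivative expression -/
lemma fderiv_dz {f : E → ℂ} {x : E} (hf : ContDiffAt ℝ 2 f x) (v w : E) :
    fderiv ℝ (dz v f) x w = (1 / 2 : ℂ) * (fderiv ℝ (fderiv ℝ f) x w v
      - I * fderiv ℝ (fderiv ℝ f) x w (I • v)) := by
  have h1 : DifferentiableAt ℝ (fderiv ℝ f) x :=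
    (hf.fderiv_right (m := 1) (by norm_num)).differentiableAt (by norm_num)
  have h2 : ∀ u : E, DifferentiableAt ℝ (fun y => fderiv ℝ f y u) x :=
    fun u => h1.clm_apply (differentiableAt_const u)
  have h3 : ∀ u : E, fderiv ℝ (fun y => fderiv ℝ f y u) x w = fderiv ℝ (fderiv ℝ f) x w u := by
    intro u
    rw [fderiv_clm_apply h1 (differentiableAt_const u)]; simp
  have : dz v f = fun y => (1 / 2 : ℂ) * (fderiv ℝ f y v - I * fderiv ℝ f y (I • v)) := rfl
  have hd : HasFDerivAt (fun y => (1 / 2 : ℂ) * (fderiv ℝ f y v - I * fderiv ℝ f y (I • v))) _ x :=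
    ((h2 v).hasFDerivAt.sub ((h2 (I • v)).hasFDerivAt.const_mul I)).const_mul (1 / 2 : ℂ)
  rw [this, hd.fderiv]
  simp [h3]

lemma fderiv_db {f : E → ℂ} {x : E} (hf : ContDiffAt ℝ 2 f x) (v w : E) :
    fderiv ℝ (db v f) x w = (1 / 2 : ℂ) * (fderiv ℝ (fderiv ℝ f) x w v
      + I * fderiv ℝ (fderiv ℝ f) x w (I • v)) := by
  have h1 : DifferentiableAt ℝ (fderiv ℝ f) x :=
    (hf.fderiv_right (m := 1) (by norm_num)).differentiableAt (by norm_num)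
  have h2 : ∀ u : E, DifferentiableAt ℝ (fun y => fderiv ℝ f y u) x :=
    fun u => h1.clm_apply (differentiableAt_const u)
  have h3 : ∀ u : E, fderiv ℝ (fun y => fderiv ℝ f y u) x w = fderiv ℝ (fderiv ℝ f) x w u := by
    intro u
    rw [fderiv_clm_apply h1 (differentiableAt_const u)]; simp
  have : db v f = fun y => (1 / 2 : ℂ) * (fderiv ℝ f y v + I * fderiv ℝ f y (I • v)) := rfl
  have hd : HasFDerivAt (fun y => (1 / 2 : ℂ) * (fderiv ℝ f y v + I * fderiv ℝ f y (I • v))) _ x :=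
    ((h2 v).hasFDerivAt.add ((h2 (I • v)).hasFDerivAt.const_mul I)).const_mul (1 / 2 : ℂ)
  rw [this, hd.fderiv]
  simp [h3, mul_add]

lemma second_symm {F : Type*} [NormedAddCommGroup F] [NormedSpace ℝ F]
    {f : E → F} {x : E} (hf : ContDiffAt ℝ 2 f x) (v w : E) :
    fderiv ℝ (fderiv ℝ f) x v w = fderiv ℝ (fderiv ℝ f) x w v :=
  (hf.isSymmSndFDerivAt (by simp)) v w

lemma dz_db_comm {f : E → ℂ} {x : E} (hf : ContDiffAt ℝ 2 f x) (v w : E) :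
    dz v (db w f) x = db w (dz v f) x := by
  simp only [dz, db]
  change (1 / 2 : ℂ) * (fderiv ℝ (db w f) x v - I * fderiv ℝ (db w f) x (I • v)) =
    (1 / 2 : ℂ) * (fderiv ℝ (dz v f) x w + I * fderiv ℝ (dz v f) x (I • w))
  simp only [fderiv_db hf, fderiv_dz hf]
  rw [second_symm hf w v, second_symm hf w (I • v), second_symm hf (I • w) v,
    second_symm hf (I • w) (I • v)]
  ring

lemma db_db_comm {f : E → ℂ} {x : E} (hf : ContDiffAt ℝ 2 f x) (v w : E) :
    db v (db w f) x = db w (db v f) x := by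
  simp only [db]
  change (1 / 2 : ℂ) * (fderiv ℝ (db w f) x v + I * fderiv ℝ (db w f) x (I • v)) =
    (1 / 2 : ℂ) * (fderiv ℝ (db v f) x w + I * fderiv ℝ (db v f) x (I • w))
  simp only [fderiv_db hf]
  rw [second_symm hf w v, second_symm hf w (I • v), second_symm hf (I • w) v,
    second_symm hf (I • w) (I • v)]
  ring

end wirtinger

section ibp
variable {E : Type*} [NormedAddCommGroup E] [InnerProductSpace ℂ E] [FiniteDimensional ℂ E]
  [MeasurableSpace E] [BorelSpace E] (μ : Measure E) [μ.IsAddHaarMeasure]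

lemma ibp_aux {f g : E → ℂ} (hf : ContDiff ℝ 1 f) (hg : ContDiff ℝ 1 g)
    (hc : HasCompactSupport f) (v : E) :
    ∫ x, f x * fderiv ℝ g x v ∂μ = - ∫ x, fderiv ℝ f x v * g x ∂μ := by
  have : FiniteDimensional ℝ E := FiniteDimensional.complexToReal E
  have hf1 : Continuous (fun x => fderiv ℝ f x v) :=
    (contDiff_fderiv_apply (n := 0) (by simpa using hf) v).continuous
  have hg1 : Continuous (fun x => fderiv ℝ g x v) :=
    (contDiff_fderiv_apply (n := 0) (by simpa using hg) v).continuous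
  have hc1 : HasCompactSupport (fun x => fderiv ℝ f x v) := hc.fderiv_apply (𝕜 := ℝ) v
  apply integral_mul_fderiv_eq_neg_fderiv_mul_of_integrable
  · exact (hf1.mul hg.continuous).integrable_of_hasCompactSupport hc1.mul_right
  · exact (hf.continuous.mul hg1).integrable_of_hasCompactSupport hc.mul_right
  · exact (hf.continuous.mul hg.continuous).integrable_of_hasCompactSupport hc.mul_right
  · exact fun x _ => hf.differentiable (by norm_num) x
  · exact fun x _ => hg.differentiable (by norm_num) x

lemma ibp_db {f g : E → ℂ} (hf : ContDiff ℝ 1 f) (hg : ContDiff ℝ 1 g)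
    (hc : HasCompactSupport f) (v : E) :
    ∫ x, f x * db v g x ∂μ = - ∫ x, db v f x * g x ∂μ := by
  have : FiniteDimensional ℝ E := FiniteDimensional.complexToReal E
  have hf1 : ∀ v, Continuous (fun x => fderiv ℝ f x v) := fun v =>
    (contDiff_fderiv_apply (n := 0) (by simpa using hf) v).continuous
  have hg1 : ∀ v, Continuous (fun x => fderiv ℝ g x v) := fun v =>
    (contDiff_fderiv_apply (n := 0) (by simpa using hg) v).continuous
  have hc1 : ∀ v, HasCompactSupport (fun x => fderiv ℝ f x v) :=
    fun v => hc.fderiv_apply (𝕜 := ℝ) v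
  have i1 : ∀ v, Integrable (fun x => f x * fderiv ℝ g x v) μ := fun v =>
    (hf.continuous.mul (hg1 v)).integrable_of_hasCompactSupport hc.mul_right
  have i2 : ∀ v, Integrable (fun x => fderiv ℝ f x v * g x) μ := fun v =>
    ((hf1 v).mul hg.continuous).integrable_of_hasCompactSupport (hc1 v).mul_right
  have e1 : ∀ x, f x * db v g x = (1 / 2 : ℂ) * (f x * fderiv ℝ g x v
      + I * (f x * fderiv ℝ g x (I • v))) := fun x => by simp only [db]; ring
  have e2 : ∀ x, db v f x * g x = (1 / 2 : ℂ) * (fderiv ℝ f x v * g x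
      + I * (fderiv ℝ f x (I • v) * g x)) := fun x => by simp only [db]; ring
  simp only [e1, e2]
  rw [integral_const_mul, integral_const_mul, integral_add (i1 v) ((i1 _).const_mul _),
    integral_add (i2 v) ((i2 _).const_mul _), integral_const_mul, integral_const_mul,
    ibp_aux μ hf hg hc, ibp_aux μ hf hg hc]
  ring

lemma ibp_dz {f g : E → ℂ} (hf : ContDiff ℝ 1 f) (hg : ContDiff ℝ 1 g)
    (hc : HasCompactSupport f) (v : E) :
    ∫ x, f x * dz v g x ∂μ = - ∫ x, dz v f x * g x ∂μ := by
  have : FiniteDimensional ℝ E := FiniteDimensional.complexToReal E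
  have hf1 : ∀ v, Continuous (fun x => fderiv ℝ f x v) := fun v =>
    (contDiff_fderiv_apply (n := 0) (by simpa using hf) v).continuous
  have hg1 : ∀ v, Continuous (fun x => fderiv ℝ g x v) := fun v =>
    (contDiff_fderiv_apply (n := 0) (by simpa using hg) v).continuous
  have hc1 : ∀ v, HasCompactSupport (fun x => fderiv ℝ f x v) :=
    fun v => hc.fderiv_apply (𝕜 := ℝ) v
  have i1 : ∀ v, Integrable (fun x => f x * fderiv ℝ g x v) μ := fun v =>
    (hf.continuous.mul (hg1 v)).integrable_of_hasCompactSupport hc.mul_right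
  have i2 : ∀ v, Integrable (fun x => fderiv ℝ f x v * g x) μ := fun v =>
    ((hf1 v).mul hg.continuous).integrable_of_hasCompactSupport (hc1 v).mul_right
  have e1 : ∀ x, f x * dz v g x = (1 / 2 : ℂ) * (f x * fderiv ℝ g x v
      - I * (f x * fderiv ℝ g x (I • v))) := fun x => by simp only [dz]; ring
  have e2 : ∀ x, dz v f x * g x = (1 / 2 : ℂ) * (fderiv ℝ f x v * g x
      - I * (fderiv ℝ f x (I • v) * g x)) := fun x => by simp only [dz]; ring
  simp only [e1, e2]
  rw [integral_const_mul, integral_const_mul, integral_sub (i1 v) ((i1 _).const_mul _),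
    integral_sub (i2 v) ((i2 _).const_mul _), integral_const_mul, integral_const_mul,
    ibp_aux μ hf hg hc, ibp_aux μ hf hg hc]
  ring

end ibp

end ModuleA

section ModuleA2
open MeasureTheory Complex

/-- The Levi form of a real function. -/
def Levi {E : Type*} [NormedAddCommGroup E] [NormedSpace ℂ E] (u : E → ℝ) (x ξ : E) : ℝ :=
  (fderiv ℝ (fderiv ℝ u) x ξ ξ + fderiv ℝ (fderiv ℝ u) x (I • ξ) (I • ξ)) / 4

section levi
variable {E : Type*} [NormedAddCommGroup E] [NormedSpace ℂ E]

lemma fderiv_ofReal_apply {φ : E → ℝ} {x : E} (h : DifferentiableAt ℝ φ x) (v : E) :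
    fderiv ℝ (fun y => (φ y : ℂ)) x v = ((fderiv ℝ φ x v : ℝ) : ℂ) := by
  have := (Complex.ofRealCLM.hasFDerivAt.comp x h.hasFDerivAt).fderiv
  have h2 : (fun y => (φ y : ℂ)) = (Complex.ofRealCLM ∘ φ) := by
    ext y; simp
  rw [h2, this]; simp

lemma fderiv2_ofReal_apply {φ : E → ℝ} {x : E} (h : ContDiffAt ℝ 2 φ x) (v w : E) :
    fderiv ℝ (fderiv ℝ (fun y => (φ y : ℂ))) x v w
      = ((fderiv ℝ (fderiv ℝ φ) x v w : ℝ) : ℂ) := by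
  have hC : ContDiffAt ℝ 2 (fun y => (φ y : ℂ)) x :=
    Complex.ofRealCLM.contDiff.contDiffAt.comp x h
  have h1 : DifferentiableAt ℝ (fderiv ℝ φ) x :=
    (h.fderiv_right (m := 1) (by norm_num)).differentiableAt (by norm_num)
  have h1C : DifferentiableAt ℝ (fderiv ℝ (fun y => (φ y : ℂ))) x :=
    (hC.fderiv_right (m := 1) (by norm_num)).differentiableAt (by norm_num)
  have e1 : fderiv ℝ (fderiv ℝ (fun y => (φ y : ℂ))) x v w
      = fderiv ℝ (fun y => fderiv ℝ (fun y => (φ y : ℂ)) y w) x v := by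
    rw [fderiv_clm_apply h1C (differentiableAt_const w)]; simp
  have e2 : fderiv ℝ (fderiv ℝ φ) x v w = fderiv ℝ (fun y => fderiv ℝ φ y w) x v := by
    rw [fderiv_clm_apply h1 (differentiableAt_const w)]; simp
  rw [e1, e2, ← fderiv_ofReal_apply (h1.clm_apply (differentiableAt_const w))]
  have hev : (fun y => fderiv ℝ (fun y => (φ y : ℂ)) y w) =ᶠ[𝓝 x]
      fun y => ((fderiv ℝ φ y w : ℝ) : ℂ) := by
    have : ∀ᶠ y in 𝓝 x, ContDiffAt ℝ 2 φ y := h.eventually (by simp)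
    filter_upwards [this] with y hy
    exact fderiv_ofReal_apply (hy.differentiableAt (by norm_num)) w
  rw [hev.fderiv_eq]

lemma dz_ofReal {φ : E → ℝ} {x : E} (h : DifferentiableAt ℝ φ x) (v : E) :
    dz v (fun y => (φ y : ℂ)) x = (1 / 2 : ℂ) * ((fderiv ℝ φ x v : ℝ)
      - I * (fderiv ℝ φ x (I • v) : ℝ)) := by
  simp only [dz, fderiv_ofReal_apply h]

lemma db_ofReal {φ : E → ℝ} {x : E} (h : DifferentiableAt ℝ φ x) (v : E) :
    db v (fun y => (φ y : ℂ)) x = (1 / 2 : ℂ) * ((fderiv ℝ φ x v : ℝ)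
      + I * (fderiv ℝ φ x (I • v) : ℝ)) := by
  simp only [db, fderiv_ofReal_apply h]

lemma db_ofReal_eq_conj {φ : E → ℝ} {x : E} (h : DifferentiableAt ℝ φ x) (v : E) :
    db v (fun y => (φ y : ℂ)) x = (starRingEnd ℂ) (dz v (fun y => (φ y : ℂ)) x) := by
  rw [db_ofReal h, dz_ofReal h]; simp [Complex.conj_ofNat]

/-- mixed second derivative -/
lemma db_dz_eq {f : E → ℂ} {x : E} (hf : ContDiffAt ℝ 2 f x) (u w : E) :
    db w (dz u f) x = (1 / 4 : ℂ) * (fderiv ℝ (fderiv ℝ f) x w u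
      - I * fderiv ℝ (fderiv ℝ f) x w (I • u) + I * fderiv ℝ (fderiv ℝ f) x (I • w) u
      + fderiv ℝ (fderiv ℝ f) x (I • w) (I • u)) := by
  rw [db, fderiv_dz hf, fderiv_dz hf]
  linear_combination (-1/4 * fderiv ℝ (fderiv ℝ f) x (I • w) (I • u)) * Complex.I_sq

lemma db_dz_add_left {f : E → ℂ} {x : E} (hf : ContDiffAt ℝ 2 f x) (u u' w : E) :
    db w (dz (u + u') f) x = db w (dz u f) x + db w (dz u' f) x := by
  simp only [db_dz_eq hf, smul_add, map_add]; ring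

lemma real_smul_re_im (D : E →L[ℝ] ℂ) (c : ℂ) (u : E) :
    D (c • u) = c.re * D u + c.im * D (I • u) := by
  have : c • u = (c.re : ℝ) • u + (c.im : ℝ) • (I • u) := by
    conv_lhs => rw [← Complex.re_add_im c]
    rw [add_smul, mul_smul]; simp
  rw [this, map_add, map_smul, map_smul]; simp

lemma db_dz_smul_left {f : E → ℂ} {x : E} (hf : ContDiffAt ℝ 2 f x) (c : ℂ) (u w : E) :
    db w (dz (c • u) f) x = c * db w (dz u f) x := by
  simp only [db_dz_eq hf, smul_smul, real_smul_re_im _ c, real_smul_re_im _ (I * c)]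
  conv_rhs => rw [← Complex.re_add_im c]
  simp only [Complex.mul_re, Complex.mul_im, Complex.I_re, Complex.I_im]
  push_cast
  linear_combination ((c.im : ℂ) / 4 * (fderiv ℝ (fderiv ℝ f) x w (I • u)
    - fderiv ℝ (fderiv ℝ f) x (I • w) u )) * Complex.I_sq

lemma db_dz_add_right {f : E → ℂ} {x : E} (hf : ContDiffAt ℝ 2 f x) (u w w' : E) :
    db (w + w') (dz u f) x = db w (dz u f) x + db w' (dz u f) x := by
  simp only [db_dz_eq hf, smul_add, map_add, add_apply]; ring

lemma db_dz_smul_right {f : E → ℂ} {x : E} (hf : ContDiffAt ℝ 2 f x) (c : ℂ) (u w : E) :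
    db (c • w) (dz u f) x = (starRingEnd ℂ) c * db w (dz u f) x := by
  simp only [db_dz_eq hf]
  rw [second_symm hf (c • w) u, second_symm hf (c • w) (I • u), second_symm hf (I • c • w) u,
    second_symm hf (I • c • w) (I • u), second_symm hf w u, second_symm hf (I • w) u,
    second_symm hf w (I • u), second_symm hf (I • w) (I • u)]
  simp only [smul_smul, real_smul_re_im _ c, real_smul_re_im _ (I * c)]
  have : (starRingEnd ℂ) c = c.re - c.im * I := by
    apply Complex.ext <;> simp
  rw [this]
  simp only [Complex.mul_re, Complex.mul_im, Complex.I_re, Complex.I_im]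
  push_cast
  linear_combination (-(c.im : ℂ) / 4 * (fderiv ℝ (fderiv ℝ f) x (I • u) w
    - fderiv ℝ (fderiv ℝ f) x u (I • w))) * Complex.I_sq

lemma Levi_eq_db_dz {φ : E → ℝ} {x : E} (h : ContDiffAt ℝ 2 φ x) (ξ : E) :
    (Levi φ x ξ : ℂ) = db ξ (dz ξ (fun y => (φ y : ℂ))) x := by
  have hC : ContDiffAt ℝ 2 (fun y => (φ y : ℂ)) x :=
    Complex.ofRealCLM.contDiff.contDiffAt.comp x h
  rw [db_dz_eq hC, second_symm hC (I • ξ) ξ]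
  simp only [fderiv2_ofReal_apply h, Levi]
  push_cast; ring

lemma db_dz_sum {f : E → ℂ} {x : E} (hf : ContDiffAt ℝ 2 f x) {N : ℕ} (b : Fin N → E)
    (a : Fin N → ℂ) : db (∑ k, a k • b k) (dz (∑ j, a j • b j) f) x
      = ∑ j, ∑ k, db (b k) (dz (b j) f) x * a j * (starRingEnd ℂ) (a k) := by
  have hl : ∀ w, IsLinearMap ℂ (fun u => db w (dz u f) x) := fun w =>
    ⟨fun u u' => db_dz_add_left hf u u' w, fun c u => db_dz_smul_left hf c u w⟩
  have h1 : ∀ w, db w (dz (∑ j, a j • b j) f) x = ∑ j, a j * db w (dz (b j) f) x := by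
    intro w
    have := map_sum (IsLinearMap.mk' _ (hl w)) (fun j => a j • b j) Finset.univ
    simp only [IsLinearMap.mk'_apply] at this
    rw [this]
    exact Finset.sum_congr rfl fun j _ => db_dz_smul_left hf _ _ _
  have h2 : ∀ u, db (∑ j, a j • b j) (dz u f) x
      = ∑ j, (starRingEnd ℂ) (a j) * db (b j) (dz u f) x := by
    intro u
    let T : E →+ ℂ := AddMonoidHom.mk' (fun w => db w (dz u f) x)
      (fun w w' => db_dz_add_right hf u w w')
    have := map_sum T (fun j => a j • b j) Finset.univ
    simp only [T, AddMonoidHom.mk'_apply] at this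
    rw [this]
    exact Finset.sum_congr rfl fun j _ => db_dz_smul_right hf _ _ _
  rw [h1]
  refine Finset.sum_congr rfl fun j _ => ?_
  rw [h2, Finset.mul_sum]
  exact Finset.sum_congr rfl fun k _ => by ring

lemma Levi_sum {φ : E → ℝ} {x : E} (h : ContDiffAt ℝ 2 φ x) {N : ℕ} (b : Fin N → E)
    (a : Fin N → ℂ) : (Levi φ x (∑ j, a j • b j) : ℂ)
      = ∑ j, ∑ k, db (b k) (dz (b j) (fun y => (φ y : ℂ))) x * a j * (starRingEnd ℂ) (a k) := by
  rw [Levi_eq_db_dz h, db_dz_sum]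
  exact Complex.ofRealCLM.contDiff.contDiffAt.comp x h

end levi

end ModuleA2

section ModuleA3
open MeasureTheory Complex

section basic0
variable {E : Type*} [NormedAddCommGroup E] [NormedSpace ℂ E]

/-- weight as a complex function -/
def cexpw (φ : E → ℝ) (x : E) : ℂ := ((Real.exp (-φ x) : ℝ) : ℂ)

/-- twisted derivative -/
def dtw (φ : E → ℝ) (v : E) (a : E → ℂ) (x : E) : ℂ :=
  dz v a x - dz v (fun y => (φ y : ℂ)) x * a x

lemma contDiff_cexpw {n : ℕ} {φ : E → ℝ} (hφ : ContDiff ℝ n φ) : ContDiff ℝ n (cexpw φ) :=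
  Complex.ofRealCLM.contDiff.comp (Real.contDiff_exp.comp hφ.neg)

lemma dz_cexpw {φ : E → ℝ} {x : E} (hφ : DifferentiableAt ℝ φ x) (v : E) :
    dz v (cexpw φ) x = - dz v (fun y => (φ y : ℂ)) x * cexpw φ x := by
  have h1 : HasFDerivAt (fun y => Real.exp (-φ y)) _ x := hφ.hasFDerivAt.neg.exp
  have : cexpw φ = fun y => ((Real.exp (-φ y) : ℝ) : ℂ) := rfl
  rw [this, dz_ofReal h1.differentiableAt, dz_ofReal hφ, h1.fderiv]
  simp; ring

end basic0

section basic
variable {E : Type*} [NormedAddCommGroup E] [InnerProductSpace ℂ E] [FiniteDimensional ℂ E]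
  [MeasurableSpace E] [BorelSpace E] (μ : Measure E) [μ.IsAddHaarMeasure]

lemma ibp_w1 {φ : E → ℝ} (hφ : ContDiff ℝ 1 φ) {a c : E → ℂ} (ha : ContDiff ℝ 1 a)
    (hc : ContDiff ℝ 1 c) (hca : HasCompactSupport a) (v : E) :
    ∫ x, dtw φ v a x * (starRingEnd ℂ) (c x) * cexpw φ x ∂μ
      = - ∫ x, a x * (starRingEnd ℂ) (db v c x) * cexpw φ x ∂μ := by
  have hW : ContDiff ℝ 1 (cexpw φ) := contDiff_cexpw (n := 1) hφ
  have hcs : ContDiff ℝ 1 (fun x => (starRingEnd ℂ) (c x)) :=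
    Complex.conjCLE.toContinuousLinearMap.contDiff.comp hc
  have := ibp_dz μ (f := fun x => a x * cexpw φ x) (g := fun x => (starRingEnd ℂ) (c x))
    (ha.mul hW) hcs hca.mul_right v
  have e1 : ∀ x, dz v (fun x => a x * cexpw φ x) x * (starRingEnd ℂ) (c x)
      = dtw φ v a x * (starRingEnd ℂ) (c x) * cexpw φ x := by
    intro x
    rw [dz_mul v (ha.differentiable (by norm_num) x) (hW.differentiable (by norm_num) x),
      dz_cexpw (hφ.differentiable (by norm_num) x), dtw]
    ring
  have e2 : ∀ x, a x * cexpw φ x * dz v (fun x => (starRingEnd ℂ) (c x)) x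
      = a x * (starRingEnd ℂ) (db v c x) * cexpw φ x := by
    intro x
    rw [dz_star (hc.differentiable (by norm_num) x)]; ring
  simp only [e1, e2] at this
  rw [this, neg_neg]

lemma ibp_w2 {φ : E → ℝ} (hφ : ContDiff ℝ 1 φ) {a c : E → ℂ} (ha : ContDiff ℝ 1 a)
    (hc : ContDiff ℝ 1 c) (hcc : HasCompactSupport c) (v : E) :
    ∫ x, a x * (starRingEnd ℂ) (dtw φ v c x) * cexpw φ x ∂μ
      = - ∫ x, db v a x * (starRingEnd ℂ) (c x) * cexpw φ x ∂μ := by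
  have := congrArg (starRingEnd ℂ) (ibp_w1 μ hφ hc ha hcc v)
  rw [map_neg, ← integral_conj, ← integral_conj] at this
  have e : ∀ x, (starRingEnd ℂ) (cexpw φ x) = cexpw φ x := fun x => Complex.conj_ofReal _
  simp only [map_mul, e, Complex.conj_conj] at this
  simp only [mul_comm (a _), mul_comm (db v a _)]
  exact this

lemma alg_ineq {N : ℕ} (A : Fin N → Fin N → ℂ) :
    - (∑ j, ∑ k, A k j * (starRingEnd ℂ) (A j k)).re ≤
      (1 / 2) * ∑ j, ∑ k, ‖A j k - A k j‖ ^ 2 := by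
  have e : ∀ j k, ‖A j k - A k j‖ ^ 2 = ‖A j k‖ ^ 2 + ‖A k j‖ ^ 2
      - 2 * (A k j * (starRingEnd ℂ) (A j k)).re := by
    intro j k
    rw [← Complex.normSq_eq_norm_sq, ← Complex.normSq_eq_norm_sq, ← Complex.normSq_eq_norm_sq]
    simp only [Complex.normSq_apply, Complex.sub_re, Complex.sub_im, Complex.mul_re,
      Complex.conj_re, Complex.conj_im]
    ring
  simp only [e, Finset.sum_sub_distrib, Finset.sum_add_distrib, ← Finset.mul_sum, Complex.re_sum]
  have : 0 ≤ ∑ j, ∑ k, ‖A j k‖ ^ 2 := by positivity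
  have : 0 ≤ ∑ j, ∑ k, ‖A k j‖ ^ 2 := by positivity
  linarith

theorem basic_ineq {N : ℕ} (b : Fin N → E) {φ : E → ℝ} (hφ : ContDiff ℝ 2 φ)
    {α : Fin N → E → ℂ} (hα : ∀ j, ContDiff ℝ 2 (α j)) (hc : ∀ j, HasCompactSupport (α j)) :
    ∫ x, Levi φ x (∑ j, α j x • b j) * Real.exp (-φ x) ∂μ ≤
      ∫ x, ‖∑ j, dtw φ (b j) (α j) x‖ ^ 2 * Real.exp (-φ x) ∂μ
      + ∫ x, (1 / 2) * (∑ j, ∑ k, ‖db (b j) (α k) x - db (b k) (α j) x‖ ^ 2)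
          * Real.exp (-φ x) ∂μ := by
  have hφ1 : ContDiff ℝ 1 φ := hφ.of_le (by norm_num)
  have hα1 : ∀ j, ContDiff ℝ 1 (α j) := fun j => (hα j).of_le (by norm_num)
  have hφC : ContDiff ℝ 2 (fun y => (φ y : ℂ)) := Complex.ofRealCLM.contDiff.comp hφ
  have hdφ : ∀ v, ContDiff ℝ 1 (dz v (fun y => (φ y : ℂ))) :=
    fun v => contDiff_dz (n := 1) hφC v
  have hdz : ∀ j v, ContDiff ℝ 1 (dz v (α j)) := fun j v => contDiff_dz (n := 1) (hα j) v
  have hdb : ∀ j v, ContDiff ℝ 1 (db v (α j)) := fun j v => contDiff_db (n := 1) (hα j) v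
  have hdt : ∀ j v, ContDiff ℝ 1 (dtw φ v (α j)) := fun j v =>
    (hdz j v).sub ((hdφ v).mul (hα1 j))
  have hcdb : ∀ j v, HasCompactSupport (db v (α j)) := fun j v => (hc j).db v
  have hcdt : ∀ j v, HasCompactSupport (dtw φ v (α j)) := fun j v =>
    ((hc j).dz v).sub ((hc j).mul_left)
  have hW : Continuous (cexpw φ) := (contDiff_cexpw (n := 1) hφ1).continuous
  have hWr : Continuous (fun x => Real.exp (-φ x)) := Real.continuous_exp.comp hφ.continuous.neg
  have hconj : ∀ {f : E → ℂ}, Continuous f → Continuous (fun x => (starRingEnd ℂ) (f x)) :=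
    fun hf => Complex.continuous_conj.comp hf
  have hWe : ∀ x, cexpw φ x = ((Real.exp (-φ x) : ℝ) : ℂ) := fun x => rfl
  -- first term
  have iT1 : ∀ j k, Integrable (fun x => dtw φ (b j) (α j) x *
      (starRingEnd ℂ) (dtw φ (b k) (α k) x) * cexpw φ x) μ := fun j k =>
    (((hdt j _).continuous.mul (hconj (hdt k _).continuous)).mul hW).integrable_of_hasCompactSupport
      ((hcdt j _).mul_right).mul_right
  have iT2 : ∀ j k, Integrable (fun x => db (b k) (α j) x *
      (starRingEnd ℂ) (db (b j) (α k) x) * cexpw φ x) μ := fun j k =>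
    (((hdb j _).continuous.mul (hconj (hdb k _).continuous)).mul hW).integrable_of_hasCompactSupport
      ((hcdb j _).mul_right).mul_right
  have eT1 : ∀ j k, ∫ x, dtw φ (b j) (α j) x * (starRingEnd ℂ) (dtw φ (b k) (α k) x)
      * cexpw φ x ∂μ
      = - ∫ x, db (b k) (dtw φ (b j) (α j)) x * (starRingEnd ℂ) (α k x) * cexpw φ x ∂μ :=
    fun j k => ibp_w2 μ hφ1 (hdt j _) (hα1 k) (hc k) _
  have eT2 : ∀ j k, ∫ x, db (b k) (α j) x * (starRingEnd ℂ) (db (b j) (α k) x) * cexpw φ x ∂μ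
      = - ∫ x, dtw φ (b j) (db (b k) (α j)) x * (starRingEnd ℂ) (α k x) * cexpw φ x ∂μ := by
    intro j k
    rw [ibp_w1 μ hφ1 (hdb j _) (hα1 k) (hcdb j _) (b j), neg_neg]
  have cdbdt : ∀ j v w, Continuous (db w (dtw φ v (α j))) := fun j v w =>
    (contDiff_db (n := 0) (by simpa using hdt j v) w).continuous
  have cdtdb : ∀ j v w, Continuous (dtw φ v (db w (α j))) := fun j v w =>
    (contDiff_dz (n := 0) (by simpa using hdb j w) v).continuous.sub
      ((hdφ v).continuous.mul (hdb j w).continuous)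
  have iU1 : ∀ j k, Integrable (fun x => db (b k) (dtw φ (b j) (α j)) x *
      (starRingEnd ℂ) (α k x) * cexpw φ x) μ := fun j k =>
    (((cdbdt j _ _).mul (hconj (hα k).continuous)).mul hW).integrable_of_hasCompactSupport
      (((hcdt j _).db _).mul_right).mul_right
  have iU2 : ∀ j k, Integrable (fun x => dtw φ (b j) (db (b k) (α j)) x *
      (starRingEnd ℂ) (α k x) * cexpw φ x) μ := fun j k =>
    (((cdtdb j _ _).mul (hconj (hα k).continuous)).mul hW).integrable_of_hasCompactSupport
      ((((hcdb j _).dz _).sub ((hcdb j _).mul_left)).mul_right).mul_right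
  have comm : ∀ j k x, dtw φ (b j) (db (b k) (α j)) x - db (b k) (dtw φ (b j) (α j)) x
      = db (b k) (dz (b j) (fun y => (φ y : ℂ))) x * α j x := by
    intro j k x
    have e1 : db (b k) (dtw φ (b j) (α j)) x = db (b k) (dz (b j) (α j)) x -
        db (b k) (fun y => dz (b j) (fun y => (φ y : ℂ)) y * α j y) x :=
      db_sub _ ((hdz j _).differentiable (by norm_num) x)
        (((hdφ _).mul (hα1 j)).differentiable (by norm_num) x)
    rw [e1, db_mul _ ((hdφ _).differentiable (by norm_num) x)
      ((hα1 j).differentiable (by norm_num) x), dtw, dz_db_comm (hα j).contDiffAt]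
    ring
  have key : ∀ j k, (∫ x, dtw φ (b j) (α j) x * (starRingEnd ℂ) (dtw φ (b k) (α k) x)
      * cexpw φ x ∂μ) - ∫ x, db (b k) (α j) x * (starRingEnd ℂ) (db (b j) (α k) x) * cexpw φ x ∂μ
      = ∫ x, db (b k) (dz (b j) (fun y => (φ y : ℂ))) x * α j x *
        (starRingEnd ℂ) (α k x) * cexpw φ x ∂μ := by
    intro j k
    rw [eT1, eT2, sub_neg_eq_add, neg_add_eq_sub, ← integral_sub (iU2 j k) (iU1 j k)]
    congr 1; ext x; rw [← comm]; ring
  -- sum up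
  have iL : ∀ j k, Integrable (fun x => db (b k) (dz (b j) (fun y => (φ y : ℂ))) x * α j x *
        (starRingEnd ℂ) (α k x) * cexpw φ x) μ := by
    intro j k
    refine ((iU2 j k).sub (iU1 j k)).congr (Filter.Eventually.of_forall fun x => ?_)
    simp only [Pi.sub_apply]; rw [← comm]; ring
  have hL : ((∫ x, Levi φ x (∑ j, α j x • b j) * Real.exp (-φ x) ∂μ : ℝ) : ℂ)
      = ∑ j, ∑ k, ∫ x, db (b k) (dz (b j) (fun y => (φ y : ℂ))) x * α j x *
        (starRingEnd ℂ) (α k x) * cexpw φ x ∂μ := by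
    rw [← integral_complex_ofReal]
    have : ∀ x, ((Levi φ x (∑ j, α j x • b j) * Real.exp (-φ x) : ℝ) : ℂ)
        = ∑ j, ∑ k, db (b k) (dz (b j) (fun y => (φ y : ℂ))) x * α j x *
        (starRingEnd ℂ) (α k x) * cexpw φ x := by
      intro x
      rw [Complex.ofReal_mul, Levi_sum hφ.contDiffAt, Finset.sum_mul, hWe]
      exact Finset.sum_congr rfl fun j _ => Finset.sum_mul _ _ _
    simp only [this]
    rw [integral_finsetSum _ fun j _ => integrable_finset_sum _ fun k _ => iL j k]
    exact Finset.sum_congr rfl fun j _ => integral_finsetSum _ fun k _ => iL j k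
  have h1 : ((∫ x, ‖∑ j, dtw φ (b j) (α j) x‖ ^ 2 * Real.exp (-φ x) ∂μ : ℝ) : ℂ)
      = ∑ j, ∑ k, ∫ x, dtw φ (b j) (α j) x * (starRingEnd ℂ) (dtw φ (b k) (α k) x)
      * cexpw φ x ∂μ := by
    rw [← integral_complex_ofReal]
    have : ∀ x, ((‖∑ j, dtw φ (b j) (α j) x‖ ^ 2 * Real.exp (-φ x) : ℝ) : ℂ)
        = ∑ j, ∑ k, dtw φ (b j) (α j) x * (starRingEnd ℂ) (dtw φ (b k) (α k) x) * cexpw φ x := by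
      intro x
      rw [Complex.ofReal_mul, Complex.ofReal_pow, ← Complex.mul_conj', map_sum, 
        Finset.sum_mul_sum, Finset.sum_mul, hWe]
      exact Finset.sum_congr rfl fun j _ => Finset.sum_mul _ _ _
    simp only [this]
    rw [integral_finsetSum _ fun j _ => integrable_finset_sum _ fun k _ => iT1 j k]
    exact Finset.sum_congr rfl fun j _ => integral_finsetSum _ fun k _ => iT1 j k
  set T2 : E → ℂ := fun x => ∑ j, ∑ k, db (b k) (α j) x *
      (starRingEnd ℂ) (db (b j) (α k) x) * cexpw φ x with hT2
  have iT2s : Integrable T2 μ :=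
    integrable_finset_sum _ fun j _ => integrable_finset_sum _ fun k _ => iT2 j k
  have h2 : ∫ x, T2 x ∂μ = ∑ j, ∑ k, ∫ x, db (b k) (α j) x *
      (starRingEnd ℂ) (db (b j) (α k) x) * cexpw φ x ∂μ := by
    rw [hT2, integral_finsetSum _ fun j _ => integrable_finset_sum _ fun k _ => iT2 j k]
    exact Finset.sum_congr rfl fun j _ => integral_finsetSum _ fun k _ => iT2 j k
  have h3 : ((∫ x, Levi φ x (∑ j, α j x • b j) * Real.exp (-φ x) ∂μ : ℝ) : ℂ)
    = ((∫ x, ‖∑ j, dtw φ (b j) (α j) x‖ ^ 2 * Real.exp (-φ x) ∂μ : ℝ) : ℂ) - ∫ x, T2 x ∂μ := by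
    rw [hL, h1, h2, ← Finset.sum_sub_distrib]
    refine Finset.sum_congr rfl fun j _ => ?_
    rw [← Finset.sum_sub_distrib]
    exact Finset.sum_congr rfl fun k _ => (key j k).symm
  have h4 := congrArg Complex.re h3
  rw [Complex.sub_re, Complex.ofReal_re, Complex.ofReal_re] at h4
  rw [h4, sub_eq_add_neg]
  gcongr
  have h5 : (∫ x, T2 x ∂μ).re = ∫ x, (T2 x).re ∂μ := (integral_re iT2s).symm
  rw [h5, ← integral_neg]
  refine integral_mono iT2s.re.neg ?_ fun x => ?_
  · refine Continuous.integrable_of_hasCompactSupport ?_ ?_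
    · refine (continuous_const.mul ?_).mul hWr
      refine continuous_finset_sum _ fun j _ => continuous_finset_sum _ fun k _ => ?_
      exact (((hdb k _).continuous.sub (hdb j _).continuous).norm).pow 2
    · refine HasCompactSupport.mul_right (HasCompactSupport.mul_left ?_)
      have : ∀ j k, HasCompactSupport fun x => ‖db (b j) (α k) x - db (b k) (α j) x‖ ^ 2 :=
        fun j k => (((hcdb k (b j)).sub (hcdb j (b k))).norm).comp_left (g := fun t : ℝ => t ^ 2)
          (by simp)
      let T : Set E := ⋃ j, ⋃ k, tsupport fun x => ‖db (b j) (α k) x - db (b k) (α j) x‖ ^ 2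
      have hT : IsCompact T := isCompact_iUnion fun j => isCompact_iUnion fun k => this j k
      refine HasCompactSupport.intro hT fun x hx => ?_
      simp only [T, mem_iUnion, not_exists] at hx
      exact Finset.sum_eq_zero fun j _ => Finset.sum_eq_zero fun k _ =>
        image_eq_zero_of_notMem_tsupport
          (f := fun x => ‖db (b j) (α k) x - db (b k) (α j) x‖ ^ 2) (hx j k)
  · have e : T2 x = (∑ j, ∑ k, db (b k) (α j) x * (starRingEnd ℂ) (db (b j) (α k) x))
        * ((Real.exp (-φ x) : ℝ) : ℂ) := by
      simp only [hT2, Finset.sum_mul, hWe]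
    simp only [Pi.neg_apply]
    change -(T2 x).re ≤ _
    rw [e, Complex.re_mul_ofReal, ← neg_mul]
    exact mul_le_mul_of_nonneg_right (alg_ineq fun j k => db (b j) (α k) x) (Real.exp_pos _).le

end basic

end ModuleA3

section ModuleB1
open MeasureTheory Complex Filter

section kernel
variable {E : Type*} [NormedAddCommGroup E] [InnerProductSpace ℂ E] [FiniteDimensional ℂ E]
  [MeasurableSpace E] [BorelSpace E] (μ : Measure E) [μ.IsAddHaarMeasure]

/-- unnormalised radial bump -/
def kern0 (ε : ℝ) (x : E) : ℝ := Real.smoothTransition (1 - ‖x‖ ^ 2 / ε ^ 2)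

/-- radial mollifier -/
def kern (ε : ℝ) (x : E) : ℝ := kern0 ε x / ∫ y, kern0 ε y ∂μ

lemma kern0_contDiff (ε : ℝ) (n : ℕ∞) : ContDiff ℝ n (kern0 ε : E → ℝ) := by
  have : ContDiff ℝ n fun x : E => ‖x‖ ^ 2 := contDiff_norm_sq ℂ
  exact Real.smoothTransition.contDiff.comp (contDiff_const.sub (this.div_const _))

lemma kern_contDiff (ε : ℝ) (n : ℕ∞) : ContDiff ℝ n (kern μ ε : E → ℝ) :=
  (kern0_contDiff ε n).div_const _

lemma kern0_nonneg (ε : ℝ) (x : E) : 0 ≤ kern0 ε x := Real.smoothTransition.nonneg _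

lemma kern0_le_one (ε : ℝ) (x : E) : kern0 ε x ≤ 1 := Real.smoothTransition.le_one _

lemma kern0_eq_zero {ε : ℝ} (hε : 0 < ε) {x : E} (hx : ε ≤ ‖x‖) : kern0 ε x = 0 := by
  apply Real.smoothTransition.zero_of_nonpos
  rw [sub_nonpos, one_le_div (by positivity)]
  gcongr

lemma kern0_hasCompactSupport {ε : ℝ} (hε : 0 < ε) :
    HasCompactSupport (kern0 ε : E → ℝ) := by
  have : ProperSpace E := FiniteDimensional.proper ℂ E
  refine HasCompactSupport.intro (isCompact_closedBall 0 ε) fun x hx => kern0_eq_zero hε ?_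
  simp only [Metric.mem_closedBall, dist_zero_right, not_le] at hx
  exact hx.le

lemma kern0_integrable {ε : ℝ} (hε : 0 < ε) : Integrable (kern0 ε : E → ℝ) μ :=
  (kern0_contDiff ε 0).continuous.integrable_of_hasCompactSupport (kern0_hasCompactSupport hε)

/-- lower bound for the integral of the bump -/
lemma kern0_integral_lb : ∃ c > 0, ∀ ε : ℝ, 0 < ε →
    c * ε ^ (Module.finrank ℝ E) ≤ ∫ y, kern0 ε y ∂μ := by
  have hfd : FiniteDimensional ℝ E := FiniteDimensional.complexToReal E
  set c0 := Real.smoothTransition (3 / 4) with hc0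
  have hc0p : 0 < c0 := Real.smoothTransition.pos_of_pos (by norm_num)
  have hm : 0 < (μ (Metric.ball (0 : E) (1 / 2))).toReal := by
    refine ENNReal.toReal_pos (Metric.measure_ball_pos μ 0 (by norm_num)).ne' ?_
    exact measure_ball_lt_top.ne
  refine ⟨c0 * (μ (Metric.ball (0 : E) (1 / 2))).toReal, by positivity, fun ε hε => ?_⟩
  have h1 : μ (Metric.ball (0 : E) (ε * (1 / 2))) = ENNReal.ofReal (ε ^ Module.finrank ℝ E) *
      μ (Metric.ball (0 : E) (1 / 2)) := Measure.addHaar_ball_mul_of_pos μ 0 hε _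
  have h2 : (μ (Metric.ball (0 : E) (ε * (1 / 2)))).toReal
      = ε ^ Module.finrank ℝ E * (μ (Metric.ball (0 : E) (1 / 2))).toReal := by
    rw [h1, ENNReal.toReal_mul, ENNReal.toReal_ofReal (by positivity)]
  calc c0 * (μ (Metric.ball (0 : E) (1 / 2))).toReal * ε ^ Module.finrank ℝ E
      = ∫ y in Metric.ball (0 : E) (ε * (1 / 2)), c0 ∂μ := by
        rw [setIntegral_const, smul_eq_mul, Measure.real, h2]; ring
    _ ≤ ∫ y in Metric.ball (0 : E) (ε * (1 / 2)), kern0 ε y ∂μ := by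
        refine setIntegral_mono_on (integrableOn_const measure_ball_lt_top.ne)
          (kern0_integrable μ hε).integrableOn measurableSet_ball fun x hx => ?_
        simp only [Metric.mem_ball, dist_zero_right] at hx
        apply Real.smoothTransition.monotone
        have : ‖x‖ ^ 2 / ε ^ 2 ≤ 1 / 4 := by
          rw [div_le_iff₀ (by positivity)]
          nlinarith [norm_nonneg x]
        linarith
    _ ≤ ∫ y, kern0 ε y ∂μ :=
        setIntegral_le_integral (kern0_integrable μ hε) (Eventually.of_forall (kern0_nonneg ε))

lemma kern0_integral_pos {ε : ℝ} (hε : 0 < ε) : 0 < ∫ y, kern0 (E := E) ε y ∂μ := by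
  obtain ⟨c, hc, h⟩ := kern0_integral_lb (E := E) μ
  exact lt_of_lt_of_le (by positivity) (h ε hε)

lemma kern_nonneg {ε : ℝ} (hε : 0 < ε) (x : E) : 0 ≤ kern μ ε x :=
  div_nonneg (kern0_nonneg _ _) (kern0_integral_pos μ hε).le

lemma kern_eq_zero {ε : ℝ} (hε : 0 < ε) {x : E} (hx : ε ≤ ‖x‖) : kern μ ε x = 0 := by
  rw [kern, kern0_eq_zero hε hx, zero_div]

lemma kern_hasCompactSupport {ε : ℝ} (hε : 0 < ε) :
    HasCompactSupport (kern μ ε : E → ℝ) := by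
  have : ProperSpace E := FiniteDimensional.proper ℂ E
  refine HasCompactSupport.intro (isCompact_closedBall 0 ε) fun x hx => kern_eq_zero μ hε ?_
  simp only [Metric.mem_closedBall, dist_zero_right, not_le] at hx
  exact hx.le

lemma kern_integrable {ε : ℝ} (hε : 0 < ε) : Integrable (kern μ ε : E → ℝ) μ :=
  (kern0_integrable μ hε).div_const _

lemma kern_integral {ε : ℝ} (hε : 0 < ε) : ∫ x, kern μ ε x ∂μ = 1 := by
  simp only [kern]
  rw [integral_div, div_self (kern0_integral_pos μ hε).ne']

lemma kern_smul {ε : ℝ} {c : ℂ} (hc : ‖c‖ = 1) (x : E) : kern μ ε (c • x) = kern μ ε x := by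
  simp [kern, kern0, norm_smul, hc]

lemma kern_neg {ε : ℝ} (x : E) : kern μ ε (-x) = kern μ ε x := by
  simp [kern, kern0]

lemma kern_le : ∃ C > 0, ∀ ε : ℝ, 0 < ε → ∀ x : E,
    kern μ ε x ≤ C / ε ^ (Module.finrank ℝ E) := by
  obtain ⟨c, hc, h⟩ := kern0_integral_lb (E := E) μ
  refine ⟨1 / c, by positivity, fun ε hε x => ?_⟩
  rw [kern, div_div]
  exact div_le_div₀ zero_le_one (kern0_le_one _ _) (by positivity) (h ε hε)

/-- lintegral version of the total mass -/
lemma kern_lintegral {ε : ℝ} (hε : 0 < ε) : ∫⁻ x, ENNReal.ofReal (kern μ ε x) ∂μ = 1 := by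
  rw [← ofReal_integral_eq_lintegral_ofReal (kern_integrable μ hε)
    (Eventually.of_forall (kern_nonneg μ hε)), kern_integral μ hε, ENNReal.ofReal_one]

lemma eLpNorm_two_sq {α F : Type*} [MeasurableSpace α] [NormedAddCommGroup F] (ν : Measure α)
    (f : α → F) : eLpNorm f 2 ν ^ 2 = ∫⁻ x, ‖f x‖ₑ ^ 2 ∂ν := by
  rw [eLpNorm_eq_lintegral_rpow_enorm_toReal (by norm_num) (by norm_num)]
  rw [← ENNReal.rpow_natCast, ← ENNReal.rpow_mul]
  simp

lemma lintegral_sq_jensen {α F : Type*} [MeasurableSpace α] [NormedAddCommGroup F]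
    (ν : Measure α) [IsProbabilityMeasure ν]
    {f : α → F} (hf : AEStronglyMeasurable f ν) :
    (∫⁻ x, ‖f x‖ₑ ∂ν) ^ 2 ≤ ∫⁻ x, ‖f x‖ₑ ^ 2 ∂ν := by
  rw [← eLpNorm_two_sq, ← eLpNorm_one_eq_lintegral_enorm]
  gcongr
  exact eLpNorm_le_eLpNorm_of_exponent_le (by norm_num) hf

lemma kern_jensen {ε : ℝ} (hε : 0 < ε) {g : E → ℂ} (hg : AEStronglyMeasurable g μ) :
    ‖∫ t, (kern μ ε t : ℂ) * g t ∂μ‖ₑ ^ 2 ≤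
      ∫⁻ t, ENNReal.ofReal (kern μ ε t) * ‖g t‖ₑ ^ 2 ∂μ := by
  have hk : Measurable fun t : E => ENNReal.ofReal (kern μ ε t) :=
    (kern_contDiff μ ε 0).continuous.measurable.ennreal_ofReal
  set ν := μ.withDensity (fun t => ENNReal.ofReal (kern μ ε t)) with hν
  have : IsProbabilityMeasure ν := ⟨by
    rw [hν, withDensity_apply _ MeasurableSet.univ, setLIntegral_univ, kern_lintegral μ hε]⟩
  have h1 : ‖∫ t, (kern μ ε t : ℂ) * g t ∂μ‖ₑ ≤ ∫⁻ t, ‖g t‖ₑ ∂ν := by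
    refine (enorm_integral_le_lintegral_enorm _).trans ?_
    rw [hν, lintegral_withDensity_eq_lintegral_mul₀ hk.aemeasurable hg.enorm]
    refine lintegral_mono fun t => ?_
    simp only [enorm_mul, Pi.mul_apply]
    gcongr
    rw [← ofReal_norm_eq_enorm, Complex.norm_real, Real.norm_of_nonneg (kern_nonneg μ hε t)]
  calc _ ≤ (∫⁻ t, ‖g t‖ₑ ∂ν) ^ 2 := by gcongr
    _ ≤ ∫⁻ t, ‖g t‖ₑ ^ 2 ∂ν := lintegral_sq_jensen ν
        (hg.mono_ac (withDensity_absolutelyContinuous _ _))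
    _ = _ := by
      rw [hν, lintegral_withDensity_eq_lintegral_mul₀ hk.aemeasurable (hg.enorm.pow_const 2)]
      rfl

/-- mollification -/
def moll (ε : ℝ) (f : E → ℂ) (x : E) : ℂ := ∫ y, f y * (kern μ ε (x - y) : ℂ) ∂μ

lemma moll_eq (ε : ℝ) (f : E → ℂ) (x : E) :
    moll μ ε f x = ∫ t, (kern μ ε t : ℂ) * f (x - t) ∂μ := by
  rw [moll, ← integral_sub_left_eq_self (fun y => f y * (kern μ ε (x - y) : ℂ)) μ x]
  congr 1; ext t; rw [sub_sub_cancel, mul_comm]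

section conv
variable {f g : E → ℂ}

lemma conv_contDiff (hf : LocallyIntegrable f μ) (hg : ContDiff ℝ 2 g)
    (hgc : HasCompactSupport g) : ContDiff ℝ 2 (fun x => ∫ y, f y * g (x - y) ∂μ) :=
  hgc.contDiff_convolution_right (n := 2) (ContinuousLinearMap.mul ℝ ℂ) hf hg

lemma conv_fderiv (hf : LocallyIntegrable f μ) (hg : ContDiff ℝ 1 g)
    (hgc : HasCompactSupport g) (x v : E) : fderiv ℝ (fun x => ∫ y, f y * g (x - y) ∂μ) x v
      = ∫ y, f y * fderiv ℝ g (x - y) v ∂μ := by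
  have h := hgc.hasFDerivAt_convolution_right (ContinuousLinearMap.mul ℝ ℂ) hf hg x
  have h2 : convolution f g (ContinuousLinearMap.mul ℝ ℂ) μ = fun x => ∫ y, f y * g (x - y) ∂μ := rfl
  rw [h2] at h
  rw [h.fderiv, convolution_precompR_apply _ hf (hgc.fderiv ℝ) (hg.continuous_fderiv (by norm_num))]
  rfl

lemma fderiv_refl (hg : ContDiff ℝ 1 g) (x y v : E) :
    fderiv ℝ (fun y => g (x - y)) y v = - fderiv ℝ g (x - y) v := by
  have h1 : HasFDerivAt (fun y : E => x - y) (-ContinuousLinearMap.id ℝ E) y := by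
    simpa using (hasFDerivAt_id y).const_sub x
  have := ((hg.differentiable (by norm_num) (x - y)).hasFDerivAt.comp y h1).fderiv
  rw [show (fun y => g (x - y)) = g ∘ fun y => x - y from rfl, this]
  simp

lemma conv_int (hf : LocallyIntegrable f μ) (hg : Continuous g)
    (hgc : HasCompactSupport g) (x : E) : Integrable (fun y => f y * g (x - y)) μ :=
  (hgc.convolutionExists_right (ContinuousLinearMap.mul ℝ ℂ) hf hg x)

lemma conv_db (hf : LocallyIntegrable f μ) (hg : ContDiff ℝ 1 g)
    (hgc : HasCompactSupport g) (x v : E) : db v (fun x => ∫ y, f y * g (x - y) ∂μ) x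
      = - ∫ y, f y * db v (fun y => g (x - y)) y ∂μ := by
  have i1 : ∀ w, Integrable (fun y => f y * fderiv ℝ g (x - y) w) μ := fun w =>
    conv_int μ hf ((hg.continuous_fderiv (by norm_num)).clm_apply continuous_const)
      (hgc.fderiv_apply (𝕜 := ℝ) w) x
  simp only [db, conv_fderiv μ hf hg hgc, fderiv_refl hg]
  have e : ∀ y, f y * (1 / 2 * (-fderiv ℝ g (x - y) v + I * -fderiv ℝ g (x - y) (I • v)))
    = -(1 / 2) * (f y * fderiv ℝ g (x - y) v + I * (f y * fderiv ℝ g (x - y) (I • v))) :=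
    fun y => by ring
  simp only [e]
  rw [integral_const_mul, integral_add (i1 v) ((i1 _).const_mul I), integral_const_mul]
  ring

lemma conv_dz (hf : LocallyIntegrable f μ) (hg : ContDiff ℝ 1 g)
    (hgc : HasCompactSupport g) (x v : E) : dz v (fun x => ∫ y, f y * g (x - y) ∂μ) x
      = - ∫ y, f y * dz v (fun y => g (x - y)) y ∂μ := by
  have i1 : ∀ w, Integrable (fun y => f y * fderiv ℝ g (x - y) w) μ := fun w =>
    conv_int μ hf ((hg.continuous_fderiv (by norm_num)).clm_apply continuous_const)
      (hgc.fderiv_apply (𝕜 := ℝ) w) x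
  simp only [dz, conv_fderiv μ hf hg hgc, fderiv_refl hg]
  have e : ∀ y, f y * (1 / 2 * (-fderiv ℝ g (x - y) v - I * -fderiv ℝ g (x - y) (I • v)))
    = -(1 / 2) * (f y * fderiv ℝ g (x - y) v - I * (f y * fderiv ℝ g (x - y) (I • v))) :=
    fun y => by ring
  simp only [e]
  rw [integral_const_mul, integral_sub (i1 v) ((i1 _).const_mul I), integral_const_mul]
  ring
end conv

/-- complex-valued kernel -/
def kernC (ε : ℝ) (x : E) : ℂ := (kern μ ε x : ℂ)

lemma kernC_contDiff (ε : ℝ) (n : ℕ∞) : ContDiff ℝ n (kernC μ ε : E → ℂ) :=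
  Complex.ofRealCLM.contDiff.comp (kern_contDiff μ ε n)

lemma kernC_hasCompactSupport {ε : ℝ} (hε : 0 < ε) :
    HasCompactSupport (kernC μ ε : E → ℂ) :=
  (kern_hasCompactSupport μ hε).comp_left (g := fun t : ℝ => (t : ℂ)) (by simp)

lemma moll_contDiff {ε : ℝ} (hε : 0 < ε) {f : E → ℂ} (hf : LocallyIntegrable f μ) :
    ContDiff ℝ 2 (moll μ ε f) :=
  conv_contDiff μ (g := kernC μ ε) hf (kernC_contDiff μ ε 2) (kernC_hasCompactSupport μ hε)

lemma moll_db {ε : ℝ} (hε : 0 < ε) {f : E → ℂ} (hf : LocallyIntegrable f μ) (x v : E) :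
    db v (moll μ ε f) x = - ∫ y, f y * db v (fun y => kernC μ ε (x - y)) y ∂μ :=
  conv_db μ (g := kernC μ ε) hf (kernC_contDiff μ ε 1) (kernC_hasCompactSupport μ hε) x v

lemma moll_dz {ε : ℝ} (hε : 0 < ε) {f : E → ℂ} (hf : LocallyIntegrable f μ) (x v : E) :
    dz v (moll μ ε f) x = - ∫ y, f y * dz v (fun y => kernC μ ε (x - y)) y ∂μ :=
  conv_dz μ (g := kernC μ ε) hf (kernC_contDiff μ ε 1) (kernC_hasCompactSupport μ hε) x v

/-- support of the translated kernel -/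
lemma kernC_refl_contDiff (ε : ℝ) (n : ℕ∞) (x : E) :
    ContDiff ℝ n (fun y => kernC μ ε (x - y)) :=
  (kernC_contDiff μ ε n).comp (contDiff_const.sub contDiff_id)

lemma kernC_refl_tsupport {ε : ℝ} (hε : 0 < ε) (x : E) :
    tsupport (fun y => kernC μ ε (x - y)) ⊆ Metric.closedBall x ε := by
  refine closure_minimal (fun y hy => ?_) Metric.isClosed_closedBall
  by_contra h
  apply hy
  simp only [Metric.mem_closedBall, not_le] at h
  have : kern μ ε (x - y) = 0 := kern_eq_zero μ hε (by rw [← dist_eq_norm, dist_comm]; exact h.le)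
  simp [kernC, this]

lemma kernC_refl_hasCompactSupport {ε : ℝ} (hε : 0 < ε) (x : E) :
    HasCompactSupport (fun y => kernC μ ε (x - y)) := by
  have : ProperSpace E := FiniteDimensional.proper ℂ E
  exact (isCompact_closedBall x ε).of_isClosed_subset (isClosed_tsupport _)
    (kernC_refl_tsupport μ hε x)

lemma moll_eq_zero {ε : ℝ} (hε : 0 < ε) {f : E → ℂ} {x : E}
    (h : ∀ y ∈ Metric.ball x ε, f y = 0) : moll μ ε f x = 0 := by
  rw [moll]
  refine integral_eq_zero_of_ae (Eventually.of_forall fun y => ?_)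
  by_cases hy : y ∈ Metric.ball x ε
  · simp [h y hy]
  · have : kern μ ε (x - y) = 0 := kern_eq_zero μ hε (by
      rw [← dist_eq_norm, dist_comm]; simpa using hy)
    simp [this]

end kernel

end ModuleB1

section ModuleB2
open MeasureTheory Complex Filter

section L2
variable {E : Type*} [NormedAddCommGroup E] [InnerProductSpace ℂ E] [FiniteDimensional ℂ E]
  [MeasurableSpace E] [BorelSpace E] (μ : Measure E) [μ.IsAddHaarMeasure]

lemma translate_L2 {f : E → ℂ} (hf : MemLp f 2 μ) :
    Tendsto (fun t => ∫⁻ x, ‖f (x - t) - f x‖ₑ ^ 2 ∂μ) (𝓝 0) (𝓝 0) := by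
  have : ProperSpace E := FiniteDimensional.proper ℂ E
  let g : E → C(E, E) := fun t => ⟨fun x => x - t, continuous_id.sub continuous_const⟩
  have hg : Continuous g := ContinuousMap.continuous_of_continuous_uncurry _
    (continuous_snd.sub continuous_fst)
  have hgm : ∀ t, MeasurePreserving (g t) μ μ := fun t => measurePreserving_sub_right μ t
  let F : Lp ℂ 2 μ := hf.toLp f
  have hcont : Continuous (fun t => Lp.compMeasurePreserving (g t) (hgm t) F) :=
    (continuous_const (y := F)).compMeasurePreservingLp hg hgm (by norm_num)
  have h0 := hcont.tendsto 0
  rw [tendsto_iff_edist_tendsto_0] at h0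
  have h1 : Tendsto (fun t => edist (Lp.compMeasurePreserving (g t) (hgm t) F)
      (Lp.compMeasurePreserving (g 0) (hgm 0) F) ^ 2) (𝓝 0) (𝓝 0) := by
    simpa [Function.comp_def] using (ENNReal.continuous_pow 2).continuousAt.tendsto.comp h0
  refine h1.congr fun t => ?_
  rw [Lp.edist_def, eLpNorm_two_sq]
  refine lintegral_congr_ae ?_
  have e1 : ∀ t, Lp.compMeasurePreserving (g t) (hgm t) F =ᵐ[μ] fun x => f (x - t) := by
    intro t
    refine (Lp.coeFn_compMeasurePreserving F (hgm t)).trans ?_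
    exact (hgm t).quasiMeasurePreserving.ae_eq_comp hf.coeFn_toLp
  filter_upwards [e1 t, e1 0] with x h1 h2
  simp only [Pi.sub_apply]
  rw [h1, h2, sub_zero]

lemma moll_sub {ε : ℝ} (hε : 0 < ε) {f : E → ℂ} (hf : LocallyIntegrable f μ) (x : E) :
    moll μ ε f x - f x = ∫ t, (kern μ ε t : ℂ) * (f (x - t) - f x) ∂μ := by
  have h1 : Integrable (fun t => (kern μ ε t : ℂ) * f (x - t)) μ := by
    have := (conv_int μ hf (kernC_contDiff μ ε 0).continuous
      (kernC_hasCompactSupport μ hε) x).comp_sub_left x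
    refine this.congr (Eventually.of_forall fun t => ?_)
    simp only [sub_sub_cancel, kernC]; ring
  have h2 : Integrable (fun t => (kern μ ε t : ℂ) * f x) μ :=
    ((kern_integrable μ hε).ofReal).mul_const _
  simp only [mul_sub]
  rw [integral_sub h1 h2, moll_eq, integral_mul_const, integral_complex_ofReal,
    kern_integral μ hε]
  simp

lemma moll_L2_bound {ε : ℝ} (hε : 0 < ε) {f : E → ℂ} (hf : MemLp f 2 μ) :
    ∫⁻ x, ‖moll μ ε f x - f x‖ₑ ^ 2 ∂μ ≤
      ∫⁻ t, ENNReal.ofReal (kern μ ε t) * ∫⁻ x, ‖f (x - t) - f x‖ₑ ^ 2 ∂μ ∂μ := by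
  have : ProperSpace E := FiniteDimensional.proper ℂ E
  have hli : LocallyIntegrable f μ := hf.locallyIntegrable (by norm_num)
  have hm2 : AEStronglyMeasurable (fun p : E × E => f (p.1 - p.2) - f p.1) (μ.prod μ) := by
    refine AEStronglyMeasurable.sub ?_ (hf.1.comp_fst)
    exact hf.1.comp_quasiMeasurePreserving (quasiMeasurePreserving_sub μ μ)
  have hm3 : AEMeasurable (fun p : E × E => ENNReal.ofReal (kern μ ε p.2)
      * ‖f (p.1 - p.2) - f p.1‖ₑ ^ 2) (μ.prod μ) := by
    refine AEMeasurable.mul ?_ (hm2.enorm.pow_const 2)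
    exact ((kern_contDiff μ ε 0).continuous.measurable.ennreal_ofReal.comp
      measurable_snd).aemeasurable
  calc _ ≤ ∫⁻ x, ∫⁻ t, ENNReal.ofReal (kern μ ε t) * ‖f (x - t) - f x‖ₑ ^ 2 ∂μ ∂μ := by
        refine lintegral_mono fun x => ?_
        simp only
        rw [moll_sub μ hε hli]
        apply kern_jensen μ hε
        refine AEStronglyMeasurable.sub ?_ aestronglyMeasurable_const
        exact hf.1.comp_quasiMeasurePreserving (quasiMeasurePreserving_sub_left μ x)
    _ = ∫⁻ t, ∫⁻ x, ENNReal.ofReal (kern μ ε t) * ‖f (x - t) - f x‖ₑ ^ 2 ∂μ ∂μ :=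
        lintegral_lintegral_swap hm3
    _ = _ := by
        refine lintegral_congr fun t => ?_
        rw [lintegral_const_mul' _ _ ENNReal.ofReal_ne_top]

lemma moll_L2 {f : E → ℂ} (hf : MemLp f 2 μ) :
    Tendsto (fun ε => ∫⁻ x, ‖moll μ ε f x - f x‖ₑ ^ 2 ∂μ) (𝓝[>] 0) (𝓝 0) := by
  rw [ENNReal.tendsto_nhds_zero]
  intro δ hδ
  have h1 := translate_L2 μ hf
  rw [ENNReal.tendsto_nhds_zero] at h1
  obtain ⟨r, hr, hball⟩ := Metric.eventually_nhds_iff.mp (h1 δ hδ)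
  have : Ioo (0 : ℝ) r ∈ 𝓝[>] (0 : ℝ) := Ioo_mem_nhdsGT hr
  filter_upwards [this] with ε hε
  refine (moll_L2_bound μ hε.1 hf).trans ?_
  calc _ ≤ ∫⁻ t, ENNReal.ofReal (kern μ ε t) * δ ∂μ := by
        refine lintegral_mono fun t => ?_
        by_cases ht : ‖t‖ < ε
        · simp only
          gcongr
          exact hball (by simpa using ht.trans hε.2)
        · simp [kern_eq_zero μ hε.1 (not_lt.mp ht)]
    _ = δ := by
        rw [lintegral_mul_const _ ((kern_contDiff μ ε 0).continuous.measurable.ennreal_ofReal),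
          kern_lintegral μ hε.1, one_mul]

end L2

end ModuleB2

section ModuleB3
open MeasureTheory Complex Filter

section MV
variable {E : Type*} [NormedAddCommGroup E] [InnerProductSpace ℂ E] [FiniteDimensional ℂ E]
  [MeasurableSpace E] [BorelSpace E] (μ : Measure E) [μ.IsAddHaarMeasure]

lemma smul_mp {c : ℂ} (hc : ‖c‖ = 1) : MeasurePreserving (fun x : E => c • x) μ μ := by
  have : FiniteDimensional ℝ E := FiniteDimensional.complexToReal E
  have : ProperSpace E := FiniteDimensional.proper ℂ E
  have hc0 : c ≠ 0 := by rintro rfl; simp at hc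
  let f : E →ₗ[ℝ] E := (LinearMap.lsmul ℂ E c).restrictScalars ℝ
  have hf : ∀ x, f x = c • x := fun x => rfl
  have h1 := Measure.addHaar_image_linearMap μ f (Metric.ball 0 1)
  have h2 : f '' Metric.ball 0 1 = Metric.ball 0 1 := by
    ext y
    simp only [mem_image, Metric.mem_ball, dist_zero_right, hf]
    constructor
    · rintro ⟨x, hx, rfl⟩
      rwa [norm_smul, hc, one_mul]
    · intro hy
      refine ⟨c⁻¹ • y, ?_, ?_⟩
      · rwa [norm_smul, norm_inv, hc, inv_one, one_mul]
      · rw [smul_smul, mul_inv_cancel₀ hc0, one_smul]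
  rw [h2] at h1
  have hpos : μ (Metric.ball (0:E) 1) ≠ 0 := (Metric.measure_ball_pos μ 0 one_pos).ne'
  have hfin : μ (Metric.ball (0:E) 1) ≠ ⊤ := measure_ball_lt_top.ne
  have h3 : ENNReal.ofReal |LinearMap.det f| = 1 := by
    rwa [eq_comm, ENNReal.mul_eq_right hpos hfin] at h1
  have h4 : |LinearMap.det f| = 1 := by
    rwa [ENNReal.ofReal_eq_one] at h3
  have h5 : LinearMap.det f ≠ 0 := by intro h; rw [h] at h4; simp at h4
  refine ⟨by fun_prop, ?_⟩
  have h6 := Measure.map_linearMap_addHaar_eq_smul_addHaar μ h5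
  rw [abs_inv, h4] at h6
  have h7 : (fun x : E => c • x) = f := by ext x; rw [hf]
  rw [h7]
  simpa using h6

variable {V : Set E} {G : E → ℂ}

lemma kern_mul_cont (hV : IsOpen V) (hG : ContinuousOn G V) {ε : ℝ} (hε : 0 < ε)
    {x : E} (hx : Metric.closedBall x ε ⊆ V) :
    Continuous (fun p : ℝ × E => (kern μ ε p.2 : ℂ) * G (x - exp (p.1 * I) • p.2)) := by
  rw [continuous_iff_continuousAt]
  rintro ⟨θ, t⟩
  have hk : Continuous (fun p : ℝ × E => (kern μ ε p.2 : ℂ)) :=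
    (kernC_contDiff μ ε 0).continuous.comp continuous_snd
  by_cases ht : ‖t‖ ≤ ε
  · refine hk.continuousAt.mul ?_
    have hmem : x - exp (θ * I) • t ∈ V := by
      apply hx
      simpa [Metric.mem_closedBall, dist_eq_norm, norm_smul, norm_exp_ofReal_mul_I] using ht
    exact ContinuousAt.comp (g := G) (f := fun p : ℝ × E => x - exp (p.1 * I) • p.2)
      (hG.continuousAt (hV.mem_nhds hmem)) (by fun_prop)
  · push Not at ht
    have : (fun p : ℝ × E => (kern μ ε p.2 : ℂ) * G (x - exp (p.1 * I) • p.2)) =ᶠ[𝓝 (θ, t)]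
        fun _ => 0 := by
      have : ∀ᶠ p : ℝ × E in 𝓝 (θ, t), ε < ‖p.2‖ :=
        (continuous_snd.norm.continuousAt).eventually (lt_mem_nhds ht)
      filter_upwards [this] with p hp
      rw [kern_eq_zero μ hε hp.le]; simp
    exact continuousAt_const.congr this.symm

lemma mean_value (hV : IsOpen V) (hG : DifferentiableOn ℂ G V) {ε : ℝ} (hε : 0 < ε)
    {x : E} (hx : Metric.closedBall x ε ⊆ V) :
    ∫ t, (kern μ ε t : ℂ) * G (x - t) ∂μ = G x := by
  have : ProperSpace E := FiniteDimensional.proper ℂ E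
  have hcont := kern_mul_cont μ hV hG.continuousOn hε hx
  set H : ℝ → E → ℂ := fun θ t => (kern μ ε t : ℂ) * G (x - exp (θ * I) • t) with hH
  have hH' : Continuous (Function.uncurry H) := hcont
  set J := ∫ t, (kern μ ε t : ℂ) * G (x - t) ∂μ with hJ
  have h1 : ∀ θ, ∫ t, H θ t ∂μ = J := by
    intro θ
    have hc : ‖exp (θ * I)‖ = 1 := norm_exp_ofReal_mul_I θ
    have hc0 : exp (θ * I) ≠ 0 := exp_ne_zero _
    have := (smul_mp μ hc).integral_comp
      (Homeomorph.smulOfNeZero (exp (θ * I)) hc0 : E ≃ₜ E).measurableEmbedding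
      (fun t => (kern μ ε t : ℂ) * G (x - t))
    rw [hJ, ← this]
    simp only [hH, kern_smul μ hc]
  have hintg : Integrable (Function.uncurry H)
      ((volume.restrict (Ioc 0 (2 * Real.pi))).prod μ) := by
    have hc : IsCompact (Icc 0 (2 * Real.pi) ×ˢ Metric.closedBall (0:E) ε) :=
      isCompact_Icc.prod (isCompact_closedBall _ _)
    have h0 : IntegrableOn (Function.uncurry H) (Icc 0 (2 * Real.pi) ×ˢ Metric.closedBall (0:E) ε)
        (volume.prod μ) := hH'.continuousOn.integrableOn_compact hc
    have h2 : IntegrableOn (Function.uncurry H) (Icc 0 (2 * Real.pi) ×ˢ univ) (volume.prod μ) := by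
      refine h0.of_forall_sdiff_eq_zero (measurableSet_Icc.prod MeasurableSet.univ) ?_
      rintro ⟨θ, t⟩ ht
      simp only [mem_diff, mem_prod, mem_univ, and_true, Metric.mem_closedBall,
        dist_zero_right, not_and, not_le] at ht
      simp only [Function.uncurry, hH]
      rw [kern_eq_zero μ hε (ht.2 ht.1).le]; simp
    have h3 := h2.mono_set (t := Icc 0 (2 * Real.pi) ×ˢ univ)
      (s := Ioc 0 (2 * Real.pi) ×ˢ univ) (prod_mono Ioc_subset_Icc_self le_rfl)
    rw [IntegrableOn, ← Measure.prod_restrict, Measure.restrict_univ] at h3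
    exact h3
  have h2 : ∀ t, ∫ θ in Ioc 0 (2 * Real.pi), H θ t = (2 * Real.pi : ℝ) * ((kern μ ε t : ℂ) * G x) := by
    intro t
    by_cases ht : ε ≤ ‖t‖
    · simp [hH, kern_eq_zero μ hε ht]
    push Not at ht
    have hd : DifferentiableOn ℂ (fun z : ℂ => G (x - z • t)) (Metric.closedBall 0 |1|) := by
      intro z hz
      have hmem : x - z • t ∈ V := by
        apply hx
        simp only [Metric.mem_closedBall, dist_eq_norm, sub_sub_cancel_left, norm_neg, norm_smul]
        simp at hz
        nlinarith [norm_nonneg z, norm_nonneg t]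
      have := (hG.differentiableAt (hV.mem_nhds hmem))
      exact (this.comp z (by fun_prop : DifferentiableAt ℂ (fun z : ℂ => x - z • t) z)).differentiableWithinAt
    have hd2 : DiffContOnCl ℂ (fun z : ℂ => G (x - z • t)) (Metric.ball 0 |1|) := by
      apply DifferentiableOn.diffContOnCl
      rwa [closure_ball _ (by norm_num)]
    have := hd2.circleAverage
    rw [Real.circleAverage, intervalIntegral.integral_of_le (by positivity)] at this
    simp only [zero_smul, sub_zero, circleMap, zero_add, ofReal_one, one_mul] at this
    simp only [hH]
    rw [integral_const_mul, ← this]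
    have hpi : (Real.pi : ℂ) ≠ 0 := by exact_mod_cast Real.pi_ne_zero
    simp only [real_smul]
    generalize (∫ θ in Ioc 0 (2 * Real.pi), G (x - exp (θ * I) • t)) = A
    push_cast
    field_simp
  have h3 := integral_integral_swap hintg
  simp only [h1, h2] at h3
  rw [integral_const_mul, integral_mul_const, integral_complex_ofReal, kern_integral μ hε] at h3
  simp only [integral_const, measureReal_restrict_apply_univ, Real.volume_real_Ioc, sub_zero, ofReal_one,
    one_mul, real_smul] at h3
  have hp : max (2 * Real.pi) 0 = 2 * Real.pi := max_eq_left (by positivity)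
  rw [hp] at h3
  have : ((2 * Real.pi : ℝ) : ℂ) ≠ 0 := by exact_mod_cast (by positivity : (2 * Real.pi) ≠ 0)
  exact mul_left_cancel₀ this h3

/-- Sub-mean value in `L²`. -/
lemma sub_mean : ∃ C : ℝ, 0 < C ∧ ∀ (V : Set E) (G : E → ℂ), IsOpen V → DifferentiableOn ℂ G V →
    ∀ ε : ℝ, 0 < ε → ∀ x : E, Metric.closedBall x ε ⊆ V →
    ‖G x‖ₑ ^ 2 ≤ ENNReal.ofReal (C / ε ^ (Module.finrank ℝ E)) *
      ∫⁻ y in Metric.closedBall x ε, ‖G y‖ₑ ^ 2 ∂μ := by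
  have : ProperSpace E := FiniteDimensional.proper ℂ E
  obtain ⟨C, hC, hk⟩ := kern_le μ (E := E)
  refine ⟨C, hC, fun V G hV hG ε hε x hx => ?_⟩
  rw [← mean_value μ hV hG hε hx]
  set g : E → ℂ := fun t => (Metric.closedBall x ε).indicator G (x - t) with hgd
  have hgm : AEStronglyMeasurable ((Metric.closedBall x ε).indicator G) μ := by
    rw [aestronglyMeasurable_indicator_iff measurableSet_closedBall]
    exact (hG.continuousOn.mono hx).aestronglyMeasurable measurableSet_closedBall
  have hgm2 : AEStronglyMeasurable g μ :=
    hgm.comp_measurePreserving (Measure.measurePreserving_sub_left μ x)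
  have e1 : ∫ t, (kern μ ε t : ℂ) * G (x - t) ∂μ = ∫ t, (kern μ ε t : ℂ) * g t ∂μ := by
    congr 1; ext t
    by_cases ht : ‖t‖ ≤ ε
    · rw [hgd]; simp only
      rw [indicator_of_mem]
      simpa [Metric.mem_closedBall, dist_eq_norm] using ht
    · rw [kern_eq_zero μ hε (not_le.1 ht).le]; simp
  rw [e1]
  refine (kern_jensen μ hε hgm2).trans ?_
  calc ∫⁻ t, ENNReal.ofReal (kern μ ε t) * ‖g t‖ₑ ^ 2 ∂μ
      ≤ ∫⁻ t, ENNReal.ofReal (C / ε ^ (Module.finrank ℝ E)) * ‖g t‖ₑ ^ 2 ∂μ := by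
        refine lintegral_mono fun t => ?_
        gcongr
        exact hk ε hε t
    _ = ENNReal.ofReal (C / ε ^ (Module.finrank ℝ E)) * ∫⁻ t, ‖g t‖ₑ ^ 2 ∂μ :=
        lintegral_const_mul' _ _ ENNReal.ofReal_ne_top
    _ = _ := by
        congr 1
        rw [hgd]
        rw [lintegral_sub_left_eq_self (fun y => ‖(Metric.closedBall x ε).indicator G y‖ₑ ^ 2) x,
          ← lintegral_indicator measurableSet_closedBall]
        congr 1; ext y
        by_cases hy : y ∈ Metric.closedBall x ε <;> simp [hy]

end MV

end ModuleB3

section ModuleB4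
open MeasureTheory Complex Filter

lemma enorm_add_sq_le {F : Type*} [NormedAddCommGroup F] (a b : F) :
    ‖a + b‖ₑ ^ 2 ≤ 2 * (‖a‖ₑ ^ 2 + ‖b‖ₑ ^ 2) := by
  have h : ‖a + b‖₊ ^ 2 ≤ 2 * (‖a‖₊ ^ 2 + ‖b‖₊ ^ 2) := by
    rw [← NNReal.coe_le_coe]
    push_cast
    have := norm_add_le a b
    nlinarith [norm_nonneg (a + b), norm_nonneg a, norm_nonneg b, sq_nonneg (‖a‖ - ‖b‖)]
  simp only [enorm_eq_nnnorm]
  exact_mod_cast h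

section holo
variable {E : Type*} [NormedAddCommGroup E] [NormedSpace ℂ E] [FiniteDimensional ℂ E]

lemma holo_of_db {N : ℕ} {b : Fin N → E} (hb : Submodule.span ℂ (range b) = ⊤) {f : E → ℂ} {x : E}
    (hf : DifferentiableAt ℝ f x) (h : ∀ j, db (b j) f x = 0) : DifferentiableAt ℂ f x := by
  set L := fderiv ℝ f x with hL
  have key : ∀ v : E, ∀ c : ℂ, L (c • v) = c.re • L v + c.im • L (I • v) := by
    intro v c
    have : c • v = c.re • v + c.im • (I • v) := by
      conv_lhs => rw [← re_add_im c]
      rw [add_smul, ← smul_smul, ← Complex.coe_smul, ← Complex.coe_smul]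
    rw [this, map_add, map_smul, map_smul]
  have h1 : ∀ v : E, L (I • v) = I * L v := by
    intro v
    have hv : v ∈ Submodule.span ℂ (range b) := by rw [hb]; trivial
    induction hv using Submodule.span_induction with
    | mem v hv =>
      obtain ⟨j, rfl⟩ := hv
      have := h j
      rw [db, ← hL] at this
      have h2 : L (b j) + I * L (I • b j) = 0 := by simpa using this
      linear_combination (-I) * h2 + (L (I • b j)) * I_mul_I
    | zero => simp
    | add v w _ _ hv hw => rw [smul_add, map_add, map_add, hv, hw]; ring
    | smul c v _ hv =>
      rw [smul_comm, key (I • v) c, smul_smul, I_mul_I, key v c, hv, neg_one_smul, map_neg]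
      simp only [real_smul]
      linear_combination (-(c.im) * L v : ℂ) * I_mul_I
  let L' : E →ₗ[ℂ] ℂ :=
    { toFun := L
      map_add' := map_add L
      map_smul' := by
        intro c v
        rw [key, h1]
        simp only [real_smul, RingHom.id_apply, smul_eq_mul]
        conv_rhs => rw [← re_add_im c]
        ring }
  refine (hasFDerivAt_of_restrictScalars ℝ (g' := L) (f' := LinearMap.toContinuousLinearMap L')
    hf.hasFDerivAt ?_).differentiableAt
  ext v; rfl

lemma db_of_holo {f : E → ℂ} {x : E} (hf : DifferentiableAt ℂ f x) (v : E) : db v f x = 0 := by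
  have : fderiv ℝ f x = (fderiv ℂ f x).restrictScalars ℝ :=
    (hf.hasFDerivAt.restrictScalars ℝ).fderiv
  rw [db, this]
  simp [← mul_assoc]
end holo

section weyl
variable {E : Type*} [NormedAddCommGroup E] [InnerProductSpace ℂ E] [FiniteDimensional ℂ E]
  [MeasurableSpace E] [BorelSpace E] (μ : Measure E) [μ.IsAddHaarMeasure]

lemma moll_unif {δ : ℝ} (hδ : 0 < δ) : ∃ C : ENNReal, C ≠ ⊤ ∧ ∀ f : E → ℂ, AEStronglyMeasurable f μ →
    ∀ x, ‖moll μ δ f x‖ₑ ^ 2 ≤ C * ∫⁻ y, ‖f y‖ₑ ^ 2 ∂μ := by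
  obtain ⟨C, hC, hk⟩ := kern_le μ (E := E)
  refine ⟨ENNReal.ofReal (C / δ ^ (Module.finrank ℝ E)), ENNReal.ofReal_ne_top, fun f hf x => ?_⟩
  rw [moll_eq]
  have hg : AEStronglyMeasurable (fun t => f (x - t)) μ :=
    hf.comp_measurePreserving (Measure.measurePreserving_sub_left μ x)
  refine (kern_jensen μ hδ hg).trans ?_
  calc ∫⁻ t, ENNReal.ofReal (kern μ δ t) * ‖f (x - t)‖ₑ ^ 2 ∂μ
      ≤ ∫⁻ t, ENNReal.ofReal (C / δ ^ (Module.finrank ℝ E)) * ‖f (x - t)‖ₑ ^ 2 ∂μ := by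
        refine lintegral_mono fun t => ?_
        gcongr
        exact hk δ hδ t
    _ = ENNReal.ofReal (C / δ ^ (Module.finrank ℝ E)) * ∫⁻ t, ‖f (x - t)‖ₑ ^ 2 ∂μ :=
        lintegral_const_mul' _ _ ENNReal.ofReal_ne_top
    _ = _ := by
        rw [lintegral_sub_left_eq_self (fun y => ‖f y‖ₑ ^ 2) x]

lemma moll_sub_fun {δ : ℝ} (hδ : 0 < δ) {f g : E → ℂ} (hf : LocallyIntegrable f μ)
    (hg : LocallyIntegrable g μ) (x : E) :
    moll μ δ (fun y => f y - g y) x = moll μ δ f x - moll μ δ g x := by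
  have h1 := conv_int μ hf (kernC_contDiff μ δ 0).continuous (kernC_hasCompactSupport μ hδ) x
  have h2 := conv_int μ hg (kernC_contDiff μ δ 0).continuous (kernC_hasCompactSupport μ hδ) x
  simp only [moll]
  simp only [kernC] at h1 h2
  rw [← integral_sub h1 h2]
  congr 1; ext y
  ring

variable {N : ℕ} {b : Fin N → E} {V : Set E} {F : E → ℂ}

lemma weyl_local (hb : Submodule.span ℂ (range b) = ⊤)
    (hF : ∀ K ⊆ V, IsCompact K → MemLp F 2 (μ.restrict K))
    (hw : ∀ j, ∀ w : E → ℂ, ContDiff ℝ 2 w → HasCompactSupport w → tsupport w ⊆ V →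
      ∫ x, F x * db (b j) w x ∂μ = 0) {x0 : E} {r : ℝ} (hr : 0 < r)
    (hxr : Metric.closedBall x0 (4 * r) ⊆ V) :
    ∃ G : E → ℂ, DifferentiableOn ℂ G (Metric.ball x0 r) ∧
      ∀ᵐ x ∂(μ.restrict (Metric.ball x0 r)), F x = G x := by
  have : ProperSpace E := FiniteDimensional.proper ℂ E
  set F0 : E → ℂ := (Metric.ball x0 (3 * r)).indicator F with hF0
  have hL2 : MemLp F0 2 μ := by
    rw [hF0, memLp_indicator_iff_restrict measurableSet_ball]
    refine (hF _ hxr (isCompact_closedBall _ _)).mono_measure (Measure.restrict_mono ?_ le_rfl)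
    exact Metric.ball_subset_closedBall.trans (Metric.closedBall_subset_closedBall (by linarith))
  have hli : LocallyIntegrable F0 μ := hL2.locallyIntegrable (by norm_num)
  have hholo : ∀ ε, 0 < ε → ε < r → ∀ x ∈ Metric.ball x0 (2 * r), ∀ j,
      db (b j) (moll μ ε F0) x = 0 := by
    intro ε hε hεr x hx j
    rw [moll_db μ hε hli, neg_eq_zero]
    have hsub : Metric.closedBall x ε ⊆ Metric.ball x0 (3 * r) := by
      intro y hy
      rw [Metric.mem_ball] at hx ⊢
      rw [Metric.mem_closedBall] at hy
      linarith [dist_triangle y x x0]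
    have hsub2 : Metric.ball x0 (3 * r) ⊆ V := (Metric.ball_subset_closedBall.trans
      (Metric.closedBall_subset_closedBall (by linarith))).trans hxr
    rw [← hw j _ (kernC_refl_contDiff μ ε 2 x) (kernC_refl_hasCompactSupport μ hε x)
      ((kernC_refl_tsupport μ hε x).trans (hsub.trans hsub2))]
    congr 1; ext y
    by_cases hy : y ∈ Metric.ball x0 (3 * r)
    · rw [hF0, indicator_of_mem hy]
    · have : db (b j) (fun y => kernC μ ε (x - y)) y = 0 := by
        by_contra hne
        have := db_support (f := fun y => kernC μ ε (x - y)) (b j) (subset_tsupport _ hne)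
        exact hy (hsub (kernC_refl_tsupport μ hε x this))
      rw [this]; simp
  have hd : ∀ ε, 0 < ε → ε < r → DifferentiableOn ℂ (moll μ ε F0) (Metric.ball x0 (2 * r)) :=
    fun ε hε hεr x hx => (holo_of_db hb ((moll_contDiff μ hε hli).differentiable (by norm_num) x)
      (hholo ε hε hεr x hx)).differentiableWithinAt
  have hr2 : 0 < r / 2 := by linarith
  have hmv : ∀ ε, 0 < ε → ε < r → ∀ x ∈ Metric.ball x0 r,
      moll μ (r / 2) (moll μ ε F0) x = moll μ ε F0 x := by
    intro ε hε hεr x hx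
    rw [moll_eq]
    refine mean_value μ Metric.isOpen_ball (hd ε hε hεr) hr2 fun y hy => ?_
    rw [Metric.mem_ball] at hx ⊢
    rw [Metric.mem_closedBall] at hy
    linarith [dist_triangle y x x0]
  obtain ⟨C, hC, hCb⟩ := moll_unif μ (E := E) hr2
  set A : ENNReal := ∫⁻ x in Metric.ball x0 r, ‖F0 x - moll μ (r / 2) F0 x‖ₑ ^ 2 ∂μ with hA
  set D : ENNReal := 2 * (1 + C * μ (Metric.ball x0 r)) with hD
  have hDt : D ≠ ⊤ := by
    rw [hD]
    exact ENNReal.mul_ne_top (by simp) (ENNReal.add_ne_top.2 ⟨by simp,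
      ENNReal.mul_ne_top hC measure_ball_lt_top.ne⟩)
  have hAle : ∀ ε, 0 < ε → ε < r → A ≤ D * ∫⁻ x, ‖moll μ ε F0 x - F0 x‖ₑ ^ 2 ∂μ := by
    intro ε hε hεr
    have hcont : Continuous (moll μ ε F0) := (moll_contDiff μ hε hli).continuous
    set Q := ∫⁻ x, ‖moll μ ε F0 x - F0 x‖ₑ ^ 2 ∂μ with hQ
    have hpt : ∀ x ∈ Metric.ball x0 r, ‖F0 x - moll μ (r / 2) F0 x‖ₑ ^ 2 ≤
        2 * (‖moll μ ε F0 x - F0 x‖ₑ ^ 2 + C * Q) := by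
      intro x hx
      have e : F0 x - moll μ (r / 2) F0 x = -(moll μ ε F0 x - F0 x) +
          moll μ (r / 2) (fun y => moll μ ε F0 y - F0 y) x := by
        rw [moll_sub_fun μ hr2 hcont.locallyIntegrable hli, hmv ε hε hεr x hx]; ring
      rw [e]
      refine (enorm_add_sq_le _ _).trans ?_
      rw [enorm_neg]
      gcongr
      exact hCb _ (hcont.aestronglyMeasurable.sub hL2.1) x
    calc A ≤ ∫⁻ x in Metric.ball x0 r, 2 * (‖moll μ ε F0 x - F0 x‖ₑ ^ 2 + C * Q) ∂μ :=
          setLIntegral_mono_ae' measurableSet_ball (Eventually.of_forall hpt)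
      _ = 2 * ((∫⁻ x in Metric.ball x0 r, ‖moll μ ε F0 x - F0 x‖ₑ ^ 2 ∂μ)
            + C * Q * μ (Metric.ball x0 r)) := by
          rw [lintegral_const_mul' _ _ (by simp), lintegral_add_right _ measurable_const,
            setLIntegral_const]
      _ ≤ 2 * (Q + C * Q * μ (Metric.ball x0 r)) := by
          gcongr
          exact setLIntegral_le_lintegral _ _
      _ = D * Q := by rw [hD]; ring
  have hA0 : A = 0 := by
    have ht : Tendsto (fun ε => D * ∫⁻ x, ‖moll μ ε F0 x - F0 x‖ₑ ^ 2 ∂μ) (𝓝[>] 0) (𝓝 (D * 0)) :=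
      ENNReal.Tendsto.const_mul (moll_L2 μ hL2) (Or.inr hDt)
    rw [mul_zero] at ht
    have : A ≤ 0 := by
      refine ge_of_tendsto ht ?_
      filter_upwards [Ioo_mem_nhdsGT hr] with ε hε
      exact hAle ε hε.1 hε.2
    simpa using this
  have hae : ∀ᵐ x ∂(μ.restrict (Metric.ball x0 r)), F x = moll μ (r / 2) F0 x := by
    rw [hA, lintegral_eq_zero_iff'] at hA0
    · filter_upwards [hA0, ae_restrict_mem measurableSet_ball] with x hx hx2
      have hx3 : F0 x = F x := by
        rw [hF0, indicator_of_mem]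
        exact Metric.ball_subset_ball (by linarith) hx2
      simp only [Pi.zero_apply, pow_eq_zero_iff, ne_eq, OfNat.ofNat_ne_zero, not_false_eq_true,
        enorm_eq_zero] at hx
      rw [← hx3]; exact sub_eq_zero.1 hx
    · exact ((hL2.1.sub (moll_contDiff μ hr2 hli).continuous.aestronglyMeasurable).restrict.enorm).pow_const 2
  refine ⟨moll μ (r / 2) F0, fun x hx => ?_, hae⟩
  refine (hd _ hr2 (by linarith) x ?_).differentiableAt ?_ |>.differentiableWithinAt
  · exact Metric.ball_subset_ball (by linarith) hx
  · exact Metric.isOpen_ball.mem_nhds (Metric.ball_subset_ball (by linarith) hx)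

theorem weyl (hb : Submodule.span ℂ (range b) = ⊤) (hV : IsOpen V)
    (hF : ∀ K ⊆ V, IsCompact K → MemLp F 2 (μ.restrict K))
    (hw : ∀ j, ∀ w : E → ℂ, ContDiff ℝ 2 w → HasCompactSupport w → tsupport w ⊆ V →
      ∫ x, F x * db (b j) w x ∂μ = 0) :
    ∃ G : E → ℂ, DifferentiableOn ℂ G V ∧ ∀ᵐ x ∂(μ.restrict V), F x = G x := by
  have : ProperSpace E := FiniteDimensional.proper ℂ E
  have hloc : ∀ x : V, ∃ r > 0, Metric.ball (x : E) r ⊆ V ∧ ∃ G : E → ℂ,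
      DifferentiableOn ℂ G (Metric.ball (x:E) r) ∧
      ∀ᵐ y ∂(μ.restrict (Metric.ball (x:E) r)), F y = G y := by
    rintro ⟨x, hx⟩
    obtain ⟨R, hR, hRs⟩ := Metric.isOpen_iff.1 hV x hx
    have h8 : Metric.closedBall x (4 * (R / 8)) ⊆ V :=
      (Metric.closedBall_subset_ball (by linarith)).trans hRs
    exact ⟨R / 8, by positivity, (Metric.ball_subset_ball (by linarith)).trans hRs,
      weyl_local μ hb hF hw (by positivity) h8⟩
  choose r hr hrV g hg hgae using hloc
  classical
  let G : E → ℂ := fun x => if hx : x ∈ V then g ⟨x, hx⟩ x else 0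
  have hGe : ∀ x : V, ∀ y ∈ Metric.ball (x:E) (r x), G y = g x y := by
    intro x y hy
    have hyV := hrV x hy
    simp only [G, dif_pos hyV]
    set y' : V := ⟨y, hyV⟩
    have hU : IsOpen (Metric.ball (x:E) (r x) ∩ Metric.ball (y':E) (r y')) :=
      Metric.isOpen_ball.inter Metric.isOpen_ball
    refine Measure.eqOn_open_of_ae_eq (μ := μ)
      (U := Metric.ball (x:E) (r x) ∩ Metric.ball (y':E) (r y')) ?_ hU
      ((hg y').continuousOn.mono inter_subset_right) ((hg x).continuousOn.mono inter_subset_left)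
      ⟨hy, Metric.mem_ball_self (hr y')⟩
    filter_upwards [ae_restrict_of_ae_restrict_of_subset inter_subset_left (hgae x),
      ae_restrict_of_ae_restrict_of_subset inter_subset_right (hgae y')] with z h1 h2
    rw [← h1, ← h2]
  refine ⟨G, fun x hx => ?_, ?_⟩
  · have h1 := (hg ⟨x, hx⟩).differentiableAt (Metric.ball_mem_nhds x (hr ⟨x, hx⟩))
    refine (h1.congr_of_eventuallyEq ?_).differentiableWithinAt
    filter_upwards [Metric.ball_mem_nhds x (hr ⟨x, hx⟩)] with y hy
    exact hGe ⟨x, hx⟩ y hy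
  · rw [ae_restrict_iff' hV.measurableSet, ae_iff]
    refine measure_null_of_locally_null _ fun x hx => ?_
    simp only [mem_setOf_eq, Classical.not_imp] at hx
    have hxV := hx.1
    refine ⟨_, inter_mem_nhdsWithin _ (Metric.ball_mem_nhds x (hr ⟨x, hxV⟩)), ?_⟩
    have h1 := hgae ⟨x, hxV⟩
    rw [ae_restrict_iff' measurableSet_ball, ae_iff] at h1
    refine measure_mono_null ?_ h1
    rintro y ⟨hy1, hy2⟩
    simp only [mem_setOf_eq, Classical.not_imp] at hy1 ⊢
    refine ⟨hy2, ?_⟩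
    rw [← hGe ⟨x, hxV⟩ y hy2]
    exact hy1.2

end weyl

end ModuleB4

section ModuleC1
open MeasureTheory Complex Filter

/-- weighted square integrals are continuous under `L²` convergence -/
lemma tendsto_wsq {α ι : Type*} [MeasurableSpace α] (ν : Measure α) {l : Filter ι}
    {W : α → ℝ} (hW : AEStronglyMeasurable W ν) {M : ℝ} (hM : ∀ x, |W x| ≤ M)
    {f : α → ℂ} (hf : MemLp f 2 ν) {F : ι → α → ℂ} (hF : ∀ᶠ i in l, MemLp (F i) 2 ν)
    (hlim : Tendsto (fun i => ∫⁻ x, ‖F i x - f x‖ₑ ^ 2 ∂ν) l (𝓝 0)) :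
    Tendsto (fun i => ∫ x, W x * ‖F i x‖ ^ 2 ∂ν) l (𝓝 (∫ x, W x * ‖f x‖ ^ 2 ∂ν)) := by
  have hintg : ∀ {g : α → ℂ}, MemLp g 2 ν → Integrable (fun x => W x * ‖g x‖ ^ 2) ν := by
    intro g hg
    have := (hg.integrable_norm_pow (p := 2) (by norm_num))
    exact this.bdd_mul hW (Eventually.of_forall fun x => by rw [Real.norm_eq_abs]; exact hM x)
  set J : ENNReal := ∫⁻ x, ‖f x‖ₑ ^ 2 ∂ν with hJ
  have hJt : J ≠ ⊤ := by
    rw [hJ, ← eLpNorm_two_sq]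
    exact ENNReal.pow_ne_top hf.2.ne
  refine tendsto_integral_of_L1 _ (hintg hf).1 (hF.mono fun i hi => hintg hi) ?_
  have hub : ∀ᶠ i in l, ∫⁻ x, ‖W x * ‖F i x‖ ^ 2 - W x * ‖f x‖ ^ 2‖ₑ ∂ν ≤
      ENNReal.ofReal M * ((∫⁻ x, ‖F i x - f x‖ₑ ^ 2 ∂ν) +
        2 * ((∫⁻ x, ‖F i x - f x‖ₑ ^ 2 ∂ν) ^ (1 / 2 : ℝ) * J ^ (1 / 2 : ℝ))) := by
    filter_upwards [hF] with i hi
    have hm1 : AEMeasurable (fun x => ‖F i x - f x‖ₑ) ν := (hi.1.sub hf.1).enorm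
    have hm2 : AEMeasurable (fun x => ‖f x‖ₑ) ν := hf.1.enorm
    have hh := ENNReal.lintegral_mul_le_Lp_mul_Lq ν Real.HolderConjugate.two_two hm1 hm2
    simp only [Pi.mul_apply] at hh
    have e2 : ∀ a : ENNReal, a ^ (2 : ℝ) = a ^ 2 := fun a => by
      rw [← ENNReal.rpow_natCast]; norm_num
    simp only [e2] at hh
    calc ∫⁻ x, ‖W x * ‖F i x‖ ^ 2 - W x * ‖f x‖ ^ 2‖ₑ ∂ν
        ≤ ∫⁻ x, ENNReal.ofReal M * (‖F i x - f x‖ₑ ^ 2 + 2 * (‖F i x - f x‖ₑ * ‖f x‖ₑ)) ∂ν := by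
          refine lintegral_mono fun x => ?_
          rw [← mul_sub, enorm_mul]
          gcongr
          · rw [← ofReal_norm_eq_enorm]
            exact ENNReal.ofReal_le_ofReal (hM x)
          · simp only [← ofReal_norm_eq_enorm]
            rw [← ENNReal.ofReal_pow (norm_nonneg _), ← ENNReal.ofReal_mul (norm_nonneg _),
              show (2 : ENNReal) = ENNReal.ofReal 2 by simp,
              ← ENNReal.ofReal_mul (by norm_num), ← ENNReal.ofReal_add (by positivity) (by positivity)]
            apply ENNReal.ofReal_le_ofReal
            rw [Real.norm_eq_abs, abs_le]
            have h1 := norm_sub_norm_le (F i x) (f x)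
            have h2 := norm_sub_norm_le (f x) (F i x)
            rw [norm_sub_rev] at h2
            have h3 := norm_nonneg (F i x)
            have h4 := norm_nonneg (f x)
            have h5 := norm_nonneg (F i x - f x)
            constructor <;> nlinarith
      _ = ENNReal.ofReal M * ((∫⁻ x, ‖F i x - f x‖ₑ ^ 2 ∂ν) +
            2 * ∫⁻ x, ‖F i x - f x‖ₑ * ‖f x‖ₑ ∂ν) := by
          rw [lintegral_const_mul' _ _ ENNReal.ofReal_ne_top,
            lintegral_add_left' (hm1.pow_const 2), lintegral_const_mul' _ _ (by simp)]
      _ ≤ _ := by gcongr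
  have hlim2 : Tendsto (fun i => ENNReal.ofReal M * ((∫⁻ x, ‖F i x - f x‖ₑ ^ 2 ∂ν) +
        2 * ((∫⁻ x, ‖F i x - f x‖ₑ ^ 2 ∂ν) ^ (1 / 2 : ℝ) * J ^ (1 / 2 : ℝ)))) l (𝓝 0) := by
    have h1 : Tendsto (fun i => (∫⁻ x, ‖F i x - f x‖ₑ ^ 2 ∂ν) ^ (1 / 2 : ℝ)) l (𝓝 0) := by
      have := (ENNReal.continuous_rpow_const (y := (1/2:ℝ))).tendsto 0
      rw [ENNReal.zero_rpow_of_pos (by norm_num)] at this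
      exact this.comp hlim
    have hJ2 : J ^ (1 / 2 : ℝ) ≠ ⊤ := ENNReal.rpow_ne_top_of_nonneg (by norm_num) hJt
    have h2 := ENNReal.Tendsto.mul_const h1 (b := J ^ (1 / 2 : ℝ)) (Or.inr hJ2)
    have h3 := ENNReal.Tendsto.const_mul h2 (a := 2) (Or.inr (by simp))
    have h4 := ENNReal.Tendsto.const_mul (hlim.add h3) (a := ENNReal.ofReal M)
      (Or.inr ENNReal.ofReal_ne_top)
    simpa using h4
  exact tendsto_of_tendsto_of_tendsto_of_le_of_le' tendsto_const_nhds hlim2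
    (Eventually.of_forall fun _ => zero_le) hub

section K0
variable {E : Type*} [NormedAddCommGroup E] [InnerProductSpace ℂ E] [FiniteDimensional ℂ E]
  [MeasurableSpace E] [BorelSpace E] (μ : Measure E) [μ.IsAddHaarMeasure]

/-- `L²` convergence to zero is stable under multiplication by bounded functions and sums -/
lemma tendsto_sq_add {α ι : Type*} [MeasurableSpace α] (ν : Measure α) {l : Filter ι}
    {F G : ι → α → ℂ} (hFm : ∀ᶠ i in l, AEStronglyMeasurable (F i) ν)
    (hF : Tendsto (fun i => ∫⁻ x, ‖F i x‖ₑ ^ 2 ∂ν) l (𝓝 0))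
    (hG : Tendsto (fun i => ∫⁻ x, ‖G i x‖ₑ ^ 2 ∂ν) l (𝓝 0)) :
    Tendsto (fun i => ∫⁻ x, ‖F i x + G i x‖ₑ ^ 2 ∂ν) l (𝓝 0) := by
  have h1 := ENNReal.Tendsto.const_mul (hF.add hG) (a := 2) (Or.inr (by simp))
  rw [add_zero, mul_zero] at h1
  refine tendsto_of_tendsto_of_tendsto_of_le_of_le' tendsto_const_nhds h1
    (Eventually.of_forall fun _ => zero_le) ?_
  filter_upwards [hFm] with i hi
  rw [← lintegral_add_left' (hi.enorm.pow_const 2), ← lintegral_const_mul' _ _ (by simp)]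
  exact lintegral_mono fun x => enorm_add_sq_le _ _

lemma tendsto_sq_mul {α ι : Type*} [MeasurableSpace α] (ν : Measure α) {l : Filter ι}
    {F : ι → α → ℂ} {g : α → ℂ} {M : ℝ} (hM : ∀ x, ‖g x‖ ≤ M)
    (hF : Tendsto (fun i => ∫⁻ x, ‖F i x‖ₑ ^ 2 ∂ν) l (𝓝 0)) :
    Tendsto (fun i => ∫⁻ x, ‖g x * F i x‖ₑ ^ 2 ∂ν) l (𝓝 0) := by
  have h1 := ENNReal.Tendsto.const_mul hF (a := ENNReal.ofReal M ^ 2)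
    (Or.inr (ENNReal.pow_ne_top ENNReal.ofReal_ne_top))
  rw [mul_zero] at h1
  refine tendsto_of_tendsto_of_tendsto_of_le_of_le' tendsto_const_nhds h1
    (Eventually.of_forall fun _ => zero_le) (Eventually.of_forall fun i => ?_)
  rw [← lintegral_const_mul' _ _ (ENNReal.pow_ne_top ENNReal.ofReal_ne_top)]
  refine lintegral_mono fun x => ?_
  rw [enorm_mul, mul_pow]
  gcongr
  rw [← ofReal_norm_eq_enorm]
  exact ENNReal.ofReal_le_ofReal (hM x)

lemma tendsto_sq_sum {α ι κ : Type*} [MeasurableSpace α] (ν : Measure α) {l : Filter ι}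
    (s : Finset κ) {F : κ → ι → α → ℂ} (hFm : ∀ j, ∀ᶠ i in l, AEStronglyMeasurable (F j i) ν)
    (hF : ∀ j, Tendsto (fun i => ∫⁻ x, ‖F j i x‖ₑ ^ 2 ∂ν) l (𝓝 0)) :
    Tendsto (fun i => ∫⁻ x, ‖∑ j ∈ s, F j i x‖ₑ ^ 2 ∂ν) l (𝓝 0) := by
  classical
  induction s using Finset.induction_on with
  | empty => simpa using tendsto_const_nhds
  | insert a s ha ih =>
    simp only [Finset.sum_insert ha]
    exact tendsto_sq_add ν (hFm a) (hF a) ih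

lemma moll_hasCompactSupport {ε : ℝ} (hε : 0 < ε) {K : Set E} (hK : IsCompact K) {f : E → ℂ}
    (hf : ∀ x ∉ K, f x = 0) : HasCompactSupport (moll μ ε f) := by
  have : ProperSpace E := FiniteDimensional.proper ℂ E
  refine HasCompactSupport.intro (hK.cthickening (r := ε)) fun x hx => ?_
  refine moll_eq_zero μ hε fun y hy => hf y fun hyK => hx ?_
  refine Metric.mem_cthickening_of_dist_le x y ε K hyK ?_
  rw [dist_comm]; exact (Metric.mem_ball.1 hy).le

variable {N : ℕ} (b : Fin N → E)

theorem K0 {φ : E → ℝ} (hφ : ContDiff ℝ 2 φ) (hφc : HasCompactSupport φ)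
    {c : E → ℝ} (hc : Continuous c) (hcc : ∃ M, ∀ x, |c x| ≤ M)
    {O K : Set E} (hO : IsOpen O) (hK : IsCompact K) (hKO : K ⊆ O)
    (hL : ∀ x ∈ O, ∀ ξ : Fin N → ℂ, c x * ∑ j, ‖ξ j‖ ^ 2 ≤ Levi φ x (∑ j, ξ j • b j))
    {β : Fin N → E → ℂ} (hβ : ∀ j, MemLp (β j) 2 μ) (hβK : ∀ j, ∀ x ∉ K, β j x = 0)
    {B : Fin N → Fin N → E → ℂ} (hB : ∀ j k, MemLp (B j k) 2 μ) (hBK : ∀ j k, ∀ x ∉ K, B j k x = 0)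
    {G : E → ℂ} (hG : MemLp G 2 μ) (hGK : ∀ x ∉ K, G x = 0)
    (hwB : ∀ j k, ∀ w : E → ℂ, ContDiff ℝ 2 w → HasCompactSupport w →
      ∫ x, (β k x * db (b j) w x - β j x * db (b k) w x) ∂μ = - ∫ x, B j k x * w x ∂μ)
    (hwG : ∀ w : E → ℂ, ContDiff ℝ 2 w → HasCompactSupport w →
      ∫ x, ∑ j, β j x * dz (b j) w x ∂μ = - ∫ x, G x * w x ∂μ) :
    ∫ x, ∑ j, (c x * Real.exp (-φ x)) * ‖β j x‖ ^ 2 ∂μ ≤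
      ∫ x, Real.exp (-φ x) * ‖G x - ∑ j, dz (b j) (fun y => (φ y : ℂ)) x * β j x‖ ^ 2 ∂μ
      + ∫ x, ∑ j, ∑ k, ((1 / 2) * Real.exp (-φ x)) * ‖B j k x‖ ^ 2 ∂μ := by
  have : ProperSpace E := FiniteDimensional.proper ℂ E
  have hφC : ContDiff ℝ 2 (fun y => (φ y : ℂ)) := Complex.ofRealCLM.contDiff.comp hφ
  have hφCc : HasCompactSupport (fun y => (φ y : ℂ)) :=
    hφc.comp_left (g := fun t : ℝ => (t : ℂ)) (by simp)
  have hdφ : ∀ v, Continuous (dz v (fun y => (φ y : ℂ))) :=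
    fun v => (contDiff_dz (n := 1) hφC v).continuous
  have hdφb : ∀ v, ∃ M, ∀ x, ‖dz v (fun y => (φ y : ℂ)) x‖ ≤ M := fun v =>
    (HasCompactSupport.dz hφCc v).exists_bound_of_continuous (hdφ v)
  obtain ⟨Mφ, hMφ⟩ := hφc.exists_bound_of_continuous hφ.continuous
  obtain ⟨Mc, hMc⟩ := hcc
  have hexpc : Continuous fun x => Real.exp (-φ x) := by
    have := hφ.continuous; fun_prop
  have hexpb : ∀ x, Real.exp (-φ x) ≤ Real.exp Mφ := fun x => by
    apply Real.exp_le_exp.2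
    have := hMφ x
    rw [Real.norm_eq_abs, abs_le] at this
    linarith
  have hβl : ∀ j, LocallyIntegrable (β j) μ := fun j => (hβ j).locallyIntegrable (by norm_num)
  have hGl : LocallyIntegrable G μ := hG.locallyIntegrable (by norm_num)
  have hBl : ∀ j k, LocallyIntegrable (B j k) μ := fun j k => (hB j k).locallyIntegrable (by norm_num)
  -- mollified objects
  have hmem : ∀ {f : E → ℂ}, MemLp f 2 μ → (∀ x ∉ K, f x = 0) → ∀ᶠ ε in 𝓝[>] (0:ℝ),
      MemLp (moll μ ε f) 2 μ := by
    intro f hf hfK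
    filter_upwards [self_mem_nhdsWithin] with ε hε
    exact (moll_contDiff μ hε (hf.locallyIntegrable (by norm_num))).continuous.memLp_of_hasCompactSupport
      (moll_hasCompactSupport μ hε hK hfK)
  have hintg : ∀ {f : E → ℂ} {W : E → ℝ} {M : ℝ}, Continuous W → (∀ x, |W x| ≤ M) →
      MemLp f 2 μ → Integrable (fun x => W x * ‖f x‖ ^ 2) μ := by
    intro f W M hW hM hf
    exact (hf.integrable_norm_pow (p := 2) (by norm_num)).bdd_mul hW.aestronglyMeasurable
      (Eventually.of_forall fun x => by rw [Real.norm_eq_abs]; exact hM x)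
  have hWc1 : Continuous fun x => c x * Real.exp (-φ x) := hc.mul hexpc
  have hWc3 : Continuous fun x => (1 / 2) * Real.exp (-φ x) := continuous_const.mul hexpc
  have hW1 : ∀ x, |c x * Real.exp (-φ x)| ≤ Mc * Real.exp Mφ := fun x => by
    rw [abs_mul, Real.abs_exp]
    have := hMc x
    exact mul_le_mul this (hexpb x) (Real.exp_pos _).le ((abs_nonneg _).trans this)
  have hW2 : ∀ x, |Real.exp (-φ x)| ≤ Real.exp Mφ := fun x => by
    rw [Real.abs_exp]; exact hexpb x
  have hW3 : ∀ x, |(1 / 2) * Real.exp (-φ x)| ≤ Real.exp Mφ := fun x => by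
    rw [abs_mul, Real.abs_exp]
    have := hexpb x
    have := Real.exp_pos (-φ x)
    norm_num; linarith
  have hPm : ∀ {γ : Fin N → E → ℂ} {H : E → ℂ}, (∀ j, MemLp (γ j) 2 μ) → MemLp H 2 μ →
      MemLp (fun x => H x - ∑ j, dz (b j) (fun y => (φ y : ℂ)) x * γ j x) 2 μ := by
    intro γ H hγ hH
    refine hH.sub (memLp_finset_sum _ fun j _ => ?_)
    obtain ⟨M, hM⟩ := hdφb (b j)
    refine (hγ j).of_le_mul (c := M) ((hdφ (b j)).aestronglyMeasurable.mul (hγ j).1)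
      (Eventually.of_forall fun x => ?_)
    rw [norm_mul]
    exact mul_le_mul_of_nonneg_right (hM x) (norm_nonneg _)
  -- limits
  have lim1 : Tendsto (fun ε => ∑ j, ∫ x, (c x * Real.exp (-φ x)) * ‖moll μ ε (β j) x‖ ^ 2 ∂μ)
      (𝓝[>] 0) (𝓝 (∑ j, ∫ x, (c x * Real.exp (-φ x)) * ‖β j x‖ ^ 2 ∂μ)) :=
    tendsto_finsetSum _ fun j _ => tendsto_wsq μ (hc.mul hexpc).aestronglyMeasurable hW1 (hβ j)
      (hmem (hβ j) (hβK j)) (moll_L2 μ (hβ j))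
  have lim3 : Tendsto (fun ε => ∑ j, ∑ k, ∫ x, ((1 / 2) * Real.exp (-φ x)) * ‖moll μ ε (B j k) x‖ ^ 2 ∂μ)
      (𝓝[>] 0) (𝓝 (∑ j, ∑ k, ∫ x, ((1 / 2) * Real.exp (-φ x)) * ‖B j k x‖ ^ 2 ∂μ)) :=
    tendsto_finsetSum _ fun j _ => tendsto_finsetSum _ fun k _ =>
      tendsto_wsq μ (continuous_const.mul hexpc).aestronglyMeasurable hW3 (hB j k)
      (hmem (hB j k) (hBK j k)) (moll_L2 μ (hB j k))
  have lim2 : Tendsto (fun ε => ∫ x, Real.exp (-φ x) * ‖moll μ ε G x -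
        ∑ j, dz (b j) (fun y => (φ y : ℂ)) x * moll μ ε (β j) x‖ ^ 2 ∂μ)
      (𝓝[>] 0) (𝓝 (∫ x, Real.exp (-φ x) * ‖G x -
        ∑ j, dz (b j) (fun y => (φ y : ℂ)) x * β j x‖ ^ 2 ∂μ)) := by
    refine tendsto_wsq μ hexpc.aestronglyMeasurable hW2 (hPm hβ hG) ?_ ?_
    · have := (eventually_all (ι := Fin N)).2 fun j => hmem (hβ j) (hβK j)
      filter_upwards [this, hmem hG hGK] with ε h1 h2
      exact hPm h1 h2
    · have e : ∀ ε x, moll μ ε G x - ∑ j, dz (b j) (fun y => (φ y : ℂ)) x * moll μ ε (β j) x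
          - (G x - ∑ j, dz (b j) (fun y => (φ y : ℂ)) x * β j x)
          = (moll μ ε G x - G x) + ∑ j, (-dz (b j) (fun y => (φ y : ℂ)) x) * (moll μ ε (β j) x - β j x) := by
        intro ε x
        have : ∑ j, (-dz (b j) (fun y => (φ y : ℂ)) x) * (moll μ ε (β j) x - β j x)
          = ∑ j, dz (b j) (fun y => (φ y : ℂ)) x * β j x
            - ∑ j, dz (b j) (fun y => (φ y : ℂ)) x * moll μ ε (β j) x := by
          rw [← Finset.sum_sub_distrib]
          exact Finset.sum_congr rfl fun j _ => by ring
        rw [this]; ring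
      simp only [e]
      refine tendsto_sq_add μ ?_ (moll_L2 μ hG) (tendsto_sq_sum μ _ ?_ ?_)
      · filter_upwards [hmem hG hGK] with ε h
        exact h.1.sub hG.1
      · intro j
        filter_upwards [hmem (hβ j) (hβK j)] with ε h
        exact (hdφ (b j)).neg.aestronglyMeasurable.mul (h.1.sub (hβ j).1)
      · intro j
        obtain ⟨M, hM⟩ := hdφb (b j)
        exact tendsto_sq_mul μ (M := M) (fun x => by rw [norm_neg]; exact hM x) (moll_L2 μ (hβ j))
  -- rewriting the statement
  rw [integral_finsetSum _ fun j _ => hintg hWc1 hW1 (hβ j)]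
  have e3 : ∀ {D : Fin N → Fin N → E → ℂ}, (∀ j k, MemLp (D j k) 2 μ) →
      ∫ x, ∑ j, ∑ k, ((1 / 2) * Real.exp (-φ x)) * ‖D j k x‖ ^ 2 ∂μ =
      ∑ j, ∑ k, ∫ x, ((1 / 2) * Real.exp (-φ x)) * ‖D j k x‖ ^ 2 ∂μ := by
    intro D hD
    rw [integral_finsetSum _ fun j _ => integrable_finset_sum _ fun k _ =>
      hintg hWc3 hW3 (hD j k)]
    exact Finset.sum_congr rfl fun j _ => integral_finsetSum _ fun k _ =>
      hintg hWc3 hW3 (hD j k)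
  rw [e3 hB]
  refine le_of_tendsto_of_tendsto lim1 (lim2.add lim3) ?_
  -- ε₀ with thickening in O
  obtain ⟨ε₀, hε₀, hthick⟩ := hK.exists_cthickening_subset_open hO hKO
  filter_upwards [Ioo_mem_nhdsGT hε₀, (eventually_all (ι := Fin N)).2 fun j => hmem (hβ j) (hβK j),
    (eventually_all (ι := Fin N)).2 fun j => (eventually_all (ι := Fin N)).2 fun k =>
      hmem (hB j k) (hBK j k)] with ε hεI hmβ hmB
  have hε : 0 < ε := hεI.1
  have hαd : ∀ j, ContDiff ℝ 2 (moll μ ε (β j)) := fun j => moll_contDiff μ hε (hβl j)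
  have hαc : ∀ j, HasCompactSupport (moll μ ε (β j)) := fun j =>
    moll_hasCompactSupport μ hε hK (hβK j)
  have hbas := basic_ineq μ b hφ hαd hαc
  have hdbB : ∀ j k x, db (b j) (moll μ ε (β k)) x - db (b k) (moll μ ε (β j)) x
      = moll μ ε (B j k) x := by
    intro j k x
    rw [moll_db μ hε (hβl k), moll_db μ hε (hβl j)]
    have h1 := hwB j k _ (kernC_refl_contDiff μ ε 2 x) (kernC_refl_hasCompactSupport μ hε x)
    have hi : ∀ j v, Integrable (fun y => β j y * db v (fun y => kernC μ ε (x - y)) y) μ := by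
      intro j v
      have := (hβl j).integrable_smul_left_of_hasCompactSupport
        (contDiff_db (n := 1) (kernC_refl_contDiff μ ε 2 x) v).continuous
        (HasCompactSupport.db (kernC_refl_hasCompactSupport μ hε x) v)
      refine this.congr (Eventually.of_forall fun y => ?_)
      simp only [smul_eq_mul]; ring
    rw [integral_sub (hi k (b j)) (hi j (b k))] at h1
    rw [moll]
    simp only [kernC] at h1 ⊢
    linear_combination -h1
  have hdzG : ∀ x, ∑ j, dtw φ (b j) (moll μ ε (β j)) x = moll μ ε G x -
        ∑ j, dz (b j) (fun y => (φ y : ℂ)) x * moll μ ε (β j) x := by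
    intro x
    simp only [dtw]
    rw [Finset.sum_sub_distrib]
    congr 1
    simp only [moll_dz μ hε (hβl _)]
    have h1 := hwG _ (kernC_refl_contDiff μ ε 2 x) (kernC_refl_hasCompactSupport μ hε x)
    have hi : ∀ j v, Integrable (fun y => β j y * dz v (fun y => kernC μ ε (x - y)) y) μ := by
      intro j v
      have := (hβl j).integrable_smul_left_of_hasCompactSupport
        (contDiff_dz (n := 1) (kernC_refl_contDiff μ ε 2 x) v).continuous
        (HasCompactSupport.dz (kernC_refl_hasCompactSupport μ hε x) v)
      refine this.congr (Eventually.of_forall fun y => ?_)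
      simp only [smul_eq_mul]; ring
    rw [integral_finsetSum _ fun j _ => hi j (b j)] at h1
    rw [Finset.sum_neg_distrib, h1, moll, neg_neg]
    rfl
  simp only [hdbB, hdzG] at hbas
  have r2 : ∫ x, (1 / 2) * (∑ j, ∑ k, ‖moll μ ε (B j k) x‖ ^ 2) * Real.exp (-φ x) ∂μ =
      ∑ j, ∑ k, ∫ x, ((1 / 2) * Real.exp (-φ x)) * ‖moll μ ε (B j k) x‖ ^ 2 ∂μ := by
    rw [← e3 hmB]
    congr 1; ext x
    simp only [Finset.mul_sum, Finset.sum_mul]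
    exact Finset.sum_congr rfl fun j _ => Finset.sum_congr rfl fun k _ => by ring
  rw [r2] at hbas
  have r1 : ∀ x, ‖moll μ ε G x - ∑ j, dz (b j) (fun y => (φ y : ℂ)) x * moll μ ε (β j) x‖ ^ 2
      * Real.exp (-φ x) = Real.exp (-φ x) * ‖moll μ ε G x - ∑ j, dz (b j) (fun y => (φ y : ℂ)) x
        * moll μ ε (β j) x‖ ^ 2 := fun x => mul_comm _ _
  simp only [r1] at hbas
  refine le_trans ?_ hbas
  rw [← integral_finsetSum _ fun j _ => hintg hWc1 hW1 (hmβ j)]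
  have hpt : ∀ x, ∑ j, (c x * Real.exp (-φ x)) * ‖moll μ ε (β j) x‖ ^ 2 ≤
      Levi φ x (∑ j, moll μ ε (β j) x • b j) * Real.exp (-φ x) := by
    intro x
    by_cases hx : x ∈ O
    · have := hL x hx (fun j => moll μ ε (β j) x)
      rw [← Finset.mul_sum]
      have he := Real.exp_pos (-φ x)
      calc _ = (c x * ∑ j, ‖moll μ ε (β j) x‖ ^ 2) * Real.exp (-φ x) := by ring
        _ ≤ _ := by gcongr
    · have h0 : ∀ j, moll μ ε (β j) x = 0 := fun j => by
        refine moll_eq_zero μ hε fun y hy => hβK j y fun hyK => hx (hthick ?_)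
        refine Metric.mem_cthickening_of_dist_le x y ε₀ K hyK ?_
        rw [dist_comm]; exact ((Metric.mem_ball.1 hy).trans hεI.2).le
      simp [h0, Levi]
  refine integral_mono (integrable_finset_sum _ fun j _ => hintg hWc1 hW1 (hmβ j)) ?_ hpt
  refine Continuous.integrable_of_hasCompactSupport ?_ ?_
  · have h2 : Continuous (fderiv ℝ (fderiv ℝ φ)) :=
      (hφ.fderiv_right (m := 1) (by norm_num)).continuous_fderiv (by norm_num)
    have h3 : Continuous fun x => ∑ j, moll μ ε (β j) x • b j :=
      continuous_finsetSum _ fun j _ => (hαd j).continuous.smul continuous_const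
    simp only [Levi]
    exact ((((h2.clm_apply h3).clm_apply h3).add ((h2.clm_apply (h3.const_smul I)).clm_apply
      (h3.const_smul I))).div_const 4).mul hexpc
  · refine HasCompactSupport.intro (hK.cthickening (r := ε)) fun x hx => ?_
    have h0 : ∀ j, moll μ ε (β j) x = 0 := fun j => by
      refine moll_eq_zero μ hε fun y hy => hβK j y fun hyK => hx ?_
      refine Metric.mem_cthickening_of_dist_le x y ε K hyK ?_
      rw [dist_comm]; exact (Metric.mem_ball.1 hy).le
    simp [h0, Levi]

end K0

end ModuleC1

section ModuleC2
open MeasureTheory Complex Filter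

section K1
variable {E : Type*} [NormedAddCommGroup E] [InnerProductSpace ℂ E] [FiniteDimensional ℂ E]
  [MeasurableSpace E] [BorelSpace E] (μ : Measure E) [μ.IsAddHaarMeasure]

/-- bounded continuous real functions -/
def BC (W : E → ℝ) : Prop := Continuous W ∧ ∃ M, ∀ x, |W x| ≤ M

lemma BC.mul {f g : E → ℝ} (hf : BC f) (hg : BC g) : BC (fun x => f x * g x) := by
  obtain ⟨hf, M, hM⟩ := hf
  obtain ⟨hg, M', hM'⟩ := hg
  refine ⟨hf.mul hg, M * M', fun x => ?_⟩
  rw [abs_mul]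
  exact mul_le_mul (hM x) (hM' x) (abs_nonneg _) ((abs_nonneg _).trans (hM x))

lemma BC.add {f g : E → ℝ} (hf : BC f) (hg : BC g) : BC (fun x => f x + g x) := by
  obtain ⟨hf, M, hM⟩ := hf
  obtain ⟨hg, M', hM'⟩ := hg
  exact ⟨hf.add hg, M + M', fun x => (abs_add_le _ _).trans (add_le_add (hM x) (hM' x))⟩

lemma BC.const (a : ℝ) : BC (fun _ : E => a) := ⟨continuous_const, |a|, fun _ => le_rfl⟩

lemma BC.sum {κ : Type*} (s : Finset κ) {f : κ → E → ℝ} (hf : ∀ j, BC (f j)) :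
    BC (fun x => ∑ j ∈ s, f j x) := by
  classical
  induction s using Finset.induction_on with
  | empty => simpa using BC.const 0
  | insert a s ha ih => simpa only [Finset.sum_insert ha] using (hf a).add ih

lemma BC.exp {f : E → ℝ} (hf : BC f) : BC (fun x => Real.exp (f x)) := by
  obtain ⟨hf, M, hM⟩ := hf
  refine ⟨Real.continuous_exp.comp hf, Real.exp M, fun x => ?_⟩
  rw [Real.abs_exp]
  exact Real.exp_le_exp.2 ((le_abs_self _).trans (hM x))

lemma BC.of_compact {f : E → ℝ} (hf : Continuous f) (hc : HasCompactSupport f) : BC f := by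
  obtain ⟨M, hM⟩ := hc.exists_bound_of_continuous hf
  exact ⟨hf, M, hM⟩

lemma BC.normsq {f : E → ℂ} (hf : Continuous f) (hc : HasCompactSupport f) :
    BC (fun x => ‖f x‖ ^ 2) :=
  BC.of_compact (by fun_prop) (hc.comp_left (g := fun z : ℂ => ‖z‖ ^ 2) (by simp))

lemma BC.int {ν : Measure E} {W : E → ℝ} (hW : BC W) {f : E → ℂ} (hf : MemLp f 2 ν) :
    Integrable (fun x => W x * ‖f x‖ ^ 2) ν := by
  obtain ⟨hW, M, hM⟩ := hW
  exact (hf.integrable_norm_pow (p := 2) (by norm_num)).bdd_mul hW.aestronglyMeasurable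
    (Eventually.of_forall fun x => by rw [Real.norm_eq_abs]; exact hM x)

lemma mulMem {K : Set E} (hK : IsCompact K) {a γ : E → ℂ} (ha : ContinuousOn a K)
    (haK : ∀ x ∉ K, a x = 0) (hγ : MemLp γ 2 (μ.restrict K)) : MemLp (fun x => a x * γ x) 2 μ := by
  obtain ⟨M, hM⟩ := hK.exists_bound_of_continuousOn ha
  have e : (fun x => a x * γ x) = K.indicator (fun x => a x * γ x) := by
    ext x
    by_cases hx : x ∈ K
    · simp [hx]
    · simp [hx, haK x hx]
  rw [e, memLp_indicator_iff_restrict hK.measurableSet]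
  refine hγ.of_le_mul (c := M) ((ha.aestronglyMeasurable hK.measurableSet).mul hγ.1) ?_
  filter_upwards [ae_restrict_mem hK.measurableSet] with x hx
  rw [norm_mul]
  exact mul_le_mul_of_nonneg_right (hM x hx) (norm_nonneg _)

lemma mulInt [IsFiniteMeasureOnCompacts μ] {K : Set E} (hK : IsCompact K) {a γ : E → ℂ}
    (ha : ContinuousOn a K)
    (haK : ∀ x ∉ K, a x = 0) (hγ : MemLp γ 2 (μ.restrict K)) : Integrable (fun x => a x * γ x) μ := by
  have h1 := mulMem μ hK ha haK hγ
  have hs : (fun x => a x * γ x).support ⊆ K := fun x hx => by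
    by_contra h
    exact hx (by simp [haK x h])
  rw [← integrableOn_iff_integrable_of_support_subset hs]
  have : IsFiniteMeasure (μ.restrict K) := ⟨by
    rw [Measure.restrict_apply_univ]; exact hK.measure_lt_top⟩
  exact (h1.restrict K).integrable (by norm_num)

lemma sum_mul_sq_le {N : ℕ} (a g : Fin N → ℂ) :
    ‖∑ j, a j * g j‖ ^ 2 ≤ (∑ j, ‖a j‖ ^ 2) * ∑ j, ‖g j‖ ^ 2 := by
  calc ‖∑ j, a j * g j‖ ^ 2 ≤ (∑ j, ‖a j‖ * ‖g j‖) ^ 2 := by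
        gcongr
        refine (norm_sum_le _ _).trans (le_of_eq ?_)
        simp
    _ ≤ _ := Finset.sum_mul_sq_le_sq_mul_sq _ _ _

lemma norm_add_sq_le2 {F : Type*} [SeminormedAddCommGroup F] (a b : F) :
    ‖a + b‖ ^ 2 ≤ 2 * ‖a‖ ^ 2 + 2 * ‖b‖ ^ 2 := by
  have := norm_add_le a b
  nlinarith [norm_nonneg (a + b), norm_nonneg a, norm_nonneg b, sq_nonneg (‖a‖ - ‖b‖)]

lemma cross_le {N : ℕ} (a a' g : Fin N → ℂ) (h : ∀ j, ‖a j‖ = ‖a' j‖) :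
    ∑ j, ∑ k, (1 / 2 : ℝ) * ‖a j * g k - a k * g j‖ ^ 2 ≤ 2 * ((∑ j, ‖a' j‖ ^ 2) * ∑ j, ‖g j‖ ^ 2) := by
  calc ∑ j, ∑ k, (1 / 2 : ℝ) * ‖a j * g k - a k * g j‖ ^ 2
      ≤ ∑ j, ∑ k, (‖a' j‖ ^ 2 * ‖g k‖ ^ 2 + ‖a' k‖ ^ 2 * ‖g j‖ ^ 2) := by
        refine Finset.sum_le_sum fun j _ => Finset.sum_le_sum fun k _ => ?_
        have := norm_add_sq_le2 (a j * g k) (-(a k * g j))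
        rw [norm_neg, norm_mul, norm_mul, h, h, ← sub_eq_add_neg] at this
        nlinarith
    _ = _ := by
        simp only [Finset.sum_add_distrib]
        rw [Finset.sum_comm (f := fun j k => ‖a' k‖ ^ 2 * ‖g j‖ ^ 2)]
        simp only [← Finset.mul_sum, ← Finset.sum_mul]
        ring

variable {N : ℕ} (b : Fin N → E)

theorem K1 {φ ω η : E → ℝ} (hφ : ContDiff ℝ 2 φ) (hφc : HasCompactSupport φ)
    (hω : ContDiff ℝ 2 ω) (hωc : HasCompactSupport ω)
    (hη : ContDiff ℝ 2 η) (hηc : HasCompactSupport η)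
    {O : Set E} (hO : IsOpen O) (hηO : tsupport η ⊆ O)
    (hL : ∀ x ∈ O, ∀ ξ : Fin N → ℂ, (2 * (∑ j, ‖dz (b j) (fun y => (ω y : ℂ)) x‖ ^ 2 + Real.exp (ω x)))
      * ∑ j, ‖ξ j‖ ^ 2 ≤ Levi (fun y => φ y + ω y) x (∑ j, ξ j • b j))
    {γ : Fin N → E → ℂ} (hγ : ∀ j, MemLp (γ j) 2 (μ.restrict (tsupport η)))
    {τ : E → ℂ} (hτ : MemLp τ 2 (μ.restrict (tsupport η)))
    (hS : ∀ j k, ∀ v : E → ℂ, ContDiff ℝ 2 v → HasCompactSupport v → tsupport v ⊆ tsupport η →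
      ∫ x, db (b j) v x * γ k x ∂μ = ∫ x, db (b k) v x * γ j x ∂μ)
    (hT : ∀ v : E → ℂ, ContDiff ℝ 2 v → HasCompactSupport v → tsupport v ⊆ tsupport η →
      ∫ x, ∑ j, (dz (b j) v x * Real.exp (-φ x)) * γ j x ∂μ =
        ∫ x, (v x * Real.exp (-φ x + ω x)) * τ x ∂μ) :
    ∫ x, ∑ j, (2 * Real.exp (-φ x)) * ‖(η x : ℂ) * γ j x‖ ^ 2 ∂μ ≤
      ∫ x, ((2 * Real.exp (-φ x - ω x)) * ‖-(Real.exp (ω x) * η x : ℂ) * τ x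
          + ∑ j, dz (b j) (fun y => (η y : ℂ)) x * γ j x‖ ^ 2
        + ∑ j, ∑ k, (2 * Real.exp (-φ x - ω x)) * ‖dz (b j) (fun y => (η y : ℂ)) x * γ k x‖ ^ 2) ∂μ := by
  have : ProperSpace E := FiniteDimensional.proper ℂ E
  set K := tsupport η with hKdef
  have hK : IsCompact K := hηc
  have toC : ∀ {f : E → ℝ}, ContDiff ℝ 2 f → ContDiff ℝ 2 (fun y => (f y : ℂ)) :=
    fun hf => Complex.ofRealCLM.contDiff.comp hf
  have toCc : ∀ {f : E → ℝ}, HasCompactSupport f → HasCompactSupport (fun y => (f y : ℂ)) :=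
    fun hf => hf.comp_left (g := fun t : ℝ => (t : ℂ)) (by simp)
  have hdzc : ∀ {f : E → ℝ}, ContDiff ℝ 2 f → ∀ v, Continuous (dz v (fun y => (f y : ℂ))) :=
    fun hf v => (contDiff_dz (n := 1) (toC hf) v).continuous
  have hdbc : ∀ {f : E → ℝ}, ContDiff ℝ 2 f → ∀ v, Continuous (db v (fun y => (f y : ℂ))) :=
    fun hf v => (contDiff_db (n := 1) (toC hf) v).continuous
  have hdiff : ∀ {f : E → ℝ}, ContDiff ℝ 2 f → ∀ x, DifferentiableAt ℝ (fun y => (f y : ℂ)) x :=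
    fun hf x => (toC hf).differentiable (by norm_num) x
  have hsup : tsupport (fun y => (η y : ℂ)) = K := by
    rw [hKdef, tsupport, tsupport]; congr 1; ext x; simp
  have hη0 : ∀ x ∉ K, η x = 0 := fun x hx => image_eq_zero_of_notMem_tsupport hx
  have hdzη0 : ∀ v, ∀ x ∉ K, dz v (fun y => (η y : ℂ)) x = 0 := fun v x hx =>
    image_eq_zero_of_notMem_tsupport fun h => hx (hsup ▸ dz_support v h)
  have hdbη0 : ∀ v, ∀ x ∉ K, db v (fun y => (η y : ℂ)) x = 0 := fun v x hx =>
    image_eq_zero_of_notMem_tsupport fun h => hx (hsup ▸ db_support v h)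
  have cη : Continuous (fun y => (η y : ℂ)) := (toC hη).continuous
  have cω : Continuous (fun y => ((Real.exp (ω y) : ℝ) : ℂ)) := by
    have := hω.continuous; fun_prop
  -- the objects
  set β : Fin N → E → ℂ := fun j x => (η x : ℂ) * γ j x with hβdef
  set B : Fin N → Fin N → E → ℂ := fun j k x => db (b j) (fun y => (η y : ℂ)) x * γ k x
    - db (b k) (fun y => (η y : ℂ)) x * γ j x with hBdef
  set P : E → ℂ := fun x => -(Real.exp (ω x) * η x : ℂ) * τ x
          + ∑ j, dz (b j) (fun y => (η y : ℂ)) x * γ j x with hPdef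
  set G : E → ℂ := fun x => P x + ∑ j, (dz (b j) (fun y => (φ y : ℂ)) x * η x) * γ j x with hGdef
  have mβ : ∀ j, MemLp (β j) 2 μ := fun j => mulMem μ hK cη.continuousOn
    (fun x hx => by simp [hη0 x hx]) (hγ j)
  have mdη : ∀ j k, MemLp (fun x => dz (b j) (fun y => (η y : ℂ)) x * γ k x) 2 μ := fun j k =>
    mulMem μ hK (hdzc hη _).continuousOn (hdzη0 _) (hγ k)
  have mdbη : ∀ j k, MemLp (fun x => db (b j) (fun y => (η y : ℂ)) x * γ k x) 2 μ := fun j k =>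
    mulMem μ hK (hdbc hη _).continuousOn (hdbη0 _) (hγ k)
  have mB : ∀ j k, MemLp (B j k) 2 μ := fun j k => (mdbη j k).sub (mdbη k j)
  have mτ : MemLp (fun x => -(Real.exp (ω x) * η x : ℂ) * τ x) 2 μ :=
    mulMem μ hK (cω.mul cη).neg.continuousOn (fun x hx => by simp [hη0 x hx]) hτ
  have mP : MemLp P 2 μ := mτ.add (memLp_finset_sum _ fun j _ => mdη j j)
  have mφ : ∀ j, MemLp (fun x => (dz (b j) (fun y => (φ y : ℂ)) x * η x) * γ j x) 2 μ := fun j =>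
    mulMem μ hK ((hdzc hφ _).mul cη).continuousOn (fun x hx => by simp [hη0 x hx]) (hγ j)
  have mω : ∀ j, MemLp (fun x => (dz (b j) (fun y => (ω y : ℂ)) x * η x) * γ j x) 2 μ := fun j =>
    mulMem μ hK ((hdzc hω _).mul cη).continuousOn (fun x hx => by simp [hη0 x hx]) (hγ j)
  have mG : MemLp G 2 μ := mP.add (memLp_finset_sum _ fun j _ => mφ j)
  have hΦ : ContDiff ℝ 2 (fun y => φ y + ω y) := hφ.add hω
  have bω : BC (fun x => Real.exp (ω x)) := (BC.of_compact hω.continuous hωc).exp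
  have bo : BC (fun x => ∑ j, ‖dz (b j) (fun y => (ω y : ℂ)) x‖ ^ 2) := BC.sum _ fun j =>
    BC.normsq (hdzc hω _) (HasCompactSupport.dz (toCc hωc) _)
  have bc : BC (fun x => 2 * (∑ j, ‖dz (b j) (fun y => (ω y : ℂ)) x‖ ^ 2 + Real.exp (ω x))) :=
    (BC.const 2).mul (bo.add bω)
  have bφ : BC (fun x => Real.exp (-φ x)) :=
    (BC.of_compact hφ.continuous.neg (hφc.comp_left (g := fun t : ℝ => -t) (by simp))).exp
  have bΦ : BC (fun x => Real.exp (-(φ x + ω x))) :=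
    (BC.of_compact hΦ.continuous.neg ((hφc.add hωc).comp_left (g := fun t : ℝ => -t) (by simp))).exp
  have hwB : ∀ j k, ∀ w : E → ℂ, ContDiff ℝ 2 w → HasCompactSupport w →
      ∫ x, (β k x * db (b j) w x - β j x * db (b k) w x) ∂μ = - ∫ x, B j k x * w x ∂μ := by
    intro j k w hw hwc
    have hv : ContDiff ℝ 2 (fun x => (η x : ℂ) * w x) := (toC hη).mul hw
    have hvs : tsupport (fun x => (η x : ℂ) * w x) ⊆ K := by
      refine (tsupport_mul_subset_left (f := fun x => (η x : ℂ)) (g := w)).trans hsup.le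
    have hvc : HasCompactSupport (fun x => (η x : ℂ) * w x) :=
      (toCc hηc).mul_right
    have h1 := hS j k _ hv hvc hvs
    have e : ∀ v x, db v (fun x => (η x : ℂ) * w x) x =
        η x * db v w x + w x * db v (fun y => (η y : ℂ)) x := fun v x =>
      db_mul v (hdiff hη x) (hw.differentiable (by norm_num) x)
    have hi : ∀ j v, Integrable (fun x => db v (fun x => (η x : ℂ) * w x) x * γ j x) μ :=
      fun j v => mulInt μ hK (contDiff_db (n := 1) hv v).continuous.continuousOn
        (fun x hx => image_eq_zero_of_notMem_tsupport fun h => hx (hvs (db_support v h))) (hγ j)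
    have hi2 : ∀ j v, Integrable (fun x => (w x * db v (fun y => (η y : ℂ)) x) * γ j x) μ :=
      fun j v => mulInt μ hK (hw.continuous.mul (hdbc hη v)).continuousOn
        (fun x hx => by rw [hdbη0 v x hx, mul_zero]) (hγ j)
    have e1 : ∀ x, β k x * db (b j) w x - β j x * db (b k) w x =
        (db (b j) (fun x => (η x : ℂ) * w x) x * γ k x - db (b k) (fun x => (η x : ℂ) * w x) x * γ j x)
        - B j k x * w x := by
      intro x
      rw [e, e]; simp only [hβdef, hBdef]; ring
    have i3 : Integrable (fun x => B j k x * w x) μ := by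
      refine ((hi2 k (b j)).sub (hi2 j (b k))).congr (Eventually.of_forall fun x => ?_)
      simp only [hBdef, Pi.sub_apply]; ring
    simp only [e1]
    have i4 : Integrable (fun x => db (b j) (fun x => (η x : ℂ) * w x) x * γ k x
        - db (b k) (fun x => (η x : ℂ) * w x) x * γ j x) μ := (hi k (b j)).sub (hi j (b k))
    rw [integral_sub i4 i3, integral_sub (hi k (b j)) (hi j (b k)), h1]
    ring
  have hwG : ∀ w : E → ℂ, ContDiff ℝ 2 w → HasCompactSupport w →
      ∫ x, ∑ j, β j x * dz (b j) w x ∂μ = - ∫ x, G x * w x ∂μ := by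
    intro w hw hwc
    have hcx : ContDiff ℝ 2 (cexpw (fun x => -φ x)) := contDiff_cexpw hφ.neg
    have hwx : ContDiff ℝ 2 (fun x => w x * cexpw (fun x => -φ x) x) := hw.mul hcx
    have hv : ContDiff ℝ 2 (fun x => (η x : ℂ) * (w x * cexpw (fun x => -φ x) x)) := (toC hη).mul hwx
    have hvs : tsupport (fun x => (η x : ℂ) * (w x * cexpw (fun x => -φ x) x)) ⊆ K := by
      refine (tsupport_mul_subset_left (f := fun x => (η x : ℂ))
        (g := fun x => w x * cexpw (fun x => -φ x) x)).trans hsup.le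
    have hvc : HasCompactSupport (fun x => (η x : ℂ) * (w x * cexpw (fun x => -φ x) x)) :=
      (toCc hηc).mul_right
    have h1 := hT _ hv hvc hvs
    have e : ∀ v x, dz v (fun x => (η x : ℂ) * (w x * cexpw (fun x => -φ x) x)) x * Real.exp (-φ x) =
        η x * dz v w x + w x * dz v (fun y => (η y : ℂ)) x
          + w x * (dz v (fun y => (φ y : ℂ)) x * η x) := by
      intro v x
      rw [dz_mul v (hdiff hη x) (hwx.differentiable (by norm_num) x),
        dz_mul v (hw.differentiable (by norm_num) x) (hcx.differentiable (by norm_num) x),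
        dz_cexpw (hφ.neg.differentiable (by norm_num) x)]
      have hneg : dz v (fun y => ((-φ y : ℝ) : ℂ)) x = - dz v (fun y => (φ y : ℂ)) x := by
        rw [show (fun y => ((-φ y : ℝ) : ℂ)) = fun y => (-1 : ℂ) * (φ y : ℂ) by ext; simp,
          dz_const_mul v _ (hdiff hφ x)]
        ring
      rw [hneg]
      have hx : cexpw (fun x => -φ x) x * (Real.exp (-φ x) : ℂ) = 1 := by
        simp only [cexpw, neg_neg]
        rw [← ofReal_mul, ← Real.exp_add]; simp
      linear_combination (η x * (w x * dz v (fun y => (φ y : ℂ)) x + dz v w x)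
        + w x * dz v (fun y => (η y : ℂ)) x) * hx
    have e2 : ∀ x, (η x : ℂ) * (w x * cexpw (fun x => -φ x) x) * Real.exp (-φ x + ω x)
        = w x * (Real.exp (ω x) * η x) := by
      intro x
      have hx : cexpw (fun x => -φ x) x * (Real.exp (-φ x + ω x) : ℂ) = Real.exp (ω x) := by
        simp only [cexpw, neg_neg]
        rw [← ofReal_mul, ← Real.exp_add]; simp
      linear_combination (η x * w x) * hx
    simp only [e, e2] at h1
    have i1 : ∀ j v, Integrable (fun x => ((η x : ℂ) * dz v w x) * γ j x) μ := fun j v =>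
      mulInt μ hK (cη.mul (contDiff_dz (n := 1) hw v).continuous).continuousOn
        (fun x hx => by simp [hη0 x hx]) (hγ j)
    have i2 : ∀ j v, Integrable (fun x => (w x * dz v (fun y => (η y : ℂ)) x
          + w x * (dz v (fun y => (φ y : ℂ)) x * η x)) * γ j x) μ := fun j v =>
      mulInt μ hK ((hw.continuous.mul (hdzc hη v)).add
        (hw.continuous.mul ((hdzc hφ v).mul cη))).continuousOn
        (fun x hx => by simp [hη0 x hx, hdzη0 v x hx]) (hγ j)
    have i3 : Integrable (fun x => (w x * (Real.exp (ω x) * η x)) * τ x) μ :=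
      mulInt μ hK (hw.continuous.mul (cω.mul cη)).continuousOn
        (fun x hx => by simp [hη0 x hx]) hτ
    have e3 : ∀ x, ∑ j, (η x * dz (b j) w x + w x * dz (b j) (fun y => (η y : ℂ)) x
          + w x * (dz (b j) (fun y => (φ y : ℂ)) x * η x)) * γ j x =
        ∑ j, β j x * dz (b j) w x + ∑ j, (w x * dz (b j) (fun y => (η y : ℂ)) x
          + w x * (dz (b j) (fun y => (φ y : ℂ)) x * η x)) * γ j x := by
      intro x
      rw [← Finset.sum_add_distrib]
      exact Finset.sum_congr rfl fun j _ => by simp only [hβdef]; ring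
    have i4 : Integrable (fun x => ∑ j, β j x * dz (b j) w x) μ :=
      integrable_finset_sum _ fun j _ => (i1 j (b j)).congr
        (Eventually.of_forall fun x => by simp only [hβdef]; ring)
    have i5 : Integrable (fun x => ∑ j, (w x * dz (b j) (fun y => (η y : ℂ)) x
          + w x * (dz (b j) (fun y => (φ y : ℂ)) x * η x)) * γ j x) μ :=
      integrable_finset_sum _ fun j _ => i2 j (b j)
    simp only [e3] at h1
    rw [integral_add i4 i5] at h1
    have e4 : ∀ x, G x * w x = ∑ j, (w x * dz (b j) (fun y => (η y : ℂ)) x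
          + w x * (dz (b j) (fun y => (φ y : ℂ)) x * η x)) * γ j x
        - (w x * (Real.exp (ω x) * η x)) * τ x := by
      intro x
      simp only [hGdef, hPdef]
      simp only [add_mul, Finset.sum_mul, Finset.sum_add_distrib]
      have a1 : ∀ j, dz (b j) (fun y => (η y : ℂ)) x * γ j x * w x =
        w x * dz (b j) (fun y => (η y : ℂ)) x * γ j x := fun j => by ring
      have a2 : ∀ j, dz (b j) (fun y => (φ y : ℂ)) x * η x * γ j x * w x =
        w x * (dz (b j) (fun y => (φ y : ℂ)) x * η x) * γ j x := fun j => by ring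
      simp only [a1, a2]
      ring
    simp only [e4]
    rw [integral_sub i5 i3]
    linear_combination h1
  have hk0 := K0 μ b hΦ (hφc.add hωc) bc.1 bc.2 hO hK hηO hL mβ
    (fun j x hx => by simp [hβdef, hη0 x hx]) mB
    (fun j k x hx => by simp [hBdef, hdbη0 _ x hx]) mG
    (fun x hx => by simp [hGdef, hPdef, hη0 x hx, hdzη0 _ x hx]) hwB hwG
  -- simplification of the G term
  have eG : ∀ x, G x - ∑ j, dz (b j) (fun y => ((φ y + ω y : ℝ) : ℂ)) x * β j x =
      P x + -∑ j, (dz (b j) (fun y => (ω y : ℂ)) x * η x) * γ j x := by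
    intro x
    have : ∀ j, dz (b j) (fun y => ((φ y + ω y : ℝ) : ℂ)) x * β j x =
      (dz (b j) (fun y => (φ y : ℂ)) x * η x) * γ j x + (dz (b j) (fun y => (ω y : ℂ)) x * η x) * γ j x := by
      intro j
      simp only [ofReal_add, hβdef]
      rw [dz_add _ (hdiff hφ x) (hdiff hω x)]
      ring
    simp only [this, Finset.sum_add_distrib, hGdef]
    ring
  simp only [eG] at hk0
  have mPQ : MemLp (fun x => P x + -∑ j, (dz (b j) (fun y => (ω y : ℂ)) x * η x) * γ j x) 2 μ :=
    mP.add (memLp_finset_sum _ fun j _ => mω j).neg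
  have iR1 := bΦ.int mPQ
  have iR2 : Integrable (fun x => ∑ j, ∑ k, ((1 / 2) * Real.exp (-(φ x + ω x))) * ‖B j k x‖ ^ 2) μ :=
    integrable_finset_sum _ fun j _ => integrable_finset_sum _ fun k _ =>
      ((BC.const (1/2)).mul bΦ).int (mB j k)
  have iL : Integrable (fun x => ∑ j, (2 * Real.exp (-φ x)) * ‖(η x : ℂ) * γ j x‖ ^ 2) μ :=
    integrable_finset_sum _ fun j _ => ((BC.const 2).mul bφ).int (mβ j)
  have iY : Integrable (fun x => ∑ j, (2 * (Real.exp (-(φ x + ω x)) *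
      ∑ i, ‖dz (b i) (fun y => (ω y : ℂ)) x‖ ^ 2)) * ‖(η x : ℂ) * γ j x‖ ^ 2) μ :=
    integrable_finset_sum _ fun j _ => ((BC.const 2).mul (bΦ.mul bo)).int (mβ j)
  have bΦ' : BC (fun x => Real.exp (-φ x - ω x)) := by
    have h : (fun x => Real.exp (-φ x - ω x)) = fun x => Real.exp (-(φ x + ω x)) := by
      ext x; congr 1; ring
    rw [h]; exact bΦ
  have iZ : Integrable (fun x => ((2 * Real.exp (-φ x - ω x)) * ‖P x‖ ^ 2
        + ∑ j, ∑ k, (2 * Real.exp (-φ x - ω x)) * ‖dz (b j) (fun y => (η y : ℂ)) x * γ k x‖ ^ 2)) μ :=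
    (((BC.const 2).mul bΦ').int mP).add (integrable_finset_sum _ fun j _ =>
      integrable_finset_sum _ fun k _ => ((BC.const 2).mul bΦ').int (mdη j k))
  have eX : ∀ x, ∑ j, (2 * (∑ j, ‖dz (b j) (fun y => (ω y : ℂ)) x‖ ^ 2 + Real.exp (ω x)))
      * Real.exp (-(φ x + ω x)) * ‖β j x‖ ^ 2 = ∑ j, (2 * Real.exp (-φ x)) * ‖(η x : ℂ) * γ j x‖ ^ 2
      + ∑ j, (2 * (Real.exp (-(φ x + ω x)) *
      ∑ i, ‖dz (b i) (fun y => (ω y : ℂ)) x‖ ^ 2)) * ‖(η x : ℂ) * γ j x‖ ^ 2 := by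
    intro x
    rw [← Finset.sum_add_distrib]
    refine Finset.sum_congr rfl fun j _ => ?_
    have : Real.exp (ω x) * Real.exp (-(φ x + ω x)) = Real.exp (-φ x) := by
      rw [← Real.exp_add]; congr 1; ring
    simp only [hβdef]
    rw [← this]; ring
  simp only [eX] at hk0
  rw [integral_add iL iY, ← integral_add iR1 iR2] at hk0
  have hfin : ∫ x, (Real.exp (-(φ x + ω x)) * ‖P x + -∑ j, (dz (b j) (fun y => (ω y : ℂ)) x * η x) * γ j x‖ ^ 2
      + ∑ j, ∑ k, ((1 / 2) * Real.exp (-(φ x + ω x))) * ‖B j k x‖ ^ 2) ∂μ -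
      ∫ x, ∑ j, (2 * (Real.exp (-(φ x + ω x)) *
      ∑ i, ‖dz (b i) (fun y => (ω y : ℂ)) x‖ ^ 2)) * ‖(η x : ℂ) * γ j x‖ ^ 2 ∂μ ≤
      ∫ x, ((2 * Real.exp (-φ x - ω x)) * ‖P x‖ ^ 2
        + ∑ j, ∑ k, (2 * Real.exp (-φ x - ω x)) * ‖dz (b j) (fun y => (η y : ℂ)) x * γ k x‖ ^ 2) ∂μ := by
    have iR12 : Integrable (fun x => Real.exp (-(φ x + ω x)) *
        ‖P x + -∑ j, (dz (b j) (fun y => (ω y : ℂ)) x * η x) * γ j x‖ ^ 2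
      + ∑ j, ∑ k, ((1 / 2) * Real.exp (-(φ x + ω x))) * ‖B j k x‖ ^ 2) μ := iR1.add iR2
    rw [← integral_sub iR12 iY]
    refine integral_mono (iR12.sub iY) iZ fun x => ?_
    simp only [Pi.add_apply]
    have hE : Real.exp (-φ x - ω x) = Real.exp (-(φ x + ω x)) := by congr 1; ring
    rw [hE]
    set e := Real.exp (-(φ x + ω x)) with he
    have he0 : 0 < e := Real.exp_pos _
    have k1 := norm_add_sq_le2 (P x) (-∑ j, (dz (b j) (fun y => (ω y : ℂ)) x * η x) * γ j x)
    have k2 := sum_mul_sq_le (fun j => dz (b j) (fun y => (ω y : ℂ)) x) (fun j => (η x : ℂ) * γ j x)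
    have k3 := cross_le (fun j => db (b j) (fun y => (η y : ℂ)) x)
      (fun j => dz (b j) (fun y => (η y : ℂ)) x) (fun j => γ j x) (fun j => by
        rw [db_ofReal_eq_conj (hη.differentiable (by norm_num) x), RCLike.norm_conj])
    rw [norm_neg] at k1
    simp only [← mul_assoc] at k2
    have s1 : ∑ j, ∑ k, ((1 / 2) * e) * ‖B j k x‖ ^ 2 = e * ∑ j, ∑ k, (1 / 2 : ℝ) * ‖B j k x‖ ^ 2 := by
      simp only [Finset.mul_sum]
      exact Finset.sum_congr rfl fun j _ => Finset.sum_congr rfl fun k _ => by ring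
    have s2 : ∑ j, ∑ k, (2 * e) * ‖dz (b j) (fun y => (η y : ℂ)) x * γ k x‖ ^ 2 =
        e * (2 * ((∑ j, ‖dz (b j) (fun y => (η y : ℂ)) x‖ ^ 2) * ∑ k, ‖γ k x‖ ^ 2)) := by
      simp only [Finset.mul_sum, Finset.sum_mul, norm_mul]
      rw [Finset.sum_comm]
      exact Finset.sum_congr rfl fun j _ => Finset.sum_congr rfl fun k _ => by ring
    have s3 : ∑ j, (2 * (e * ∑ i, ‖dz (b i) (fun y => (ω y : ℂ)) x‖ ^ 2)) * ‖(η x : ℂ) * γ j x‖ ^ 2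
        = e * (2 * ((∑ i, ‖dz (b i) (fun y => (ω y : ℂ)) x‖ ^ 2) * ∑ j, ‖(η x : ℂ) * γ j x‖ ^ 2)) := by
      rw [← Finset.mul_sum]; ring
    rw [s1, s2, s3]
    have := mul_le_mul_of_nonneg_left k1 he0.le
    have := mul_le_mul_of_nonneg_left k2 he0.le
    have := mul_le_mul_of_nonneg_left k3 he0.le
    simp only [hBdef]
    linarith
  linarith

end K1

end ModuleC2

section ModuleC3
open MeasureTheory Complex Filter

section C3
variable {E : Type*} [NormedAddCommGroup E] [InnerProductSpace ℂ E] [FiniteDimensional ℂ E]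

open scoped Manifold in
lemma cutoff_exists {K V : Set E} (hK : IsCompact K) (hV : IsOpen V) (hKV : K ⊆ V) :
    ∃ χ : E → ℝ, ContDiff ℝ 2 χ ∧ HasCompactSupport χ ∧ tsupport χ ⊆ V ∧
      (∀ x, χ x ∈ Icc (0 : ℝ) 1) ∧ ∃ O, IsOpen O ∧ K ⊆ O ∧ ∀ x ∈ O, χ x = 1 := by
  have : ProperSpace E := FiniteDimensional.proper ℂ E
  have : FiniteDimensional ℝ E := FiniteDimensional.complexToReal E
  obtain ⟨L, hL, hKL, hLV⟩ := exists_compact_between hK hV hKV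
  obtain ⟨f, h1, h2, h3⟩ := exists_contMDiffMap_one_nhds_of_subset_interior (n := 2) 𝓘(ℝ, E)
    hK.isClosed hKL
  have ht : tsupport (f : E → ℝ) ⊆ L := closure_minimal (fun x hx => by
    by_contra h; exact hx (h2 x h)) hL.isClosed
  rw [eventually_nhdsSet_iff_exists] at h1
  obtain ⟨O, hO, hKO, h⟩ := h1
  exact ⟨f, f.contMDiff.contDiff, hL.of_isClosed_subset (isClosed_tsupport _) ht, ht.trans hLV, h3,
    O, hO, hKO, h⟩

lemma cutoff_mul {F : Type*} [NormedAddCommGroup F] [NormedSpace ℝ F] {χ : E → ℝ} {f : E → F}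
    {V : Set E} (hV : IsOpen V) (hχ : ContDiff ℝ 2 χ) (hs : tsupport χ ⊆ V)
    (hf : ContDiffOn ℝ 2 f V) : ContDiff ℝ 2 (fun x => χ x • f x) := by
  rw [contDiff_iff_contDiffAt]
  intro x
  by_cases hx : x ∈ tsupport χ
  · exact hχ.contDiffAt.smul (hf.contDiffAt (hV.mem_nhds (hs hx)))
  · have : (fun x => χ x • f x) =ᶠ[𝓝 x] fun _ => 0 := by
      filter_upwards [notMem_tsupport_iff_eventuallyEq.mp hx] with y hy
      simp [hy]
    exact contDiffAt_const.congr_of_eventuallyEq this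

variable [MeasurableSpace E] [BorelSpace E] (μ : Measure E) [μ.IsAddHaarMeasure]
variable {N : ℕ} (b : Fin N → E)

/-- Weight data for the Hörmander estimate. -/
structure Wt (V : Set E) (φ ω : E → ℝ) (η : ℕ → E → ℝ) : Prop where
  hV : IsOpen V
  hφ : ContDiffOn ℝ 2 φ V
  hω : ContDiffOn ℝ 2 ω V
  hη : ∀ k, ContDiff ℝ 2 (η k)
  hηc : ∀ k, HasCompactSupport (η k)
  hηV : ∀ k, tsupport (η k) ⊆ V
  hη1 : ∀ k x, η k x ∈ Icc (0 : ℝ) 1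
  hηlim : ∀ x ∈ V, ∀ᶠ k in atTop, η k =ᶠ[𝓝 x] fun _ => 1
  hηd : ∀ k, ∀ x ∈ V, ∑ j, ‖dz (b j) (fun y => (η k y : ℂ)) x‖ ^ 2 ≤ Real.exp (ω x)
  hL : ∀ x ∈ V, ∀ ξ : Fin N → ℂ, (2 * (∑ j, ‖dz (b j) (fun y => (ω y : ℂ)) x‖ ^ 2 + Real.exp (ω x)))
      * ∑ j, ‖ξ j‖ ^ 2 ≤ Levi (fun y => φ y + ω y) x (∑ j, ξ j • b j)

variable {b}

lemma Levi_congr {u v : E → ℝ} {x : E} (h : u =ᶠ[𝓝 x] v) (ξ : E) : Levi u x ξ = Levi v x ξ := by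
  simp only [Levi, h.fderiv.fderiv_eq]

lemma memLp_bdd_mul {K : Set E} (hK : IsCompact K) {a f : E → ℂ} (ha : ContinuousOn a K)
    (hf : MemLp f 2 (μ.restrict K)) : MemLp (fun x => a x * f x) 2 (μ.restrict K) := by
  obtain ⟨M, hM⟩ := hK.exists_bound_of_continuousOn ha
  refine MemLp.of_le_mul (c := M) hf ((ha.aestronglyMeasurable_of_isCompact hK hK.measurableSet).mul
    hf.1) ?_
  filter_upwards [ae_restrict_mem hK.measurableSet] with x hx
  rw [norm_mul]
  exact mul_le_mul_of_nonneg_right (hM x hx) (norm_nonneg _)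

theorem K2 {V : Set E} {φ ω : E → ℝ} {η : ℕ → E → ℝ} (W : Wt b V φ ω η)
    {G : Fin N → E → ℂ} (hG : ∀ j, MemLp (G j) 2 (μ.restrict V))
    {T : E → ℂ} (hT : MemLp T 2 (μ.restrict V))
    (h1 : ∀ j k, ∀ v : E → ℂ, ContDiff ℝ 2 v → HasCompactSupport v → tsupport v ⊆ V →
      ∫ x, db (b j) v x * (Real.exp (φ x / 2) * G k x) ∂μ =
        ∫ x, db (b k) v x * (Real.exp (φ x / 2) * G j x) ∂μ)
    (h2 : ∀ v : E → ℂ, ContDiff ℝ 2 v → HasCompactSupport v → tsupport v ⊆ V →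
      ∫ x, ∑ j, (dz (b j) v x * Real.exp (-φ x / 2)) * G j x ∂μ =
        ∫ x, (v x * Real.exp ((-φ x + ω x) / 2)) * T x ∂μ) (k : ℕ) :
    ∫ x in V, ∑ j, 2 * ‖(η k x : ℂ) * G j x‖ ^ 2 ∂μ ≤
      ∫ x in V, (2 * ‖-(η k x : ℂ) * T x
          + ∑ j, (Real.exp (-ω x / 2) * dz (b j) (fun y => (η k y : ℂ)) x) * G j x‖ ^ 2
        + ∑ j, ∑ i, 2 * ‖(Real.exp (-ω x / 2) * dz (b j) (fun y => (η k y : ℂ)) x) * G i x‖ ^ 2) ∂μ := by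
  obtain ⟨χ, hχ, hχc, hχV, -, O, hO, hKO, hχ1⟩ := cutoff_exists (W.hηc k) W.hV (W.hηV k)
  set K := tsupport (η k) with hKdef
  have hK : IsCompact K := W.hηc k
  have eO : ∀ f : E → ℝ, ∀ x ∈ O, (fun y => χ y • f y) =ᶠ[𝓝 x] f := fun f x hx => by
    filter_upwards [hO.mem_nhds hx] with y hy
    simp [hχ1 y hy]
  have eK : ∀ f : E → ℝ, ∀ x ∈ K, χ x • f x = f x := fun f x hx => by simp [hχ1 x (hKO hx)]
  have hOV : O ⊆ V := fun x hx => hχV (subset_tsupport _ (by simp [hχ1 x hx]))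
  have hφK : ContinuousOn φ K := W.hφ.continuousOn.mono (W.hηV k)
  have hωK : ContinuousOn ω K := W.hω.continuousOn.mono (W.hηV k)
  have hη0 : ∀ x ∉ K, η k x = 0 := fun x hx => image_eq_zero_of_notMem_tsupport hx
  have hsup : tsupport (fun y => (η k y : ℂ)) = K := by
    rw [hKdef, tsupport, tsupport]; congr 1; ext x; simp
  have hdzη0 : ∀ v, ∀ x ∉ K, dz v (fun y => (η k y : ℂ)) x = 0 := fun v x hx =>
    image_eq_zero_of_notMem_tsupport fun h => hx (hsup ▸ dz_support v h)
  have res : ∀ f : E → ℂ, MemLp f 2 (μ.restrict V) → MemLp f 2 (μ.restrict K) := fun f hf =>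
    hf.mono_measure (Measure.restrict_mono (W.hηV k) le_rfl)
  have hexp : ∀ f : E → ℝ, ContinuousOn f K → ContinuousOn (fun x => ((Real.exp (f x) : ℝ) : ℂ)) K :=
    fun f hf => by fun_prop
  have key := K1 μ b (φ := fun x => χ x • φ x) (ω := fun x => χ x • ω x) (η := η k)
    (cutoff_mul W.hV hχ hχV W.hφ) (hχc.smul_right) (cutoff_mul W.hV hχ hχV W.hω) hχc.smul_right
    (W.hη k) (W.hηc k) hO hKO (fun x hx ξ => by
      have e1 := eO φ x hx
      have e2 := eO ω x hx
      have e3 : (fun y => ((χ y • ω y : ℝ) : ℂ)) =ᶠ[𝓝 x] fun y => (ω y : ℂ) :=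
        e2.fun_comp (fun t : ℝ => (t : ℂ))
      have e4 : (fun y => χ y • φ y + χ y • ω y) =ᶠ[𝓝 x] fun y => φ y + ω y := e1.add e2
      rw [Levi_congr e4]
      simp only [e3.dz_eq]
      rw [show χ x • ω x = ω x from e2.self_of_nhds]
      exact W.hL x (hOV hx) ξ)
    (γ := fun j x => ((Real.exp (φ x / 2) : ℝ) : ℂ) * G j x)
    (fun j => memLp_bdd_mul μ hK (hexp _ (hφK.div_const 2)) (res _ (hG j)))
    (τ := fun x => ((Real.exp ((φ x - ω x) / 2) : ℝ) : ℂ) * T x)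
    (memLp_bdd_mul μ hK (hexp _ ((hφK.sub hωK).div_const 2)) (res _ hT))
    (fun j i v hv hvc hvs => h1 j i v hv hvc (hvs.trans (W.hηV k)))
    (fun v hv hvc hvs => by
      have := h2 v hv hvc (hvs.trans (W.hηV k))
      have a1 : ∀ x, ∑ j, dz (b j) v x * (Real.exp (-(χ x • φ x)) : ℂ) * (Real.exp (φ x / 2) * G j x)
          = ∑ j, (dz (b j) v x * Real.exp (-φ x / 2)) * G j x := by
        intro x
        refine Finset.sum_congr rfl fun j _ => ?_
        by_cases hx : x ∈ K
        · rw [eK _ x hx]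
          have : ((Real.exp (-φ x / 2) : ℝ) : ℂ) = (Real.exp (-φ x) : ℂ) * Real.exp (φ x / 2) := by
            rw [← ofReal_mul, ← Real.exp_add]; congr 2; ring
          rw [this]; ring
        · have : dz (b j) v x = 0 := image_eq_zero_of_notMem_tsupport fun h => hx (hvs (dz_support _ h))
          simp [this]
      have a2 : ∀ x, v x * (Real.exp (-(χ x • φ x) + χ x • ω x) : ℂ) * (Real.exp ((φ x - ω x) / 2) * T x)
          = (v x * Real.exp ((-φ x + ω x) / 2)) * T x := by
        intro x
        by_cases hx : x ∈ K
        · rw [eK _ x hx, eK _ x hx]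
          have : ((Real.exp ((-φ x + ω x) / 2) : ℝ) : ℂ) = (Real.exp (-φ x + ω x) : ℂ) *
              Real.exp ((φ x - ω x) / 2) := by
            rw [← ofReal_mul, ← Real.exp_add]; congr 2; ring
          rw [this]; ring
        · have : v x = 0 := image_eq_zero_of_notMem_tsupport fun h => hx (hvs h)
          simp [this]
      simp only [a1, a2]
      exact this)
  rw [setIntegral_eq_integral_of_forall_compl_eq_zero, setIntegral_eq_integral_of_forall_compl_eq_zero]
  · convert key using 1
    · congr 1; ext x
      refine Finset.sum_congr rfl fun j _ => ?_
      by_cases hx : x ∈ K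
      · rw [eK _ x hx]
        have : Real.exp (-φ x) * Real.exp (φ x / 2) ^ 2 = 1 := by
          rw [← Real.exp_nat_mul, ← Real.exp_add]; simp; ring_nf
        rw [norm_mul, norm_mul, norm_mul, Complex.norm_of_nonneg (Real.exp_pos _).le]
        linear_combination (-2 * (‖(η k x : ℂ)‖ * ‖G j x‖) ^ 2) * this
      · simp [hη0 x hx]
    · congr 1; ext x
      by_cases hx : x ∈ K
      · rw [eK _ x hx, eK _ x hx]
        have q1 : Real.exp (-φ x - ω x) * (Real.exp ((φ x + ω x) / 2)) ^ 2 = 1 := by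
          rw [← Real.exp_nat_mul, ← Real.exp_add, Real.exp_eq_one_iff]; push_cast; ring
        have q2 : (Real.exp (ω x) : ℂ) * Real.exp ((φ x - ω x) / 2) = Real.exp ((φ x + ω x) / 2) := by
          rw [← ofReal_mul, ← Real.exp_add]; congr 2; ring
        have q3 : (Real.exp (φ x / 2) : ℂ) = Real.exp ((φ x + ω x) / 2) * Real.exp (- ω x / 2) := by
          rw [← ofReal_mul, ← Real.exp_add]; congr 2; ring
        have q4 : -(Real.exp (ω x) * η k x : ℂ) * (Real.exp ((φ x - ω x) / 2) * T x)
          + ∑ j, dz (b j) (fun y => (η k y : ℂ)) x * (Real.exp (φ x / 2) * G j x) =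
          (Real.exp ((φ x + ω x) / 2) : ℂ) * (-(η k x : ℂ) * T x
          + ∑ j, (Real.exp (-ω x / 2) * dz (b j) (fun y => (η k y : ℂ)) x) * G j x) := by
          rw [mul_add, Finset.mul_sum]
          congr 1
          · linear_combination (-(η k x : ℂ) * T x) * q2
          · refine Finset.sum_congr rfl fun j _ => ?_
            rw [q3]; ring
        rw [q4]
        have q5 : ∀ z : ℂ, 2 * Real.exp (-φ x - ω x) * ‖(Real.exp ((φ x + ω x) / 2) : ℂ) * z‖ ^ 2 =
            2 * ‖z‖ ^ 2 := by
          intro z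
          rw [norm_mul, Complex.norm_of_nonneg (Real.exp_pos _).le]
          linear_combination (2 * ‖z‖ ^ 2) * q1
        rw [q5]
        congr 1
        refine Finset.sum_congr rfl fun j _ => Finset.sum_congr rfl fun i _ => ?_
        rw [← q5, q3]
        congr 3; ring
      · simp [hη0 x hx, hdzη0 _ x hx]
  · intro x hx
    have hx : x ∉ K := fun h => hx (W.hηV k h)
    simp [hη0 x hx, hdzη0 _ x hx]
  · intro x hx
    have hx : x ∉ K := fun h => hx (W.hηV k h)
    simp [hη0 x hx]

theorem lemmaK {V : Set E} {φ ω : E → ℝ} {η : ℕ → E → ℝ} (W : Wt b V φ ω η)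
    {G : Fin N → E → ℂ} (hG : ∀ j, MemLp (G j) 2 (μ.restrict V))
    {T : E → ℂ} (hT : MemLp T 2 (μ.restrict V))
    (h1 : ∀ j k, ∀ v : E → ℂ, ContDiff ℝ 2 v → HasCompactSupport v → tsupport v ⊆ V →
      ∫ x, db (b j) v x * (Real.exp (φ x / 2) * G k x) ∂μ =
        ∫ x, db (b k) v x * (Real.exp (φ x / 2) * G j x) ∂μ)
    (h2 : ∀ v : E → ℂ, ContDiff ℝ 2 v → HasCompactSupport v → tsupport v ⊆ V →
      ∫ x, ∑ j, (dz (b j) v x * Real.exp (-φ x / 2)) * G j x ∂μ =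
        ∫ x, (v x * Real.exp ((-φ x + ω x) / 2)) * T x ∂μ) :
    ∫ x in V, ∑ j, ‖G j x‖ ^ 2 ∂μ ≤ ∫ x in V, ‖T x‖ ^ 2 ∂μ := by
  have key := K2 μ W hG hT h1 h2
  have iG : Integrable (fun x => ∑ j, ‖G j x‖ ^ 2) (μ.restrict V) :=
    integrable_finset_sum _ fun j _ => (hG j).integrable_norm_pow (p := 2) (by norm_num)
  have iT : Integrable (fun x => ‖T x‖ ^ 2) (μ.restrict V) :=
    hT.integrable_norm_pow (p := 2) (by norm_num)
  have cη : ∀ k, Continuous (fun x => (η k x : ℂ)) := fun k =>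
    Complex.continuous_ofReal.comp (W.hη k).continuous
  have cdz : ∀ k j, Continuous (dz (b j) (fun y => (η k y : ℂ))) := fun k j =>
    (contDiff_dz (n := 1) (Complex.ofRealCLM.contDiff.comp (W.hη k)) (b j)).continuous
  have mω : ∀ k j, AEStronglyMeasurable (fun x => ((Real.exp (-ω x / 2) : ℝ) : ℂ) *
      dz (b j) (fun y => (η k y : ℂ)) x) (μ.restrict V) := fun k j => by
    refine ContinuousOn.aestronglyMeasurable ?_ W.hV.measurableSet
    have := W.hω.continuousOn
    have := (cdz k j).continuousOn (s := V)
    fun_prop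
  have hη1 : ∀ k x, ‖(η k x : ℂ)‖ ≤ 1 := fun k x => by
    rw [Complex.norm_of_nonneg (W.hη1 k x).1]; exact (W.hη1 k x).2
  have hc : ∀ k, ∀ x ∈ V, ∑ j, ‖((Real.exp (-ω x / 2) : ℝ) : ℂ) *
      dz (b j) (fun y => (η k y : ℂ)) x‖ ^ 2 ≤ 1 := by
    intro k x hx
    have := W.hηd k x hx
    have e : ∀ j, ‖((Real.exp (-ω x / 2) : ℝ) : ℂ) * dz (b j) (fun y => (η k y : ℂ)) x‖ ^ 2 =
        Real.exp (-ω x) * ‖dz (b j) (fun y => (η k y : ℂ)) x‖ ^ 2 := by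
      intro j
      rw [norm_mul, Complex.norm_of_nonneg (Real.exp_pos _).le, mul_pow, ← Real.exp_nat_mul]
      congr 2; push_cast; ring
    simp only [e]
    rw [← Finset.mul_sum]
    calc _ ≤ Real.exp (-ω x) * Real.exp (ω x) := mul_le_mul_of_nonneg_left this (Real.exp_pos _).le
      _ = 1 := by rw [← Real.exp_add]; simp
  have hdz0 : ∀ x ∈ V, ∀ᶠ k in atTop, η k x = 1 ∧ ∀ j, dz (b j) (fun y => (η k y : ℂ)) x = 0 := by
    intro x hx
    filter_upwards [W.hηlim x hx] with k hk
    refine ⟨hk.self_of_nhds, fun j => ?_⟩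
    have : (fun y => (η k y : ℂ)) =ᶠ[𝓝 x] fun _ => 1 := by
      filter_upwards [hk] with y hy; simp [hy]
    rw [this.dz_eq]; simp [dz]
  have L1 : Tendsto (fun k => ∫ x in V, ∑ j, 2 * ‖(η k x : ℂ) * G j x‖ ^ 2 ∂μ) atTop
      (𝓝 (∫ x in V, 2 * ∑ j, ‖G j x‖ ^ 2 ∂μ)) := by
    refine tendsto_integral_of_dominated_convergence (fun x => 2 * ∑ j, ‖G j x‖ ^ 2) ?_
      (iG.const_mul 2) ?_ ?_
    · intro k
      have : ∀ j, AEStronglyMeasurable (fun x => 2 * ‖(η k x : ℂ) * G j x‖ ^ 2) (μ.restrict V) :=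
        fun j => ((((cη k).aestronglyMeasurable.mul (hG j).1).norm.pow 2).const_mul 2)
      simpa only [Finset.sum_apply] using Finset.aestronglyMeasurable_fun_sum Finset.univ (fun j _ => this j)
    · intro k
      refine Eventually.of_forall fun x => ?_
      rw [Real.norm_of_nonneg (by positivity), Finset.mul_sum]
      refine Finset.sum_le_sum fun j _ => ?_
      rw [norm_mul, mul_pow]
      have := hη1 k x
      have : ‖(η k x : ℂ)‖ ^ 2 ≤ 1 := pow_le_one₀ (norm_nonneg _) this
      nlinarith [sq_nonneg ‖G j x‖]
    · filter_upwards [ae_restrict_mem W.hV.measurableSet] with x hx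
      refine tendsto_const_nhds.congr' ?_
      filter_upwards [hdz0 x hx] with k hk
      simp [hk.1, Finset.mul_sum]
  have L2 : Tendsto (fun k => ∫ x in V, (2 * ‖-(η k x : ℂ) * T x
          + ∑ j, (Real.exp (-ω x / 2) * dz (b j) (fun y => (η k y : ℂ)) x) * G j x‖ ^ 2
        + ∑ j, ∑ i, 2 * ‖(Real.exp (-ω x / 2) * dz (b j) (fun y => (η k y : ℂ)) x) * G i x‖ ^ 2) ∂μ)
      atTop (𝓝 (∫ x in V, 2 * ‖T x‖ ^ 2 ∂μ)) := by
    refine tendsto_integral_of_dominated_convergence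
      (fun x => 4 * ‖T x‖ ^ 2 + 6 * ∑ j, ‖G j x‖ ^ 2) ?_
      ((iT.const_mul 4).add (iG.const_mul 6)) ?_ ?_
    · intro k
      refine AEStronglyMeasurable.add ?_ ?_
      · refine (((AEStronglyMeasurable.add ((cη k).neg.aestronglyMeasurable.mul hT.1) ?_).norm.pow 2).const_mul 2)
        exact Finset.aestronglyMeasurable_fun_sum Finset.univ (fun j _ => (mω k j).mul (hG j).1)
      · exact Finset.aestronglyMeasurable_fun_sum Finset.univ (fun j _ =>
          Finset.aestronglyMeasurable_fun_sum Finset.univ (fun i _ =>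
            (((mω k j).mul (hG i).1).norm.pow 2).const_mul 2))
    · intro k
      filter_upwards [ae_restrict_mem W.hV.measurableSet] with x hx
      rw [Real.norm_of_nonneg (by positivity)]
      have hc' := hc k x hx
      set c : Fin N → ℂ := fun j => ((Real.exp (-ω x / 2) : ℝ) : ℂ) *
        dz (b j) (fun y => (η k y : ℂ)) x with hcdef
      have k1 := norm_add_sq_le2 (-(η k x : ℂ) * T x) (∑ j, c j * G j x)
      have k2 := sum_mul_sq_le c (fun j => G j x)
      have k4 : ‖-(η k x : ℂ) * T x‖ ^ 2 ≤ ‖T x‖ ^ 2 := by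
        rw [norm_mul, norm_neg, mul_pow]
        have : ‖(η k x : ℂ)‖ ^ 2 ≤ 1 := pow_le_one₀ (norm_nonneg _) (hη1 k x)
        nlinarith [sq_nonneg ‖T x‖]
      have k5 : ∑ j, ∑ i, 2 * ‖c j * G i x‖ ^ 2 = 2 * ((∑ j, ‖c j‖ ^ 2) * ∑ i, ‖G i x‖ ^ 2) := by
        simp only [Finset.mul_sum, Finset.sum_mul, norm_mul]
        rw [Finset.sum_comm]
        exact Finset.sum_congr rfl fun j _ => Finset.sum_congr rfl fun k _ => by ring
      have k6 : (∑ j, ‖c j‖ ^ 2) * ∑ i, ‖G i x‖ ^ 2 ≤ ∑ i, ‖G i x‖ ^ 2 :=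
        mul_le_of_le_one_left (by positivity) hc'
      change 2 * ‖-(η k x : ℂ) * T x + ∑ j, c j * G j x‖ ^ 2 + ∑ j, ∑ i, 2 * ‖c j * G i x‖ ^ 2 ≤ _
      rw [k5]
      linarith
    · filter_upwards [ae_restrict_mem W.hV.measurableSet] with x hx
      refine tendsto_const_nhds.congr' ?_
      filter_upwards [hdz0 x hx] with k hk
      simp [hk.1, hk.2]
  have := le_of_tendsto_of_tendsto' L1 L2 key
  rw [integral_const_mul, integral_const_mul] at this
  linarith

end C3

end ModuleC3

section ModuleC4
open MeasureTheory Complex Filter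

section hilb
variable {H₁ H₂ A D : Type*} [NormedAddCommGroup H₁] [InnerProductSpace ℂ H₁] [CompleteSpace H₁]
  [NormedAddCommGroup H₂] [InnerProductSpace ℂ H₂] [CompleteSpace H₂] [AddCommGroup A] [Module ℂ A]

theorem hilb (t : A →ₗ[ℂ] H₁) (a : A → H₂) (i : D → H₁) (d : D → H₂)
    (hadj : ∀ α h, inner ℂ (d h) (a α) = inner ℂ (i h) (t α))
    (hK : ∀ α γ, γ ∈ (Submodule.span ℂ (range d)).topologicalClosure →
      (∀ h, inner ℂ (d h) γ = inner ℂ (i h) (t α)) → ‖γ‖ ≤ ‖t α‖) (h : D) :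
    ∃ u : H₁, ‖u‖ ≤ ‖d h‖ ∧ ∀ α, inner ℂ (t α) (i h - u) = 0 := by
  set Z := (Submodule.span ℂ (range d)).topologicalClosure with hZ
  set R := (LinearMap.range t).topologicalClosure with hR
  have hZc : IsClosed (Z : Set H₂) := Submodule.isClosed_topologicalClosure _
  have hRc : IsClosed (R : Set H₁) := Submodule.isClosed_topologicalClosure _
  have : CompleteSpace Z := hZc.completeSpace_coe
  have : CompleteSpace R := hRc.completeSpace_coe
  have hdZ : ∀ h, d h ∈ Z := fun h =>
    Submodule.le_topologicalClosure _ (Submodule.subset_span ⟨h, rfl⟩)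
  have b1 : ∀ α, ‖inner ℂ (i h) (t α)‖ ≤ ‖d h‖ * ‖t α‖ := by
    intro α
    have hin : ∀ h, inner ℂ (d h) ((Z.orthogonalProjection (a α) : Z) : H₂) = inner ℂ (i h) (t α) := by
      intro h
      rw [← hadj]
      exact (Submodule.inner_orthogonalProjection_eq_of_mem_left (⟨d h, hdZ h⟩ : Z) (a α))
    have := hK α _ (Z.orthogonalProjection (a α)).2 hin
    rw [← hin h]
    exact (norm_inner_le_norm _ _).trans (mul_le_mul_of_nonneg_left this (norm_nonneg _))
  have b2 : ∀ r ∈ R, ‖inner ℂ (i h) r‖ ≤ ‖d h‖ * ‖r‖ := by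
    intro r hr
    have hcl : IsClosed {r : H₁ | ‖inner ℂ (i h) r‖ ≤ ‖d h‖ * ‖r‖} :=
      isClosed_le (by fun_prop) (by fun_prop)
    refine closure_minimal (s := (LinearMap.range t : Set H₁)) ?_ hcl hr
    rintro _ ⟨α, rfl⟩
    exact b1 α
  refine ⟨(R.orthogonalProjection (i h) : R), ?_, fun α => ?_⟩
  · set u := R.orthogonalProjection (i h) with hu
    have h1 := b2 u u.2
    have h2 : inner ℂ (i h) (u : H₁) = inner ℂ (u : H₁) (u : H₁) :=
      (Submodule.inner_orthogonalProjection_eq_of_mem_right u (i h)).symm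
    rw [h2, inner_self_eq_norm_sq_to_K] at h1
    by_cases h0 : ‖(u : H₁)‖ = 0
    · rw [h0]; exact norm_nonneg _
    · have : ‖((‖(u : H₁)‖ : ℂ)) ^ 2‖ = ‖(u : H₁)‖ * ‖(u : H₁)‖ := by
        rw [norm_pow, Complex.norm_real, norm_norm, sq]
      erw [this] at h1
      exact le_of_mul_le_mul_right h1 ((norm_nonneg _).lt_of_ne' h0)
  · have := Submodule.sub_starProjection_mem_orthogonal (K := R) (i h)
    exact this _ (Submodule.le_topologicalClosure _ ⟨α, rfl⟩)
end hilb

section C4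
variable {E : Type*} [NormedAddCommGroup E] [InnerProductSpace ℂ E] [FiniteDimensional ℂ E]
  [MeasurableSpace E] [BorelSpace E] (μ : Measure E) [μ.IsAddHaarMeasure]
variable {N : ℕ} {b : Fin N → E}

/-- test functions -/
def TestSub (V : Set E) : Submodule ℂ (E → ℂ) where
  carrier := {h | ContDiff ℝ 2 h ∧ HasCompactSupport h ∧ tsupport h ⊆ V}
  add_mem' := fun {f g} hf hg => ⟨hf.1.add hg.1, hf.2.1.add hg.2.1,
    (tsupport_add f g).trans (union_subset hf.2.2 hg.2.2)⟩
  zero_mem' := ⟨contDiff_const, HasCompactSupport.zero, by simp [tsupport]⟩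
  smul_mem' := fun c f hf => ⟨contDiff_const.smul hf.1, hf.2.1.smul_left (f := fun _ => c),
    (tsupport_smul_subset_right (fun _ => c) f).trans hf.2.2⟩

lemma cont_mul {V : Set E} (hV : IsOpen V) {a : E → ℝ} {f : E → ℂ} (ha : ContinuousOn a V)
    (hf : Continuous f) (hs : tsupport f ⊆ V) : Continuous (fun x => (a x : ℂ) * f x) := by
  rw [continuous_iff_continuousAt]
  intro x
  by_cases hx : x ∈ tsupport f
  · exact (Complex.continuous_ofReal.continuousAt.comp (ha.continuousAt (hV.mem_nhds (hs hx)))).mul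
      hf.continuousAt
  · have : (fun x => (a x : ℂ) * f x) =ᶠ[𝓝 x] fun _ => 0 := by
      filter_upwards [notMem_tsupport_iff_eventuallyEq.mp hx] with y hy
      simp [hy]
    exact continuousAt_const.congr this.symm

lemma wmem {V : Set E} (hV : IsOpen V) {a : E → ℝ} {f : E → ℂ} (ha : ContinuousOn a V)
    (hf : Continuous f) (hc : HasCompactSupport f) (hs : tsupport f ⊆ V) :
    MemLp (fun x => (a x : ℂ) * f x) 2 (μ.restrict V) :=
  ((cont_mul hV ha hf hs).memLp_of_hasCompactSupport (hc.mul_left)).restrict V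

lemma inner_toLp {ν : Measure E} {f : E → ℂ} (hf : MemLp f 2 ν) (g : Lp ℂ 2 ν) :
    inner ℂ (hf.toLp f) g = ∫ x, (starRingEnd ℂ) (f x) * g x ∂ν := by
  rw [L2.inner_def]
  refine integral_congr_ae ?_
  filter_upwards [hf.coeFn_toLp] with x hx
  rw [hx, RCLike.inner_apply, mul_comm]

lemma inner_toLp2 {ν : Measure E} {f g : E → ℂ} (hf : MemLp f 2 ν) (hg : MemLp g 2 ν) :
    inner ℂ (hf.toLp f) (hg.toLp g) = ∫ x, (starRingEnd ℂ) (f x) * g x ∂ν := by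
  rw [inner_toLp]
  refine integral_congr_ae ?_
  filter_upwards [hg.coeFn_toLp] with x hx
  rw [hx]

lemma TestSub.star {V : Set E} {h : E → ℂ} (hh : h ∈ TestSub V) :
    (fun x => (starRingEnd ℂ) (h x)) ∈ TestSub V := by
  obtain ⟨h1, h2, h3⟩ := hh
  refine ⟨Complex.conjCLE.contDiff.comp h1, h2.comp_left (g := starRingEnd ℂ) (by simp), ?_⟩
  refine (closure_mono fun x hx => ?_).trans h3
  simpa using hx

section
variable {V : Set E}
lemma TestSub.db_cont {h : E → ℂ} (hh : h ∈ TestSub V) (v : E) : Continuous (db v h) :=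
  (contDiff_db (n := 1) hh.1 v).continuous
lemma TestSub.dz_cont {h : E → ℂ} (hh : h ∈ TestSub V) (v : E) : Continuous (dz v h) :=
  (contDiff_dz (n := 1) hh.1 v).continuous
lemma TestSub.db_supp {h : E → ℂ} (hh : h ∈ TestSub V) (v : E) : tsupport (db v h) ⊆ V :=
  (db_support v).trans hh.2.2
lemma TestSub.dz_supp {h : E → ℂ} (hh : h ∈ TestSub V) (v : E) : tsupport (dz v h) ⊆ V :=
  (dz_support v).trans hh.2.2
lemma TestSub.db_int {h : E → ℂ} (hh : h ∈ TestSub V) {h' : E → ℂ} (hh' : h' ∈ TestSub V) (v : E) :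
    Integrable (fun x => db v h x * h' x) μ :=
  ((TestSub.db_cont hh v).mul hh'.1.continuous).integrable_of_hasCompactSupport hh'.2.1.mul_left
lemma TestSub.dz_int {h : E → ℂ} (hh : h ∈ TestSub V) {h' : E → ℂ} (hh' : h' ∈ TestSub V) (v : E) :
    Integrable (fun x => dz v h x * h' x) μ :=
  ((TestSub.dz_cont hh v).mul hh'.1.continuous).integrable_of_hasCompactSupport hh'.2.1.mul_left
lemma TestSub.dzs_mem {h : E → ℂ} (hh : h ∈ TestSub V) (v : E) (x : E) (hx : x ∉ V) : dz v h x = 0 :=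
  image_eq_zero_of_notMem_tsupport fun h' => hx (TestSub.dz_supp hh v h')
lemma TestSub.dbs_mem {h : E → ℂ} (hh : h ∈ TestSub V) (v : E) (x : E) (hx : x ∉ V) : db v h x = 0 :=
  image_eq_zero_of_notMem_tsupport fun h' => hx (TestSub.db_supp hh v h')
lemma TestSub.z_mem {h : E → ℂ} (hh : h ∈ TestSub V) (x : E) (hx : x ∉ V) : h x = 0 :=
  image_eq_zero_of_notMem_tsupport fun h' => hx (hh.2.2 h')
end

/-- sum of dz -/
def divz (b : Fin N → E) (β : Fin N → E → ℂ) (x : E) : ℂ := ∑ j, dz (b j) (β j) x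

end C4

end ModuleC4

section ModuleC5
open MeasureTheory Complex Filter

section C5
variable {E : Type*} [NormedAddCommGroup E] [InnerProductSpace ℂ E] [FiniteDimensional ℂ E]
  [MeasurableSpace E] [BorelSpace E] (μ : Measure E) [μ.IsAddHaarMeasure]
variable {N : ℕ} {b : Fin N → E} {V : Set E}

lemma wmem_dz (hV : IsOpen V) {a : E → ℝ} (ha : ContinuousOn a V) (v : E) {w : E → ℂ} (hw : w ∈ TestSub V) :
    MemLp (fun x => (a x : ℂ) * dz v w x) 2 (μ.restrict V) :=
  wmem μ hV ha (TestSub.dz_cont hw v) (hw.2.1.dz v) (TestSub.dz_supp hw v)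

lemma wmem_db (hV : IsOpen V) {a : E → ℝ} (ha : ContinuousOn a V) (v : E) {w : E → ℂ} (hw : w ∈ TestSub V) :
    MemLp (fun x => (a x : ℂ) * db v w x) 2 (μ.restrict V) :=
  wmem μ hV ha (TestSub.db_cont hw v) (hw.2.1.db v) (TestSub.db_supp hw v)

lemma wmem_t (hV : IsOpen V) {a : E → ℝ} (ha : ContinuousOn a V) {w : E → ℂ} (hw : w ∈ TestSub V) :
    MemLp (fun x => (a x : ℂ) * w x) 2 (μ.restrict V) :=
  wmem μ hV ha hw.1.continuous hw.2.1 hw.2.2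

/-- weighted `dz` as a linear map on test functions -/
def Ldz (hV : IsOpen V) {a : E → ℝ} (ha : ContinuousOn a V) (v : E) :
    TestSub V →ₗ[ℂ] Lp ℂ 2 (μ.restrict V) where
  toFun w := (wmem_dz μ hV ha v w.2).toLp _
  map_add' w w' := by
    rw [← MemLp.toLp_add]
    refine MemLp.toLp_congr _ _ (Eventually.of_forall fun x => ?_)
    simp only [Pi.add_apply]
    have : dz v (fun y => (w : E → ℂ) y + (w' : E → ℂ) y) x = _ :=
      dz_add v (w.2.1.differentiable (by norm_num) x) (w'.2.1.differentiable (by norm_num) x)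
    rw [← mul_add, ← this]; rfl
  map_smul' c w := by
    rw [RingHom.id_apply, ← MemLp.toLp_const_smul]
    refine MemLp.toLp_congr _ _ (Eventually.of_forall fun x => ?_)
    simp only [Pi.smul_apply, smul_eq_mul]
    have : dz v (fun y => c * (w : E → ℂ) y) x = _ :=
      dz_const_mul v c (w.2.1.differentiable (by norm_num) x)
    rw [mul_left_comm, ← this]; rfl

theorem thmH (hb : Submodule.span ℂ (range b) = ⊤) {φ ω : E → ℝ} {η : ℕ → E → ℝ} (W : Wt b V φ ω η)
    {h : E → ℂ} (hh : h ∈ TestSub V) :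
    ∃ F : E → ℂ, DifferentiableOn ℂ F V ∧
      ∫⁻ x in V, ‖(Real.exp ((-φ x + ω x) / 2) : ℂ) * (h x - F x)‖ₑ ^ 2 ∂μ ≤
        ∑ j, ∫⁻ x in V, ‖(Real.exp (-φ x / 2) : ℂ) * db (b j) h x‖ₑ ^ 2 ∂μ := by
  have : ProperSpace E := FiniteDimensional.proper ℂ E
  have hV := W.hV
  have cφ := W.hφ.continuousOn
  have cω := W.hω.continuousOn
  have cp : ContinuousOn (fun x => Real.exp (φ x / 2)) V := by fun_prop
  have cm : ContinuousOn (fun x => Real.exp (-φ x / 2)) V := by fun_prop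
  have c1p : ContinuousOn (fun x => Real.exp ((φ x - ω x) / 2)) V := by fun_prop
  have c1m : ContinuousOn (fun x => Real.exp ((-φ x + ω x) / 2)) V := by fun_prop
  have epm : ∀ x, (Real.exp (-φ x / 2) : ℂ) * Real.exp (φ x / 2) = 1 := fun x => by
    rw [← ofReal_mul, ← Real.exp_add]; ring_nf; simp
  have epm1 : ∀ x, (Real.exp ((-φ x + ω x) / 2) : ℂ) * Real.exp ((φ x - ω x) / 2) = 1 := fun x => by
    rw [← ofReal_mul, ← Real.exp_add]; ring_nf; simp
  let H := Lp ℂ 2 (μ.restrict V)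
  let t : (Fin N → TestSub V) →ₗ[ℂ] H :=
    -∑ j, (Ldz μ hV c1p (b j)).comp (LinearMap.proj j)
  let a : (Fin N → TestSub V) → PiLp 2 (fun _ : Fin N => H) := fun β =>
    WithLp.toLp 2 fun j => (wmem_t μ hV cp (β j).2).toLp _
  let i : TestSub V → H := fun h => (wmem_t μ hV c1m h.2).toLp _
  let d : TestSub V → PiLp 2 (fun _ : Fin N => H) := fun h =>
    WithLp.toLp 2 fun j => (wmem_db μ hV cm (b j) h.2).toLp _
  have ht : ∀ β, t β = -∑ j, (wmem_dz μ hV c1p (b j) (β j).2).toLp _ := fun β => by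
    simp only [t, LinearMap.neg_apply, LinearMap.sum_apply, LinearMap.comp_apply,
      LinearMap.proj_apply]; rfl
  have hconjE : ∀ s : ℝ, (starRingEnd ℂ) (s : ℂ) = s := fun s => Complex.conj_ofReal s
  have hadj : ∀ α h, inner ℂ (d h) (a α) = inner ℂ (i h) (t α) := by
    intro α h
    rw [PiLp.inner_apply, ht, inner_neg_right, inner_sum, ← Finset.sum_neg_distrib]
    refine Finset.sum_congr rfl fun j _ => ?_
    simp only [d, a, i]
    rw [inner_toLp2, inner_toLp2]
    rw [setIntegral_eq_integral_of_forall_compl_eq_zero (fun x hx => by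
      simp [TestSub.z_mem (α j).2 x hx]),
      setIntegral_eq_integral_of_forall_compl_eq_zero (fun x hx => by
      simp [TestSub.z_mem h.2 x hx])]
    have := ibp_dz μ (f := fun x => (starRingEnd ℂ) ((h : E → ℂ) x)) (g := α j)
      ((TestSub.star h.2).1.of_le (by norm_num)) ((α j).2.1.of_le (by norm_num)) (TestSub.star h.2).2.1 (b j)
    have e1 : ∀ x, (starRingEnd ℂ) ((Real.exp (-φ x / 2) : ℂ) * db (b j) h x) *
        ((Real.exp (φ x / 2) : ℂ) * (α j : E → ℂ) x) =
        dz (b j) (fun x => (starRingEnd ℂ) ((h : E → ℂ) x)) x * (α j : E → ℂ) x := by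
      intro x
      rw [dz_star (h.2.1.differentiable (by norm_num) x), map_mul, hconjE]
      linear_combination ((starRingEnd ℂ) (db (b j) h x) * (α j : E → ℂ) x) * epm x
    have e2 : ∀ x, (starRingEnd ℂ) ((Real.exp ((-φ x + ω x) / 2) : ℂ) * (h : E → ℂ) x) *
        ((Real.exp ((φ x - ω x) / 2) : ℂ) * dz (b j) (α j) x) =
        (starRingEnd ℂ) ((h : E → ℂ) x) * dz (b j) (α j) x := by
      intro x
      rw [map_mul, hconjE]
      linear_combination ((starRingEnd ℂ) ((h : E → ℂ) x) * dz (b j) (α j) x) * epm1 x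
    simp only [e1, e2]
    rw [this]; simp
  have hK : ∀ α γ, γ ∈ (Submodule.span ℂ (range d)).topologicalClosure →
      (∀ h, inner ℂ (d h) γ = inner ℂ (i h) (t α)) → ‖γ‖ ≤ ‖t α‖ := by
    intro α γ hγ hγt
    have key := lemmaK μ W (G := fun j => (γ j : E → ℂ)) (T := (t α : E → ℂ)) (fun j => Lp.memLp _)
      (Lp.memLp _) ?_ ?_
    · have n1 : ∀ f : H, ∫ x in V, ‖f x‖ ^ 2 ∂μ = ‖f‖ ^ 2 := by
        intro f
        have := L2.inner_def (𝕜 := ℂ) f f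
        rw [inner_self_eq_norm_sq_to_K] at this
        have h2 : ∀ x, inner ℂ (f x) (f x) = ((‖f x‖ ^ 2 : ℝ) : ℂ) := fun x => by
          rw [inner_self_eq_norm_sq_to_K]; simp
        simp only [h2] at this
        rw [integral_complex_ofReal] at this
        have h3 : ((‖f‖ ^ 2 : ℝ) : ℂ) = ((∫ x in V, ‖f x‖ ^ 2 ∂μ : ℝ) : ℂ) := by
          rw [← this]; simp
        exact (Complex.ofReal_injective h3).symm
      rw [integral_finsetSum _ (fun j _ => (Lp.memLp (γ j)).integrable_norm_pow (p := 2) (by norm_num)),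
        n1] at key
      simp only [n1] at key
      rw [← PiLp.norm_sq_eq_of_L2] at key
      exact le_of_sq_le_sq key (norm_nonneg _)
    · intro j k v hv hvc hvs
      have hvT : v ∈ TestSub V := ⟨hv, hvc, hvs⟩
      have hvT' := TestSub.star hvT
      set p : Fin N → H := fun j => (wmem_dz μ hV cp (b j) hvT').toLp _ with hp
      have hpi : ∀ j, ∀ f : H, inner ℂ (p j) f = ∫ x, db (b j) v x * (Real.exp (φ x / 2) * f x) ∂μ := by
        intro j f
        rw [hp, inner_toLp, setIntegral_eq_integral_of_forall_compl_eq_zero (fun x hx => by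
          simp [TestSub.dzs_mem hvT' _ x hx])]
        congr 1; ext x
        rw [dz_star (hv.differentiable (by norm_num) x), map_mul, hconjE]
        simp only [starRingEnd_self_apply]; ring
      rw [← hpi, ← hpi]
      let Λ : PiLp 2 (fun _ : Fin N => H) →L[ℂ] ℂ :=
        (innerSL ℂ (p j)).comp (PiLp.proj 2 (fun _ : Fin N => H) k) -
        (innerSL ℂ (p k)).comp (PiLp.proj 2 (fun _ : Fin N => H) j)
      have hΛ : (Submodule.span ℂ (range d)).topologicalClosure ≤ LinearMap.ker Λ.toLinearMap := by
        refine Submodule.topologicalClosure_minimal _ ?_ Λ.isClosed_ker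
        rw [Submodule.span_le]
        rintro _ ⟨h, rfl⟩
        change inner ℂ (p j) (d h k) - inner ℂ (p k) (d h j) = 0
        have e : ∀ j k, inner ℂ (p j) (d h k) = ∫ x, db (b j) v x * db (b k) h x ∂μ := by
          intro j k
          simp only [hp, d]
          rw [inner_toLp2, setIntegral_eq_integral_of_forall_compl_eq_zero (fun x hx => by
            simp [TestSub.dzs_mem hvT' _ x hx])]
          congr 1; ext x
          rw [dz_star (hv.differentiable (by norm_num) x), map_mul, hconjE]
          simp only [starRingEnd_self_apply]
          linear_combination (db (b j) v x * db (b k) h x) * epm x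
        have e' : ∀ j k, ∫ x, db (b j) v x * db (b k) h x ∂μ = - ∫ x, v x * db (b j) (db (b k) h) x ∂μ := by
          intro j k
          rw [ibp_db μ (hv.of_le (by norm_num)) (contDiff_db (n := 1) h.2.1 (b k)) hvc]
          simp
        rw [e, e, e', e', sub_eq_zero]
        congr 2; ext x
        rw [db_db_comm h.2.1.contDiffAt]
      have := hΛ hγ
      rw [LinearMap.mem_ker] at this
      exact sub_eq_zero.1 this
    · intro v hv hvc hvs
      have hvT : v ∈ TestSub V := ⟨hv, hvc, hvs⟩
      have hvT' := TestSub.star hvT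
      have := hγt ⟨_, hvT'⟩
      rw [PiLp.inner_apply] at this
      simp only [d, i] at this
      rw [inner_toLp] at this
      rw [Finset.sum_congr rfl (fun j _ => inner_toLp _ (γ j))] at this
      rw [setIntegral_eq_integral_of_forall_compl_eq_zero (fun x hx => by
          simp [TestSub.z_mem hvT' x hx])] at this
      have e1 : ∀ j, ∫ x in V, (starRingEnd ℂ) ((Real.exp (-φ x / 2) : ℂ) *
          db (b j) (fun x => (starRingEnd ℂ) (v x)) x) * γ j x ∂μ
          = ∫ x, (dz (b j) v x * Real.exp (-φ x / 2)) * γ j x ∂μ := by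
        intro j
        rw [setIntegral_eq_integral_of_forall_compl_eq_zero (fun x hx => by
          simp [TestSub.dbs_mem hvT' _ x hx])]
        congr 1; ext x
        rw [db_star (hv.differentiable (by norm_num) x), map_mul, hconjE]
        simp only [starRingEnd_self_apply]; ring
      simp only [e1] at this
      rw [integral_finsetSum, this]
      · congr 1; ext x
        rw [map_mul, hconjE]
        simp only [starRingEnd_self_apply]; ring
      · intro j _
        have hi : Integrable (fun x => (Real.exp (-φ x / 2) * dz (b j) v x : ℂ) * γ j x) (μ.restrict V) := by
          have := MemLp.integrable_mul (wmem_dz μ hV cm (b j) hvT) (Lp.memLp (γ j))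
          exact this
        have hi := (integrableOn_iff_integrable_of_support_subset (s := V) (μ := μ)
          (f := fun x => (Real.exp (-φ x / 2) * dz (b j) v x : ℂ) * γ j x) (fun x hx => by
            by_contra h; exact hx (by simp [TestSub.dzs_mem hvT _ x h]))).1 hi
        refine hi.congr (Eventually.of_forall fun x => by simp only []; ring)
  obtain ⟨u, hu1, hu2⟩ := hilb t a i d hadj hK ⟨h, hh⟩
  -- the function
  have hw := weyl μ (V := V) (b := b)
    (F := fun x => h x - (Real.exp ((φ x - ω x) / 2) : ℂ) * u x) hb hV ?_ ?_
  · obtain ⟨F, hF, hFe⟩ := hw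
    refine ⟨F, hF, ?_⟩
    have e1 : ∫⁻ x in V, ‖(Real.exp ((-φ x + ω x) / 2) : ℂ) * (h x - F x)‖ₑ ^ 2 ∂μ =
        ∫⁻ x in V, ‖u x‖ₑ ^ 2 ∂μ := by
      refine lintegral_congr_ae ?_
      filter_upwards [hFe] with x hx
      rw [← hx, sub_sub_cancel, ← mul_assoc, epm1, one_mul]
    have n1 : ∀ f : H, ∫⁻ x in V, ‖f x‖ₑ ^ 2 ∂μ = ENNReal.ofReal (‖f‖ ^ 2) := by
      intro f
      rw [← eLpNorm_two_sq, ← Lp.enorm_def, ENNReal.ofReal_pow (norm_nonneg _), ofReal_norm]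
    have e2 : ∀ j, ∫⁻ x in V, ‖(Real.exp (-φ x / 2) : ℂ) * db (b j) h x‖ₑ ^ 2 ∂μ =
        ENNReal.ofReal (‖d ⟨h, hh⟩ j‖ ^ 2) := by
      intro j
      rw [← n1]
      refine lintegral_congr_ae ?_
      filter_upwards [(wmem_db μ hV cm (b j) hh).coeFn_toLp] with x hx
      simp only [d]
      rw [hx]
    rw [e1, n1]
    simp only [e2]
    rw [← ENNReal.ofReal_sum_of_nonneg (fun j _ => sq_nonneg _), ← PiLp.norm_sq_eq_of_L2]
    exact ENNReal.ofReal_le_ofReal (pow_le_pow_left₀ (norm_nonneg _) hu1 2)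
  · intro K hKV hKc
    refine MemLp.sub ?_ ?_
    · exact (hh.1.continuous.memLp_of_hasCompactSupport hh.2.1).restrict K
    · refine memLp_bdd_mul μ hKc ?_ ((Lp.memLp u).mono_measure (Measure.restrict_mono hKV le_rfl))
      have := c1p.mono hKV
      exact Complex.continuous_ofReal.comp_continuousOn this
  · intro j w hw hwc hws
    have hwT : w ∈ TestSub V := ⟨hw, hwc, hws⟩
    have hwT' := TestSub.star hwT
    have := hu2 (Pi.single j ⟨_, hwT'⟩)
    have ht' : t (Pi.single j ⟨_, hwT'⟩) = - (wmem_dz μ hV c1p (b j) hwT').toLp _ := by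
      simp only [t, LinearMap.neg_apply, LinearMap.sum_apply, LinearMap.comp_apply,
        LinearMap.proj_apply]
      rw [Finset.sum_eq_single j]
      · rw [Pi.single_eq_same]; rfl
      · intro k _ hk; simp [Pi.single_eq_of_ne hk]
      · simp
    rw [ht', inner_neg_left, neg_eq_zero, inner_toLp, setIntegral_eq_integral_of_forall_compl_eq_zero
      (fun x hx => by simp [TestSub.dzs_mem hwT' _ x hx])] at this
    rw [← this]
    have hae : ∀ᵐ x ∂μ, x ∈ V → (i ⟨h, hh⟩ - u : H) x = (Real.exp ((-φ x + ω x) / 2) : ℂ) * h x - u x := by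
      rw [← ae_restrict_iff' hV.measurableSet]
      filter_upwards [Lp.coeFn_sub (i ⟨h, hh⟩) u, (wmem_t μ hV c1m hh).coeFn_toLp] with x h1 h2
      rw [h1, Pi.sub_apply]
      simp only [i]
      rw [h2]
    refine integral_congr_ae ?_
    filter_upwards [hae] with x hx
    by_cases hxV : x ∈ V
    · rw [hx hxV, dz_star (hw.differentiable (by norm_num) x), map_mul, hconjE]
      simp only [starRingEnd_self_apply]
      linear_combination (-(db (b j) w x * h x)) * epm1 x
    · simp [TestSub.dbs_mem hwT _ x hxV, TestSub.dzs_mem hwT' _ x hxV]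

end C5

end ModuleC5

section ModuleD1
open MeasureTheory Complex Filter

/-- a C² function of one variable, together with its derivatives -/
structure C2f (χ χ1 χ2 : ℝ → ℝ) : Prop where
  h1 : ∀ t, HasDerivAt χ (χ1 t) t
  h2 : ∀ t, HasDerivAt χ1 (χ2 t) t
  h3 : Continuous χ2

lemma C2f.contDiff {χ χ1 χ2 : ℝ → ℝ} (h : C2f χ χ1 χ2) : ContDiff ℝ 2 χ := by
  have e1 : deriv χ = χ1 := funext fun t => (h.h1 t).deriv
  have e2 : deriv χ1 = χ2 := funext fun t => (h.h2 t).deriv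
  rw [show (2 : WithTop ℕ∞) = 1 + 1 by norm_num, contDiff_succ_iff_deriv]
  refine ⟨fun t => (h.h1 t).differentiableAt, by simp, ?_⟩
  rw [e1, contDiff_one_iff_deriv, e2]
  exact ⟨fun t => (h.h2 t).differentiableAt, h.h3⟩

lemma growth (m : ℕ → ℝ) : ∃ χ χ1 χ2 : ℝ → ℝ, C2f χ χ1 χ2 ∧ (∀ t, 0 ≤ χ t) ∧ (∀ t, 0 ≤ χ1 t) ∧ (∀ t, 0 ≤ χ2 t) ∧
    (∀ t ≤ 0, χ t = 0) ∧ ∀ t, 3 ≤ t → m ⌊t⌋₊ ≤ χ t ∧ m ⌊t⌋₊ ≤ χ1 t := by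
  set M : ℝ → ℝ := fun t => ∑ k ∈ Finset.range (⌊t⌋₊ + 4), |m k| with hM
  have hMm : Monotone M := fun s t hst => by
    refine Finset.sum_le_sum_of_subset_of_nonneg ?_ fun _ _ _ => abs_nonneg _
    exact Finset.range_subset_range.2 (by have := Nat.floor_mono hst; omega)
  have hM0 : ∀ t, 0 ≤ M t := fun t => Finset.sum_nonneg fun _ _ => abs_nonneg _
  obtain ⟨A, hA⟩ := exists_continuous_forall_mem_convex_of_local_const (X := ℝ) (E := ℝ)
    (t := fun x => Ici (M x)) (fun x => convex_Ici _) (fun x => ⟨M (x + 1), by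
      filter_upwards [gt_mem_nhds (lt_add_one x)] with y hy
      exact hMm (le_of_lt hy)⟩)
  have hA : ∀ t, M t ≤ A t := hA
  set a : ℝ → ℝ := fun t => A t * min 1 (max t 0) with ha
  have hac : Continuous a := by fun_prop
  have ha0 : ∀ t, 0 ≤ a t := fun t => mul_nonneg ((hM0 t).trans (hA t)) (by positivity)
  have hai : ∀ x y, IntervalIntegrable a volume x y := fun x y => hac.intervalIntegrable x y
  set χ1 : ℝ → ℝ := fun t => ∫ x in (0:ℝ)..t, a x with hχ1
  have d1 : ∀ t, HasDerivAt χ1 (a t) t := fun t => hac.integral_hasStrictDerivAt 0 t |>.hasDerivAt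
  have hχ1c : Continuous χ1 := continuous_iff_continuousAt.2 fun t => (d1 t).continuousAt
  have hi1 : ∀ x y, IntervalIntegrable χ1 volume x y := fun x y => hχ1c.intervalIntegrable x y
  set χ : ℝ → ℝ := fun t => ∫ x in (0:ℝ)..t, χ1 x with hχ
  have d0 : ∀ t, HasDerivAt χ (χ1 t) t := fun t => hχ1c.integral_hasStrictDerivAt 0 t |>.hasDerivAt
  have z1 : ∀ t ≤ 0, χ1 t = 0 := by
    intro t ht
    simp only [hχ1]
    rw [intervalIntegral.integral_zero_ae]
    refine Eventually.of_forall fun x hx => ?_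
    rw [uIoc_of_ge ht] at hx
    simp [ha, max_eq_right hx.2]
  have z0 : ∀ t ≤ 0, χ t = 0 := by
    intro t ht
    simp only [hχ]
    rw [intervalIntegral.integral_zero_ae]
    refine Eventually.of_forall fun x hx => ?_
    rw [uIoc_of_ge ht] at hx
    exact z1 x hx.2
  have m1 : Monotone χ1 := monotone_of_deriv_nonneg (fun t => (d1 t).differentiableAt)
    fun t => by rw [(d1 t).deriv]; exact ha0 t
  have p1 : ∀ t, 0 ≤ χ1 t := fun t => by
    rcases le_total t 0 with h | h
    · exact (z1 t h).ge
    · have := m1 h; rwa [z1 0 le_rfl] at this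
  have m0 : Monotone χ := monotone_of_deriv_nonneg (fun t => (d0 t).differentiableAt)
    fun t => by rw [(d0 t).deriv]; exact p1 t
  have p0 : ∀ t, 0 ≤ χ t := fun t => by
    rcases le_total t 0 with h | h
    · exact (z0 t h).ge
    · have := m0 h; rwa [z0 0 le_rfl] at this
  have l1 : ∀ t, 2 ≤ t → M (t - 1) ≤ χ1 t := by
    intro t ht
    have e : χ1 t = χ1 (t - 1) + ∫ x in (t-1)..t, a x :=
      (intervalIntegral.integral_add_adjacent_intervals (hai _ _) (hai _ _)).symm
    have : ∫ x in (t-1)..t, M (t - 1) ≤ ∫ x in (t-1)..t, a x := by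
      refine intervalIntegral.integral_mono_on (by linarith) (by simp) (hai _ _) fun x hx => ?_
      have : min 1 (max x 0) = 1 := min_eq_left (le_max_of_le_left (by linarith [hx.1]))
      simp only [ha, this, mul_one]
      exact (hMm hx.1).trans (hA x)
    simp at this
    have := p1 (t - 1)
    linarith
  have l0 : ∀ t, 3 ≤ t → M (t - 2) ≤ χ t := by
    intro t ht
    have e : χ t = χ (t - 1) + ∫ x in (t-1)..t, χ1 x :=
      (intervalIntegral.integral_add_adjacent_intervals (hi1 _ _) (hi1 _ _)).symm
    have : ∫ x in (t-1)..t, M (t - 2) ≤ ∫ x in (t-1)..t, χ1 x := by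
      refine intervalIntegral.integral_mono_on (by linarith) (by simp) (hi1 _ _) fun x hx => ?_
      refine le_trans ?_ (l1 x (by linarith [hx.1]))
      exact hMm (by linarith [hx.1])
    simp at this
    have := p0 (t - 1)
    linarith
  have hm : ∀ t, 3 ≤ t → m ⌊t⌋₊ ≤ M (t - 2) := by
    intro t ht
    refine (le_abs_self _).trans (Finset.single_le_sum (f := fun k => |m k|) (fun _ _ => abs_nonneg _) ?_)
    rw [Finset.mem_range]
    have h2 : t < ⌊t - 2⌋₊ + 1 + 2 := by linarith [Nat.lt_floor_add_one (t - 2)]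
    have h3 : (⌊t⌋₊ : ℝ) < ((⌊t - 2⌋₊ + 4 : ℕ) : ℝ) := by
      push_cast
      linarith [Nat.floor_le (show 0 ≤ t by linarith)]
    exact_mod_cast h3
  refine ⟨χ, χ1, a, ⟨d0, d1, hac⟩, p0, p1, ha0, z0, fun t ht => ⟨(hm t ht).trans (l0 t ht),
    (hm t ht).trans (le_trans (hMm (by linarith)) (l1 t (by linarith)))⟩⟩

/-- positive part powers -/
lemma pos_cube_deriv (t : ℝ) : HasDerivAt (fun t : ℝ => (max t 0) ^ 3) (3 * (max t 0) ^ 2) t := by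
  rcases lt_trichotomy t 0 with h | h | h
  · have : (fun t : ℝ => (max t 0) ^ 3) =ᶠ[𝓝 t] fun _ => 0 := by
      filter_upwards [gt_mem_nhds h] with y hy; simp [max_eq_right (le_of_lt hy)]
    rw [max_eq_right h.le]
    simpa using (hasDerivAt_const t (0:ℝ)).congr_of_eventuallyEq this
  · subst h
    rw [hasDerivAt_iff_isLittleO]
    simp only [max_self, sub_zero, ne_eq, OfNat.ofNat_ne_zero, not_false_eq_true, zero_pow, mul_zero, smul_zero]
    have h1 : (fun x : ℝ => (max x 0) ^ 3) =O[𝓝 0] fun x : ℝ => x ^ 3 := by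
      refine Asymptotics.IsBigO.of_bound 1 (Eventually.of_forall fun x => ?_)
      simp only [norm_pow, one_mul]
      refine pow_le_pow_left₀ (norm_nonneg _) ?_ 3
      rw [Real.norm_of_nonneg (le_max_right _ _)]
      exact max_le (Real.le_norm_self x) (norm_nonneg _)
    refine h1.trans_isLittleO ?_
    simpa using Asymptotics.isLittleO_pow_pow (𝕜 := ℝ) (show 1 < 3 by norm_num)
  · have : (fun t : ℝ => (max t 0) ^ 3) =ᶠ[𝓝 t] fun t => t ^ 3 := by
      filter_upwards [lt_mem_nhds h] with y hy; simp [max_eq_left (le_of_lt hy)]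
    rw [max_eq_left h.le]
    simpa using (hasDerivAt_pow 3 t).congr_of_eventuallyEq this

lemma pos_sq_deriv (t : ℝ) : HasDerivAt (fun t : ℝ => (max t 0) ^ 2) (2 * (max t 0)) t := by
  rcases lt_trichotomy t 0 with h | h | h
  · have : (fun t : ℝ => (max t 0) ^ 2) =ᶠ[𝓝 t] fun _ => 0 := by
      filter_upwards [gt_mem_nhds h] with y hy; simp [max_eq_right (le_of_lt hy)]
    rw [max_eq_right h.le]
    simpa using (hasDerivAt_const t (0:ℝ)).congr_of_eventuallyEq this
  · subst h
    rw [hasDerivAt_iff_isLittleO]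
    simp only [max_self, sub_zero, ne_eq, OfNat.ofNat_ne_zero, not_false_eq_true, zero_pow, mul_zero, smul_zero]
    have h1 : (fun x : ℝ => (max x 0) ^ 2) =O[𝓝 0] fun x : ℝ => x ^ 2 := by
      refine Asymptotics.IsBigO.of_bound 1 (Eventually.of_forall fun x => ?_)
      simp only [norm_pow, one_mul]
      refine pow_le_pow_left₀ (norm_nonneg _) ?_ 2
      rw [Real.norm_of_nonneg (le_max_right _ _)]
      exact max_le (Real.le_norm_self x) (norm_nonneg _)
    refine h1.trans_isLittleO ?_
    simpa using Asymptotics.isLittleO_pow_pow (𝕜 := ℝ) (show 1 < 2 by norm_num)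
  · have : (fun t : ℝ => (max t 0) ^ 2) =ᶠ[𝓝 t] fun t => t ^ 2 := by
      filter_upwards [lt_mem_nhds h] with y hy; simp [max_eq_left (le_of_lt hy)]
    rw [max_eq_left h.le]
    simpa using (hasDerivAt_pow 2 t).congr_of_eventuallyEq this

/-- regularized positive part -/
def rp (t : ℝ) : ℝ := ((max (t + 1) 0) ^ 3 - 2 * (max t 0) ^ 3 + (max (t - 1) 0) ^ 3) / 6
/-- first derivative -/
def rp1 (t : ℝ) : ℝ := ((max (t + 1) 0) ^ 2 - 2 * (max t 0) ^ 2 + (max (t - 1) 0) ^ 2) / 2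
/-- second derivative -/
def rp2 (t : ℝ) : ℝ := max (t + 1) 0 - 2 * max t 0 + max (t - 1) 0

lemma rp_C2f : C2f rp rp1 rp2 := by
  refine ⟨fun t => ?_, fun t => ?_, by unfold rp2; fun_prop⟩
  · have h1 := (pos_cube_deriv (t + 1)).comp_add_const t 1
    have h2 := pos_cube_deriv t
    have h3 := (pos_cube_deriv (t - 1)).comp_sub_const t 1
    refine HasDerivAt.congr_deriv (((h1.sub (h2.const_mul 2)).add h3).div_const 6) ?_
    simp only [rp1]; ring
  · have h1 := (pos_sq_deriv (t + 1)).comp_add_const t 1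
    have h2 := pos_sq_deriv t
    have h3 := (pos_sq_deriv (t - 1)).comp_sub_const t 1
    refine HasDerivAt.congr_deriv (((h1.sub (h2.const_mul 2)).add h3).div_const 2) ?_
    simp only [rp2]; ring

lemma rp_cases (t : ℝ) : (t ≤ -1 ∧ rp t = 0 ∧ rp1 t = 0 ∧ rp2 t = 0) ∨
    (-1 ≤ t ∧ t ≤ 0 ∧ rp t = (t + 1) ^ 3 / 6 ∧ rp1 t = (t + 1) ^ 2 / 2 ∧ rp2 t = t + 1) ∨
    (0 ≤ t ∧ t ≤ 1 ∧ rp t = ((t + 1) ^ 3 - 2 * t ^ 3) / 6 ∧ rp1 t = ((t + 1) ^ 2 - 2 * t ^ 2) / 2 ∧ rp2 t = 1 - t) ∨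
    (1 ≤ t ∧ rp t = t ∧ rp1 t = 1 ∧ rp2 t = 0) := by
  rcases le_total t (-1) with h | h
  · left
    simp [rp, rp1, rp2, max_eq_right (show t + 1 ≤ 0 by linarith), max_eq_right (show t ≤ 0 by linarith),
      max_eq_right (show t - 1 ≤ 0 by linarith), h]
  rcases le_total t 0 with h' | h'
  · right; left
    simp [rp, rp1, rp2, max_eq_left (show 0 ≤ t + 1 by linarith), max_eq_right (show t ≤ 0 by linarith),
      max_eq_right (show t - 1 ≤ 0 by linarith), h, h']
  rcases le_total t 1 with h'' | h''
  · right; right; left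
    simp [rp, rp1, rp2, max_eq_left (show 0 ≤ t + 1 by linarith), max_eq_left (show 0 ≤ t by linarith),
      max_eq_right (show t - 1 ≤ 0 by linarith), h', h'']
    ring
  · right; right; right
    simp only [rp, rp1, rp2, max_eq_left (show 0 ≤ t + 1 by linarith), max_eq_left (show 0 ≤ t by linarith),
      max_eq_left (show 0 ≤ t - 1 by linarith)]
    refine ⟨h'', ?_, ?_, ?_⟩ <;> ring

lemma rp_le {t : ℝ} (h : t ≤ -1) : rp t = 0 := by
  rcases rp_cases t with h1 | h1 | h1 | h1
  · exact h1.2.1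
  · rw [h1.2.2.1, show t = -1 by linarith [h1.1]]; norm_num
  · linarith [h1.1]
  · linarith [h1.1]

lemma rp_ge {t : ℝ} (h : 1 ≤ t) : rp t = t := by
  rcases rp_cases t with h1 | h1 | h1 | h1
  · linarith [h1.1]
  · linarith [h1.1]
  · rw [h1.2.2.1, show t = 1 by linarith [h1.1]]; norm_num
  · exact h1.2.1

lemma rp_props (t : ℝ) : 0 ≤ rp t ∧ t ≤ rp t ∧ rp t ≤ max t 0 + 1 ∧ 0 ≤ rp1 t ∧ rp1 t ≤ 1 ∧ 0 ≤ rp2 t := by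
  rcases rp_cases t with ⟨h, h1, h2, h3⟩ | ⟨h, h', h1, h2, h3⟩ | ⟨h, h', h1, h2, h3⟩ | ⟨h, h1, h2, h3⟩
  · rw [h1, h2, h3]; exact ⟨le_rfl, by linarith, by positivity, le_rfl, by norm_num, le_rfl⟩
  · rw [h1, h2, h3, max_eq_right h']
    have : 0 ≤ t + 1 := by linarith
    have hc : (t + 1) ^ 3 ≤ 1 := pow_le_one₀ this (by linarith)
    have hc2 : (t + 1) ^ 2 ≤ 1 := pow_le_one₀ this (by linarith)
    refine ⟨by positivity, ?_, by linarith, by positivity, by linarith, this⟩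
    have : 0 ≤ (t + 1) ^ 3 / 6 := by positivity
    linarith
  · rw [h1, h2, h3, max_eq_left h]
    have q1 : 0 ≤ t * (1 - t) := mul_nonneg h (by linarith)
    have q2 : 0 ≤ (1 - t) ^ 3 := by have : 0 ≤ 1 - t := by linarith
                                    positivity
    have q3 : 0 ≤ t * (t * (1 - t)) := mul_nonneg h q1
    have q4 : 0 ≤ t ^ 3 := by positivity
    refine ⟨by nlinarith, by nlinarith, by nlinarith, by nlinarith, by nlinarith, by linarith⟩
  · rw [h1, h2, h3, max_eq_left (by linarith)]
    exact ⟨by linarith, le_rfl, by linarith, by norm_num, le_rfl, le_rfl⟩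

end ModuleD1

section ModuleD2
open MeasureTheory Complex Filter

/-- squared gradient along a complex line -/
def Gsq {E : Type*} [NormedAddCommGroup E] [NormedSpace ℂ E] (u : E → ℝ) (x ξ : E) : ℝ :=
  ((fderiv ℝ u x ξ) ^ 2 + (fderiv ℝ u x (I • ξ)) ^ 2) / 4

lemma Gsq_nonneg {E : Type*} [NormedAddCommGroup E] [NormedSpace ℂ E] (u : E → ℝ) (x ξ : E) : 0 ≤ Gsq u x ξ := by
  unfold Gsq; positivity

section levicalc
variable {E : Type*} [NormedAddCommGroup E] [NormedSpace ℂ E] {u v : E → ℝ} {x : E}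

lemma cd2_fderiv (h : ContDiffAt ℝ 2 u x) : DifferentiableAt ℝ (fderiv ℝ u) x :=
  (h.fderiv_right (m := 1) (by norm_num)).differentiableAt (by norm_num)

lemma cd2_ev (h : ContDiffAt ℝ 2 u x) : ∀ᶠ y in 𝓝 x, DifferentiableAt ℝ u y := by
  have : ∀ᶠ y in 𝓝 x, ContDiffAt ℝ 2 u y := h.eventually (by simp)
  filter_upwards [this] with y hy using hy.differentiableAt (by norm_num)

lemma D2_chain {χ χ1 : ℝ → ℝ} {c : ℝ} (h : ContDiffAt ℝ 2 u x)
    (h1 : ∀ᶠ t in 𝓝 (u x), HasDerivAt χ (χ1 t) t) (h2 : HasDerivAt χ1 c (u x)) (ξ : E) :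
    fderiv ℝ (fderiv ℝ (fun y => χ (u y))) x ξ ξ =
      χ1 (u x) * fderiv ℝ (fderiv ℝ u) x ξ ξ + c * (fderiv ℝ u x ξ) ^ 2 := by
  have hu := (cd2_ev h).self_of_nhds
  have ev : fderiv ℝ (fun y => χ (u y)) =ᶠ[𝓝 x] fun y => χ1 (u y) • fderiv ℝ u y := by
    filter_upwards [cd2_ev h, h.continuousAt.eventually h1] with y hy hy1
    exact (hy1.comp_hasFDerivAt y hy.hasFDerivAt).fderiv
  have hc : HasFDerivAt (fun y => χ1 (u y)) (c • fderiv ℝ u x) x :=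
    h2.comp_hasFDerivAt x hu.hasFDerivAt
  rw [ev.fderiv_eq, fderiv_fun_smul hc.differentiableAt (cd2_fderiv h), hc.fderiv]
  simp; ring

lemma D2_mul (h : ContDiffAt ℝ 2 u x) (h' : ContDiffAt ℝ 2 v x) (ξ : E) :
    fderiv ℝ (fderiv ℝ (fun y => u y * v y)) x ξ ξ =
      u x * fderiv ℝ (fderiv ℝ v) x ξ ξ + v x * fderiv ℝ (fderiv ℝ u) x ξ ξ
       + 2 * (fderiv ℝ u x ξ * fderiv ℝ v x ξ) := by
  have hu := (cd2_ev h).self_of_nhds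
  have hv := (cd2_ev h').self_of_nhds
  have ev : fderiv ℝ (fun y => u y * v y) =ᶠ[𝓝 x] fun y => u y • fderiv ℝ v y + v y • fderiv ℝ u y := by
    filter_upwards [cd2_ev h, cd2_ev h'] with y hy hy1
    exact fderiv_fun_mul hy hy1
  have d1 : DifferentiableAt ℝ (fun y => u y • fderiv ℝ v y) x := hu.smul (cd2_fderiv h')
  have d2 : DifferentiableAt ℝ (fun y => v y • fderiv ℝ u y) x := hv.smul (cd2_fderiv h)
  rw [ev.fderiv_eq, fderiv_fun_add d1 d2, fderiv_fun_smul hu (cd2_fderiv h'), fderiv_fun_smul hv (cd2_fderiv h)]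
  simp; ring

lemma D2_add (h : ContDiffAt ℝ 2 u x) (h' : ContDiffAt ℝ 2 v x) (ξ : E) :
    fderiv ℝ (fderiv ℝ (fun y => u y + v y)) x ξ ξ =
      fderiv ℝ (fderiv ℝ u) x ξ ξ + fderiv ℝ (fderiv ℝ v) x ξ ξ := by
  have ev : fderiv ℝ (fun y => u y + v y) =ᶠ[𝓝 x] fun y => fderiv ℝ u y + fderiv ℝ v y := by
    filter_upwards [cd2_ev h, cd2_ev h'] with y hy hy1
    exact fderiv_fun_add hy hy1
  rw [ev.fderiv_eq, fderiv_fun_add (cd2_fderiv h) (cd2_fderiv h')]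
  simp

lemma Levi_chain {χ χ1 : ℝ → ℝ} {c : ℝ} (h : ContDiffAt ℝ 2 u x)
    (h1 : ∀ᶠ t in 𝓝 (u x), HasDerivAt χ (χ1 t) t) (h2 : HasDerivAt χ1 c (u x)) (ξ : E) :
    Levi (fun y => χ (u y)) x ξ = χ1 (u x) * Levi u x ξ + c * Gsq u x ξ := by
  simp only [Levi, Gsq, D2_chain h h1 h2]; ring

lemma Levi_add (h : ContDiffAt ℝ 2 u x) (h' : ContDiffAt ℝ 2 v x) (ξ : E) :
    Levi (fun y => u y + v y) x ξ = Levi u x ξ + Levi v x ξ := by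
  simp only [Levi, D2_add h h']; ring

lemma Levi_const (c : ℝ) (x ξ : E) : Levi (fun _ => c) x ξ = 0 := by
  simp [Levi]

lemma Levi_const_mul (c : ℝ) (h : ContDiffAt ℝ 2 u x) (ξ : E) :
    Levi (fun y => c * u y) x ξ = c * Levi u x ξ := by
  have := Levi_chain (χ := fun t => c * t) (χ1 := fun _ => c) (c := 0) h
    (Eventually.of_forall fun t => by simpa using (hasDerivAt_id t).const_mul c) (hasDerivAt_const _ _) ξ
  simpa using this

lemma Levi_sub (h : ContDiffAt ℝ 2 u x) (h' : ContDiffAt ℝ 2 v x) (ξ : E) :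
    Levi (fun y => u y - v y) x ξ = Levi u x ξ - Levi v x ξ := by
  have := Levi_add h (contDiffAt_const (c := (-1:ℝ)) |>.mul h') ξ
  rw [Levi_const_mul _ h'] at this
  calc _ = Levi (fun y => u y + (-1) * v y) x ξ := by congr 1; ext y; ring
    _ = _ := by rw [this]; ring

lemma Levi_mul (h : ContDiffAt ℝ 2 u x) (h' : ContDiffAt ℝ 2 v x) (ξ : E) :
    Levi (fun y => u y * v y) x ξ = u x * Levi v x ξ + v x * Levi u x ξ
      + (fderiv ℝ u x ξ * fderiv ℝ v x ξ + fderiv ℝ u x (I • ξ) * fderiv ℝ v x (I • ξ)) / 2 := by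
  simp only [Levi, D2_mul h h']; ring

lemma Levi_fsum {ι : Type*} (s : Finset ι) {w : ι → E → ℝ} (h : ∀ i ∈ s, ContDiffAt ℝ 2 (w i) x) (ξ : E) :
    Levi (fun y => ∑ i ∈ s, w i y) x ξ = ∑ i ∈ s, Levi (w i) x ξ := by
  classical
  induction s using Finset.induction_on with
  | empty => simp [Levi_const]
  | insert a s ha ih =>
    simp only [Finset.sum_insert ha]
    rw [Levi_add (h a (Finset.mem_insert_self _ _)) (ContDiffAt.sum fun i hi => h i (Finset.mem_insert_of_mem hi)),
      ih fun i hi => h i (Finset.mem_insert_of_mem hi)]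

lemma Levi_exp (h : ContDiffAt ℝ 2 u x) (ξ : E) :
    Levi (fun y => Real.exp (u y)) x ξ = Real.exp (u x) * (Levi u x ξ + Gsq u x ξ) := by
  rw [Levi_chain (χ1 := Real.exp) h (Eventually.of_forall Real.hasDerivAt_exp) (Real.hasDerivAt_exp _)]
  ring

lemma Levi_max (h : ContDiffAt ℝ 2 u x) (h' : ContDiffAt ℝ 2 v x) (ξ : E) (hu : 0 ≤ Levi u x ξ) (hv : 0 ≤ Levi v x ξ) :
    0 ≤ Levi (fun y => v y + rp (u y - v y)) x ξ := by
  have hd := h.sub h'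
  have hd : ContDiffAt ℝ 2 (fun y => u y - v y) x := hd
  have hr : ContDiffAt ℝ 2 (fun y => rp (u y - v y)) x := rp_C2f.contDiff.contDiffAt.comp x hd
  rw [Levi_add h' hr, 
    Levi_chain hd (Eventually.of_forall rp_C2f.h1) (rp_C2f.h2 _), Levi_sub h h']
  obtain ⟨_, _, _, h1, h2, h3⟩ := rp_props (u x - v x)
  have := mul_nonneg h3 (Gsq_nonneg (fun y => u y - v y) x ξ)
  nlinarith [mul_nonneg h1 hu, mul_nonneg (sub_nonneg.2 h2) hv]

end levicalc

section normsq
variable {E : Type*} [NormedAddCommGroup E] [NormedSpace ℂ E] {x : E}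

lemma fderiv_normsq {f : E → ℂ} {f' : E →L[ℂ] ℂ} (hf : HasFDerivAt f f' x) (v : E) :
    fderiv ℝ (fun y => ‖f y‖ ^ 2) x v = 2 * ((f x).re * (f' v).re + (f x).im * (f' v).im) := by
  have h := (hf.restrictScalars ℝ).norm_sq
  have := h.fderiv
  rw [this]
  simp [Complex.inner]
  ring
end normsq

section holo
variable {E : Type*} [NormedAddCommGroup E] [InnerProductSpace ℂ E] [FiniteDimensional ℂ E]

lemma holo_contDiff' [MeasurableSpace E] [BorelSpace E] (μ : Measure E) [μ.IsAddHaarMeasure] {V : Set E} {f : E → ℂ}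
    (hV : IsOpen V) (hf : DifferentiableOn ℂ f V) {x : E} (hx : x ∈ V) : ContDiffAt ℝ 2 f x := by
  have : ProperSpace E := FiniteDimensional.proper ℂ E
  obtain ⟨r0, hr0, hr0V⟩ := Metric.isOpen_iff.1 hV x hx
  set r := r0 / 4 with hr
  have hrp : 0 < r := by positivity
  have hB : Metric.closedBall x (2 * r) ⊆ V := fun y hy => hr0V (by
    rw [Metric.mem_closedBall] at hy; rw [Metric.mem_ball]; linarith)
  have hli : LocallyIntegrable ((Metric.closedBall x (2 * r)).indicator f) μ := by
    refine Integrable.locallyIntegrable ?_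
    rw [integrable_indicator_iff Metric.isClosed_closedBall.measurableSet]
    exact (hf.continuousOn.mono hB).integrableOn_compact (isCompact_closedBall _ _)
  refine (moll_contDiff μ hrp hli).contDiffAt.congr_of_eventuallyEq ?_
  filter_upwards [Metric.ball_mem_nhds x hrp] with y hy
  rw [Metric.mem_ball] at hy
  rw [moll_eq, ← mean_value μ hV hf hrp (x := y)]
  · congr 1; ext t
    rcases le_or_gt r ‖t‖ with h | h
    · rw [kern_eq_zero μ hrp h]; simp
    · rw [indicator_of_mem]
      rw [Metric.mem_closedBall]
      have h1 : dist (y - t) y = ‖t‖ := by simp [dist_eq_norm]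
      have := dist_triangle (y - t) y x
      linarith
  · refine (Metric.closedBall_subset_closedBall' ?_).trans hB
    linarith

lemma holo_contDiff {V : Set E} {f : E → ℂ}
    (hV : IsOpen V) (hf : DifferentiableOn ℂ f V) {x : E} (hx : x ∈ V) : ContDiffAt ℝ 2 f x := by
  have : FiniteDimensional ℝ E := FiniteDimensional.complexToReal E
  borelize E
  let := InnerProductSpace.complexToReal (G := E)
  exact holo_contDiff' (volume : Measure E) hV hf hx

lemma normsq_contDiff {V : Set E} {f : E → ℂ}
    (hV : IsOpen V) (hf : DifferentiableOn ℂ f V) {x : E} (hx : x ∈ V) : ContDiffAt ℝ 2 (fun y => ‖f y‖ ^ 2) x := 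
  (holo_contDiff hV hf hx).norm_sq ℂ

lemma Levi_normsq {V : Set E} {f : E → ℂ} (hV : IsOpen V) (hf : DifferentiableOn ℂ f V) {x : E} (hx : x ∈ V) (ξ : E) :
    Levi (fun y => ‖f y‖ ^ 2) x ξ = ‖fderiv ℂ f x ξ‖ ^ 2 := by
  have hc := holo_contDiff hV hf hx
  have hd := hc.differentiableAt (by norm_num)
  have hds : DifferentiableAt ℝ (fun y => (starRingEnd ℂ) (f y)) x :=
    (Complex.conjCLE : ℂ →L[ℝ] ℂ).differentiableAt.comp x hd
  have hfd : DifferentiableAt ℝ (fderiv ℝ f) x :=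
    (hc.fderiv_right (m := 1) (by norm_num)).differentiableAt (by norm_num)
  have hdz : DifferentiableAt ℝ (dz ξ f) x := by
    unfold dz
    have h1 := hfd.clm_apply (differentiableAt_const ξ)
    have h2 := hfd.clm_apply (differentiableAt_const (I • ξ))
    exact (h1.sub (h2.const_mul I)).const_mul _
  have hdzx : dz ξ f x = fderiv ℂ f x ξ := by
    have hfx := hf.differentiableAt (hV.mem_nhds hx)
    rw [dz, (hfx.hasFDerivAt.restrictScalars ℝ).fderiv]
    simp
    linear_combination (-1 / 2 * fderiv ℂ f x ξ) * Complex.I_sq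
  have key : (Levi (fun y => ‖f y‖ ^ 2) x ξ : ℂ) = ((‖fderiv ℂ f x ξ‖ ^ 2 : ℝ) : ℂ) := by
    rw [Levi_eq_db_dz (normsq_contDiff hV hf hx)]
    have e : dz ξ (fun y => ((‖f y‖ ^ 2 : ℝ) : ℂ)) =ᶠ[𝓝 x] fun y => (starRingEnd ℂ) (f y) * dz ξ f y := by
      filter_upwards [hV.mem_nhds hx] with y hy
      have hdy := (holo_contDiff hV hf hy).differentiableAt (by norm_num)
      have hdsy : DifferentiableAt ℝ (fun y => (starRingEnd ℂ) (f y)) y :=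
        (Complex.conjCLE : ℂ →L[ℝ] ℂ).differentiableAt.comp y hdy
      have : (fun y => ((‖f y‖ ^ 2 : ℝ) : ℂ)) = fun y => f y * (starRingEnd ℂ) (f y) := by
        ext y; rw [Complex.mul_conj']; push_cast; rfl
      rw [this, dz_mul ξ hdy hdsy, dz_star hdy, db_of_holo (hf.differentiableAt (hV.mem_nhds hy))]
      simp
    have e0 : db ξ f =ᶠ[𝓝 x] fun _ => 0 := by
      filter_upwards [hV.mem_nhds hx] with y hy
      exact db_of_holo (hf.differentiableAt (hV.mem_nhds hy)) ξ
    rw [e.db_eq, db_mul ξ hds hdz, db_star hd, ← dz_db_comm hc, e0.dz_eq, hdzx, Complex.mul_conj']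
    simp [dz]
  exact_mod_cast key

lemma Levi_normsq_exp {V : Set E} {f : E → ℂ} (hV : IsOpen V) (hf : DifferentiableOn ℂ f V) {x : E} (hx : x ∈ V) (ξ : E)
    {w : E → ℝ} (hw : ContDiffAt ℝ 2 w x) (hL : 0 ≤ Levi w x ξ) :
    0 ≤ Levi (fun y => ‖f y‖ ^ 2 * Real.exp (w y)) x ξ := by
  have hfx := (hf.differentiableAt (hV.mem_nhds hx)).hasFDerivAt
  rw [Levi_mul (normsq_contDiff hV hf hx) hw.exp, Levi_exp hw, Levi_normsq hV hf hx,
    fderiv_normsq hfx, fderiv_normsq hfx, fderiv_exp (hw.differentiableAt (by norm_num)), Gsq]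
  simp only [map_smul, smul_apply, smul_eq_mul, Complex.mul_re, Complex.mul_im, Complex.I_re, Complex.I_im]
  set D := fderiv ℂ f x ξ
  set p := fderiv ℝ w x ξ
  set q := fderiv ℝ w x (I • ξ)
  have e1 : ‖f x‖ ^ 2 = (f x).re ^ 2 + (f x).im ^ 2 := by rw [Complex.sq_norm, Complex.normSq_apply]; ring
  have e2 : ‖D‖ ^ 2 = D.re ^ 2 + D.im ^ 2 := by rw [Complex.sq_norm, Complex.normSq_apply]; ring
  have h0 : 0 ≤ Real.exp (w x) * (‖f x‖ ^ 2 * Levi w x ξ + ((D.re + ((f x).re * p + (f x).im * q) / 2) ^ 2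
      + (D.im + ((f x).im * p - (f x).re * q) / 2) ^ 2)) := by positivity
  convert h0 using 1
  rw [e1, e2]
  ring

lemma fderiv_distsq (p x v : E) : fderiv ℝ (fun y => ‖y - p‖ ^ 2) x v = 2 * (inner ℂ (x - p) v).re := by
  let := InnerProductSpace.complexToReal (G := E)
  have h := ((hasFDerivAt_id (𝕜 := ℝ) x).sub_const p).norm_sq
  simp only [id] at h
  rw [h.fderiv]
  simp
  rfl

lemma distsq_contDiff (p : E) : ContDiff ℝ 2 (fun y => ‖y - p‖ ^ 2) :=
  (contDiff_id.sub contDiff_const).norm_sq ℂ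

lemma Levi_distsq (p x ξ : E) : Levi (fun y => ‖y - p‖ ^ 2) x ξ = ‖ξ‖ ^ 2 := by
  have hd : DifferentiableAt ℝ (fderiv ℝ (fun y => ‖y - p‖ ^ 2)) x :=
    cd2_fderiv (distsq_contDiff p).contDiffAt
  have e : ∀ v, fderiv ℝ (fderiv ℝ (fun y => ‖y - p‖ ^ 2)) x v v = 2 * ‖v‖ ^ 2 := by
    intro v
    have e1 : fderiv ℝ (fderiv ℝ (fun y => ‖y - p‖ ^ 2)) x v v 
      = fderiv ℝ (fun y => fderiv ℝ (fun y => ‖y - p‖ ^ 2) y v) x v := by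
      rw [fderiv_clm_apply hd (differentiableAt_const v)]; simp
    rw [e1]
    simp only [fderiv_distsq]
    let := InnerProductSpace.complexToReal (G := E)
    have h : HasFDerivAt (fun y => ((2:ℝ) • innerSL ℝ v) y - ((2:ℝ) • innerSL ℝ v) p) ((2:ℝ) • innerSL ℝ v) x :=
      ((2:ℝ) • innerSL ℝ v).hasFDerivAt.sub_const _
    have e2 : (fun y => 2 * (inner ℂ (y - p) v).re) = fun y => ((2:ℝ) • innerSL ℝ v) y - ((2:ℝ) • innerSL ℝ v) p := by
      ext y
      have : (inner ℂ (y - p) v).re = inner ℝ (y - p) v := rfl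
      rw [this, inner_sub_left]
      simp only [smul_apply, innerSL_apply_apply, smul_eq_mul]
      rw [real_inner_comm y v, real_inner_comm p v]; ring
    rw [e2, h.fderiv]
    simp
  rw [Levi, e, e, norm_smul]; simp; ring

lemma Levi_logdist (p x ξ : E) {ε : ℝ} (hε : 0 < ε) : 0 ≤ Levi (fun y => Real.log (‖y - p‖ ^ 2 + ε ^ 2)) x ξ := by
  have hp : 0 < ‖x - p‖ ^ 2 + ε ^ 2 := by positivity
  have hc : ContDiff ℝ 2 (fun y : E => ‖y - p‖ ^ 2 + ε ^ 2) := (distsq_contDiff p).add contDiff_const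
  rw [Levi_chain (χ1 := fun t => t⁻¹) (c := -((‖x - p‖ ^ 2 + ε ^ 2) ^ 2)⁻¹) hc.contDiffAt
    (by filter_upwards [lt_mem_nhds hp] with t ht using Real.hasDerivAt_log ht.ne') (hasDerivAt_inv hp.ne'),
    Levi_add (distsq_contDiff p).contDiffAt contDiffAt_const, Levi_distsq, Levi_const, Gsq, fderiv_add_const,
    fderiv_distsq, fderiv_distsq, inner_smul_right]
  have h1 : ((2 * (inner ℂ (x - p) ξ).re) ^ 2 + (2 * (I * inner ℂ (x - p) ξ).re) ^ 2) / 4 = ‖inner ℂ (x - p) ξ‖ ^ 2 := by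
    rw [Complex.sq_norm, Complex.normSq_apply]; simp; ring
  rw [h1]
  have h2 : ‖inner ℂ (x - p) ξ‖ ^ 2 ≤ (‖x - p‖ * ‖ξ‖) ^ 2 := by gcongr; exact norm_inner_le_norm _ _
  set a := ‖x - p‖ ^ 2 + ε ^ 2
  have h3 : a⁻¹ * (‖ξ‖ ^ 2 + 0) + -(a ^ 2)⁻¹ * ‖inner ℂ (x - p) ξ‖ ^ 2 
      = (a ^ 2)⁻¹ * (a * ‖ξ‖ ^ 2 - ‖inner ℂ (x - p) ξ‖ ^ 2) := by
    field_simp; ring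
  rw [h3]
  refine mul_nonneg (by positivity) ?_
  rw [mul_pow] at h2
  have : (0:ℝ) ≤ ε ^ 2 * ‖ξ‖ ^ 2 := by positivity
  have e : a * ‖ξ‖ ^ 2 = ‖x - p‖ ^ 2 * ‖ξ‖ ^ 2 + ε ^ 2 * ‖ξ‖ ^ 2 := by simp only [a]; ring
  linarith

end holo

/-- C² plurisubharmonic functions on a set -/
def PSH2 {E : Type*} [NormedAddCommGroup E] [NormedSpace ℂ E] (u : E → ℝ) (V : Set E) : Prop :=
  ∀ z ∈ V, ContDiffAt ℝ 2 u z ∧ ∀ ξ, 0 ≤ Levi u z ξ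

end ModuleD2

section ModuleD3
open MeasureTheory Complex Filter

section wtcons
variable {E : Type*} [NormedAddCommGroup E] [InnerProductSpace ℂ E] [FiniteDimensional ℂ E]

/-- strictly plurisubharmonic exhaustion -/
structure Exh (V : Set E) (s : E → ℝ) : Prop where
  hV : IsOpen V
  hs : ∀ z ∈ V, ContDiffAt ℝ 2 s z
  h3 : ∀ z ∈ V, 3 ≤ s z
  hL : ∀ z ∈ V, ∀ ξ, ‖ξ‖ ^ 2 ≤ Levi s z ξ
  hc : ∀ c, IsCompact {z ∈ V | s z ≤ c}

variable {V : Set E} {s : E → ℝ}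

lemma growth_on (H : Exh V s) {q : E → ℝ} (hq : ContinuousOn q V) : ∃ χ χ1 χ2 : ℝ → ℝ, C2f χ χ1 χ2 ∧ (∀ t, 0 ≤ χ t) ∧ (∀ t, 0 ≤ χ1 t) ∧
    (∀ t, 0 ≤ χ2 t) ∧ ∀ z ∈ V, q z ≤ χ (s z) ∧ q z ≤ χ1 (s z) := by
  have h : ∀ n : ℕ, ∃ M : ℝ, ∀ z ∈ V, s z ≤ n + 1 → q z ≤ M := by
    intro n
    obtain ⟨M, hM⟩ := ((H.hc (n + 1)).image_of_continuousOn (hq.mono fun z hz => hz.1)).bddAbove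
    exact ⟨M, fun z hz hs => hM ⟨z, ⟨hz, hs⟩, rfl⟩⟩
  choose m hm using h
  obtain ⟨χ, χ1, χ2, h1, h2, h3, h4, _, h5⟩ := growth m
  refine ⟨χ, χ1, χ2, h1, h2, h3, h4, fun z hz => ?_⟩
  have := hm ⌊s z⌋₊ z hz (Nat.lt_floor_add_one _).le
  obtain ⟨h6, h7⟩ := h5 (s z) (H.h3 z hz)
  exact ⟨this.trans h6, this.trans h7⟩

lemma dz_chain {χ : ℝ → ℝ} {c : ℝ} {x : E} (hu : DifferentiableAt ℝ s x) (h : HasDerivAt χ c (s x)) (v : E) :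
    dz v (fun y => (χ (s y) : ℂ)) x = c * dz v (fun y => (s y : ℂ)) x := by
  have h1 := h.comp_hasFDerivAt x hu.hasFDerivAt
  have h1' : HasFDerivAt (fun y => χ (s y)) (c • fderiv ℝ s x) x := h1
  rw [dz_ofReal h1'.differentiableAt, dz_ofReal hu, h1'.fderiv]
  simp; ring

lemma step_deriv : ∃ C : ℝ, 0 ≤ C ∧ ∀ t, ∃ d, HasDerivAt (fun t => Real.smoothTransition (2 - t)) d t ∧ |d| ≤ C := by
  have hc : ContDiff ℝ 1 Real.smoothTransition := Real.smoothTransition.contDiff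
  have hd : Continuous (deriv Real.smoothTransition) := hc.continuous_deriv (by norm_num)
  obtain ⟨C, hC⟩ := (isCompact_Icc (a := (0:ℝ)) (b := 1)).exists_bound_of_continuousOn hd.continuousOn
  have hb : ∀ t, |deriv Real.smoothTransition t| ≤ max C 0 := by
    intro t
    rcases lt_or_ge t 0 with h | h
    · have : Real.smoothTransition =ᶠ[𝓝 t] fun _ => 0 := by
        filter_upwards [gt_mem_nhds h] with y hy using Real.smoothTransition.zero_of_nonpos (le_of_lt hy)
      rw [this.deriv_eq]; simp
    rcases lt_or_ge 1 t with h' | h'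
    · have : Real.smoothTransition =ᶠ[𝓝 t] fun _ => 1 := by
        filter_upwards [lt_mem_nhds h'] with y hy using Real.smoothTransition.one_of_one_le (le_of_lt hy)
      rw [this.deriv_eq]; simp
    · exact (hC t ⟨h, h'⟩).trans (le_max_left _ _)
  refine ⟨max C 0, le_max_right _ _, fun t => ⟨-deriv Real.smoothTransition (2 - t), ?_, ?_⟩⟩
  · exact ((hc.differentiable (by norm_num) (2 - t)).hasDerivAt).comp_const_sub 2 t
  · rw [abs_neg]; exact hb _

open Classical in
/-- cutoffs -/
def etaf (V : Set E) (s : E → ℝ) (k : ℕ) (x : E) : ℝ := if x ∈ V then Real.smoothTransition (2 - (s x - k)) else 0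

lemma etaf_ev (H : Exh V s) (k : ℕ) {x : E} (hx : x ∈ V) : etaf V s k =ᶠ[𝓝 x] fun y => Real.smoothTransition (2 - (s y - k)) := by
  filter_upwards [H.hV.mem_nhds hx] with y hy
  simp [etaf, hy]

lemma etaf_supp (H : Exh V s) (k : ℕ) : tsupport (etaf V s k) ⊆ {z ∈ V | s z ≤ k + 2} := by
  refine closure_minimal ?_ (H.hc _).isClosed
  intro x hx
  by_contra h
  apply hx
  by_cases hxV : x ∈ V
  · have : ¬ s x ≤ k + 2 := fun h' => h ⟨hxV, h'⟩
    simp only [etaf, hxV, if_true]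
    exact Real.smoothTransition.zero_of_nonpos (by linarith)
  · simp [etaf, hxV]

lemma exists_Wt (H : Exh V s) {N : ℕ} (b : OrthonormalBasis (Fin N) ℂ E) : ∃ κ ω : E → ℝ,
    (∀ z ∈ V, ContDiffAt ℝ 2 κ z) ∧ (∀ z ∈ V, ContDiffAt ℝ 2 ω z) ∧ 
    ∀ Φ, PSH2 Φ V → Wt b V (fun z => Φ z + κ z - ω z) ω (etaf V s) := by
  obtain ⟨C, hC0, hC⟩ := step_deriv
  set P : E → ℝ := fun z => ∑ j, ‖dz (b j) (fun y => (s y : ℂ)) z‖ ^ 2 with hP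
  have hsd : ∀ z ∈ V, DifferentiableAt ℝ s z := fun z hz => (H.hs z hz).differentiableAt (by norm_num)
  have hfc : ContinuousOn (fderiv ℝ s) V := fun z hz => (cd2_fderiv (H.hs z hz)).continuousAt.continuousWithinAt
  have hPc : ContinuousOn P V := by
    refine continuousOn_finset_sum _ fun j _ => ((ContinuousOn.norm ?_).pow 2)
    have : ContinuousOn (fun z => (1 / 2 : ℂ) * ((fderiv ℝ s z (b j) : ℝ) - I * (fderiv ℝ s z (I • b j) : ℝ))) V := by
      have h1 : ContinuousOn (fun z => fderiv ℝ s z (b j)) V := hfc.clm_apply continuousOn_const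
      have h2 : ContinuousOn (fun z => fderiv ℝ s z (I • b j)) V := hfc.clm_apply continuousOn_const
      have h1' := Complex.continuous_ofReal.comp_continuousOn h1
      have h2' := Complex.continuous_ofReal.comp_continuousOn h2
      exact (h1'.sub (h2'.const_mul I)).const_mul _
    exact this.congr fun z hz => dz_ofReal (hsd z hz) _
  have hP0 : ∀ z, 0 ≤ P z := fun z => by positivity
  have hsum : ∀ {χ : ℝ → ℝ} {c : ℝ} {z : E}, z ∈ V → HasDerivAt χ c (s z) →
      ∑ j, ‖dz (b j) (fun y => (χ (s y) : ℂ)) z‖ ^ 2 = c ^ 2 * P z := by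
    intro χ c z hz h
    rw [hP, Finset.mul_sum]
    refine Finset.sum_congr rfl fun j _ => ?_
    rw [dz_chain (hsd z hz) h, norm_mul, mul_pow]; simp
  obtain ⟨χ, χ1, χ2, c1, c2, c3, c4, c5⟩ := growth_on H (q := fun z => C ^ 2 * P z) (hPc.const_mul _)
  have hχc : Continuous χ := c1.contDiff.continuous
  have hχ1c : Continuous χ1 := continuous_iff_continuousAt.2 fun t => (c1.h2 t).continuousAt
  have hsc : ContinuousOn s V := fun z hz => (hsd z hz).continuousAt.continuousWithinAt
  obtain ⟨τ, τ1, τ2, d1, d2, d3, d4, d5⟩ := growth_on H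
    (q := fun z => 2 * ((χ1 (s z)) ^ 2 * P z + Real.exp (χ (s z)))) (by
      refine ((((hχ1c.comp_continuousOn hsc).pow 2).mul hPc).add ?_).const_mul 2
      exact Real.continuous_exp.comp_continuousOn (hχc.comp_continuousOn hsc))
  have hω : ∀ z ∈ V, ContDiffAt ℝ 2 (fun z => χ (s z)) z := fun z hz => c1.contDiff.contDiffAt.comp z (H.hs z hz)
  have hκ : ∀ z ∈ V, ContDiffAt ℝ 2 (fun z => τ (s z)) z := fun z hz => d1.contDiff.contDiffAt.comp z (H.hs z hz)
  refine ⟨fun z => τ (s z), fun z => χ (s z), hκ, hω, fun Φ hΦ => ?_⟩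
  refine ⟨H.hV, fun z hz => (((hΦ z hz).1.add (hκ z hz)).sub (hω z hz)).contDiffWithinAt, 
    fun z hz => (hω z hz).contDiffWithinAt, ?_, ?_, ?_, ?_, ?_, ?_, ?_⟩
  · intro k
    rw [contDiff_iff_contDiffAt]
    intro x
    by_cases hx : x ∈ V
    · refine ContDiffAt.congr_of_eventuallyEq ?_ (etaf_ev H k hx)
      exact (Real.smoothTransition.contDiff (n := 2)).contDiffAt.comp x
        (contDiffAt_const.sub ((H.hs x hx).sub contDiffAt_const))
    · have hx' : x ∉ tsupport (etaf V s k) := fun h => hx (etaf_supp H k h).1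
      have : etaf V s k =ᶠ[𝓝 x] fun _ => 0 := notMem_tsupport_iff_eventuallyEq.1 hx'
      exact contDiffAt_const.congr_of_eventuallyEq this
  · intro k
    exact (H.hc _).of_isClosed_subset (isClosed_tsupport _) (etaf_supp H k)
  · exact fun k => (etaf_supp H k).trans fun z hz => hz.1
  · intro k x
    unfold etaf
    split_ifs
    · exact ⟨Real.smoothTransition.nonneg _, Real.smoothTransition.le_one _⟩
    · simp
  · intro x hx
    obtain ⟨n, hn⟩ := exists_nat_gt (s x)
    filter_upwards [eventually_ge_atTop n] with k hk
    have hk' : s x < k := hn.trans_le (by exact_mod_cast hk)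
    filter_upwards [etaf_ev H k hx, (hsd x hx).continuousAt.eventually (gt_mem_nhds hk')] with y hy hy'
    rw [hy]
    exact Real.smoothTransition.one_of_one_le (by linarith)
  · intro k x hx
    obtain ⟨d, hd, hdC⟩ := hC (s x - k)
    have e : (fun y => (etaf V s k y : ℂ)) =ᶠ[𝓝 x] fun y => (((fun t => Real.smoothTransition (2 - (t - k))) (s y) : ℝ) : ℂ) := by
      filter_upwards [etaf_ev H k hx] with y hy
      rw [hy]
    simp only [e.dz_eq]
    have hd' : HasDerivAt (fun t => Real.smoothTransition (2 - (t - k))) d (s x) :=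
      HasDerivAt.comp_sub_const (f := fun t => Real.smoothTransition (2 - t)) (s x) (k : ℝ) hd
    rw [hsum hx hd']
    have h1 : d ^ 2 * P x ≤ C ^ 2 * P x := by
      gcongr ?_ * _
      rw [← sq_abs]; gcongr
    have h2 := (c5 x hx).1
    have h3 := Real.add_one_le_exp (χ (s x))
    linarith
  · intro x hx ξ
    rw [hsum hx (c1.h1 _)]
    have e : (fun y => Φ y + τ (s y) - χ (s y) + χ (s y)) = fun y => Φ y + τ (s y) := by ext y; ring
    rw [e, Levi_add (hΦ x hx).1 (hκ x hx), Levi_chain (H.hs x hx) (Eventually.of_forall d1.h1) (d1.h2 _)]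
    have hn : ∑ j, ‖ξ j‖ ^ 2 = ‖∑ j, ξ j • b j‖ ^ 2 := by
      have := b.sum_repr_symm (WithLp.toLp 2 ξ)
      simp only at this
      rw [this, LinearIsometryEquiv.norm_map, EuclideanSpace.norm_sq_eq]
    rw [hn]
    have h1 := (hΦ x hx).2 (∑ j, ξ j • b j)
    have h2 := H.hL x hx (∑ j, ξ j • b j)
    have h3 := mul_nonneg (d4 (s x)) (Gsq_nonneg s x (∑ j, ξ j • b j))
    have h4 := (d5 x hx).2
    have h5 := mul_le_mul h4 h2 (by positivity) (d3 _)
    linarith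

variable [MeasurableSpace E] [BorelSpace E] (μ : Measure E) [μ.IsAddHaarMeasure]

lemma enorm_exp_sq (a : ℝ) (c : ℂ) : ‖(Real.exp (a / 2) : ℂ) * c‖ₑ ^ 2 = ENNReal.ofReal (Real.exp a) * ‖c‖ₑ ^ 2 := by
  rw [enorm_mul, mul_pow]
  congr 1
  rw [← ofReal_norm_eq_enorm, Complex.norm_real, Real.norm_of_nonneg (Real.exp_pos _).le, ← ENNReal.ofReal_pow (Real.exp_pos _).le,
    ← Real.exp_nat_mul]
  congr 2; push_cast; ring

theorem corH (H : Exh V s) {N : ℕ} (b : OrthonormalBasis (Fin N) ℂ E) : ∃ α β : E → ℝ, ContinuousOn α V ∧ ContinuousOn β V ∧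
    ∀ Φ, PSH2 Φ V → ∀ h ∈ TestSub V, ∃ F, DifferentiableOn ℂ F V ∧
      ∫⁻ x in V, ENNReal.ofReal (Real.exp (α x - Φ x)) * ‖h x - F x‖ₑ ^ 2 ∂μ ≤
        ∑ j, ∫⁻ x in V, ENNReal.ofReal (Real.exp (β x - Φ x)) * ‖db (b j) h x‖ₑ ^ 2 ∂μ := by
  obtain ⟨κ, ω, hκ, hω, HW⟩ := exists_Wt H b
  have kc : ContinuousOn κ V := fun z hz => (hκ z hz).continuousAt.continuousWithinAt
  have wc : ContinuousOn ω V := fun z hz => (hω z hz).continuousAt.continuousWithinAt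
  refine ⟨fun z => -κ z + 2 * ω z, fun z => -κ z + ω z, kc.neg.add (wc.const_mul 2), kc.neg.add wc, fun Φ hΦ h hh => ?_⟩
  have hb : Submodule.span ℂ (range b) = ⊤ := by
    have := b.toBasis.span_eq
    rwa [b.coe_toBasis] at this
  obtain ⟨F, hF, hle⟩ := thmH μ hb (HW Φ hΦ) hh
  refine ⟨F, hF, ?_⟩
  simp only [enorm_exp_sq] at hle
  convert hle using 7
  · ring
  · rename_i j x; ring
end wtcons

end ModuleD3

section ModuleD4
open MeasureTheory Complex Filter

section peak
variable {E : Type*} [NormedAddCommGroup E] [InnerProductSpace ℂ E] [FiniteDimensional ℂ E]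
variable {V : Set E} {s : E → ℝ}

lemma sub_est [MeasurableSpace E] [BorelSpace E] (μ : Measure E) {C : ℝ} {d : ℕ} (hC : 0 < C) {G w : E → ℝ} {g : E → ℂ} {ρ q X : ℝ}
    {x : E} (hq : 0 < q) (hρ : 0 < ρ) (hX : 0 ≤ X) (hB : Metric.closedBall x ρ ⊆ V)
    (h1 : ‖g x‖ₑ ^ 2 ≤ ENNReal.ofReal (C / ρ ^ d) * ∫⁻ y in Metric.closedBall x ρ, ‖g y‖ₑ ^ 2 ∂μ)
    (h2 : ∀ y ∈ Metric.closedBall x ρ, q ≤ w y ∧ ‖g y‖ₑ = ENNReal.ofReal (G y))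
    (h3 : ∫⁻ y in V, ENNReal.ofReal (w y) * ENNReal.ofReal (G y) ^ 2 ∂μ ≤ ENNReal.ofReal X) :
    ‖g x‖ ^ 2 ≤ C / ρ ^ d * (X / q) := by
  have hq' : ENNReal.ofReal q ≠ 0 := by simpa using hq
  have h4 : ENNReal.ofReal q * ∫⁻ y in Metric.closedBall x ρ, ‖g y‖ₑ ^ 2 ∂μ ≤ ENNReal.ofReal X := by
    rw [← lintegral_const_mul' _ _ ENNReal.ofReal_ne_top]
    refine le_trans ?_ ((lintegral_mono_set hB).trans h3)
    refine setLIntegral_mono' Metric.isClosed_closedBall.measurableSet fun y hy => ?_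
    rw [(h2 y hy).2]
    gcongr
    exact (h2 y hy).1
  have h5 : ∫⁻ y in Metric.closedBall x ρ, ‖g y‖ₑ ^ 2 ∂μ ≤ ENNReal.ofReal (X / q) := by
    rw [ENNReal.ofReal_div_of_pos hq, ENNReal.le_div_iff_mul_le (Or.inl hq') (Or.inl ENNReal.ofReal_ne_top), mul_comm]
    exact h4
  have h6 : ENNReal.ofReal (‖g x‖ ^ 2) ≤ ENNReal.ofReal (C / ρ ^ d * (X / q)) := by
    rw [ENNReal.ofReal_mul (by positivity), ENNReal.ofReal_pow (norm_nonneg _), ofReal_norm_eq_enorm]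
    exact h1.trans (by gcongr)
  exact (ENNReal.ofReal_le_ofReal_iff (by positivity)).1 h6

lemma Phi_psh {ψ : E → ℝ} (hψ : PSH2 ψ V) (n m : ℕ) (p : E) {ε : ℝ} (hε : 0 < ε) :
    PSH2 (fun z => n * ψ z + m * Real.log (‖z - p‖ ^ 2 + ε ^ 2)) V := by
  intro z hz
  have h1 : ContDiffAt ℝ 2 (fun z => Real.log (‖z - p‖ ^ 2 + ε ^ 2)) z := by
    refine ContDiffAt.log ((distsq_contDiff p).contDiffAt.add contDiffAt_const) ?_
    positivity
  have h2 : ContDiffAt ℝ 2 (fun z => (n:ℝ) * ψ z) z := contDiffAt_const.mul (hψ z hz).1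
  have h3 : ContDiffAt ℝ 2 (fun z => (m:ℝ) * Real.log (‖z - p‖ ^ 2 + ε ^ 2)) z := contDiffAt_const.mul h1
  refine ⟨h2.add h3, fun ξ => ?_⟩
  rw [Levi_add h2 h3, Levi_const_mul _ (hψ z hz).1, Levi_const_mul _ h1]
  have := (hψ z hz).2 ξ
  have := Levi_logdist p z ξ hε
  positivity

lemma exp_Phi (a t : ℝ) {u : ℝ} (hu : 0 < u) (m : ℕ) : Real.exp (a - (t + m * Real.log u)) = Real.exp (a - t) / u ^ m := by
  rw [← sub_sub, Real.exp_sub, Real.exp_nat_mul, Real.exp_log hu]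

theorem peak (H : Exh V s) {ψ : E → ℝ} (hψ : PSH2 ψ V) {p : E} (hp : p ∈ V) {K : Set E} (hK : IsCompact K) (hKV : K ⊆ V)
    (hlt : ∀ z ∈ K, ψ z < ψ p) : ∃ F : E → ℂ, DifferentiableOn ℂ F V ∧ (∀ z ∈ K, ‖F z‖ < 1 / 2) ∧ 1 / 2 < ‖F p‖ := by
  have : ProperSpace E := FiniteDimensional.proper ℂ E
  have : FiniteDimensional ℝ E := FiniteDimensional.complexToReal E
  borelize E
  let := InnerProductSpace.complexToReal (G := E)
  set μ : Measure E := volume with hμ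
  clear_value μ
  have hμ' : μ.IsAddHaarMeasure := hμ ▸ inferInstance
  set b := stdOrthonormalBasis ℂ E
  obtain ⟨α, β, hα, hβ, HH⟩ := corH μ H b
  obtain ⟨C, hC, hsub⟩ := sub_mean (E := E) μ
  set d := Module.finrank ℝ E
  set m := d + 1 with hm
  set c := ψ p with hc
  have hψc : ContinuousOn ψ V := fun z hz => (hψ z hz).1.continuousAt.continuousWithinAt
  obtain ⟨δ, hδ, hKδ⟩ : ∃ δ > 0, ∀ z ∈ K, ψ z < c - 3 * δ := by
    rcases K.eq_empty_or_nonempty with rfl | hne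
    · exact ⟨1, one_pos, by simp⟩
    · obtain ⟨z0, hz0, hmax⟩ := hK.exists_isMaxOn hne (hψc.mono hKV)
      refine ⟨(c - ψ z0) / 4, by linarith [hlt z0 hz0], fun z hz => ?_⟩
      have := hmax hz
      simp only [mem_setOf_eq] at this
      linarith [hlt z0 hz0]
  have hO : IsOpen (V ∩ ψ ⁻¹' Iio (c - 3 * δ)) := hψc.isOpen_inter_preimage H.hV isOpen_Iio
  obtain ⟨r, hr, hrK⟩ := hK.exists_cthickening_subset_open hO fun z hz => ⟨hKV hz, hKδ z hz⟩
  have hK' : IsCompact (Metric.cthickening r K) := hK.cthickening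
  have hO2 : IsOpen (V ∩ ψ ⁻¹' Ioi (c - δ)) := hψc.isOpen_inter_preimage H.hV isOpen_Ioi
  obtain ⟨χ, hχ, hχc, hχs, hχ1, O', hO', hpO', hχO⟩ := cutoff_exists (isCompact_singleton (x := p)) hO2
    (by rintro z rfl; exact ⟨hp, by simp [hc, hδ]⟩)
  set h : E → ℂ := fun x => (χ x : ℂ) with hh
  have hhs : tsupport h ⊆ tsupport χ := closure_mono fun x hx hx0 => hx (by simp [hh, hx0])
  have hhT : h ∈ TestSub V := by
    refine ⟨Complex.ofRealCLM.contDiff.comp hχ, hχc.of_isClosed_subset (isClosed_tsupport _) hhs, 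
      (hhs.trans hχs).trans inter_subset_left⟩
  have hT : IsCompact (tsupport h) := hhT.2.1
  have hTV : tsupport h ⊆ V := hhT.2.2
  obtain ⟨r2, hr2, hr2O⟩ := Metric.isOpen_iff.1 hO' p (hpO' rfl)
  set r1 := r2 / 2 with hr1
  have hr1p : 0 < r1 := by positivity
  have hr1O : Metric.closedBall p r1 ⊆ O' := (Metric.closedBall_subset_ball (by linarith)).trans hr2O
  have hO'V : O' ⊆ V := fun z hz => hTV (subset_tsupport _ (by simp [hh, hχO z hz]))
  have hdb1 : ∀ v, ∀ x ∈ O', db v h x = 0 := by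
    intro v x hx
    have : h =ᶠ[𝓝 x] fun _ => 1 := by
      filter_upwards [hO'.mem_nhds hx] with y hy; simp [hh, hχO y hy]
    rw [this.db_eq]; simp [db]
  have hdb0 : ∀ v, ∀ x, x ∉ tsupport h → db v h x = 0 := fun v x hx =>
    image_eq_zero_of_notMem_tsupport fun hx' => hx (db_support v hx')
  have hdbc : ∀ v, Continuous (db v h) := fun v => (contDiff_db (n := 1) (by exact_mod_cast hhT.1) v).continuous
  -- the right hand side
  have hR : ∃ R : ℝ, 0 ≤ R ∧ ∀ n : ℕ, ∀ ε > 0, ∑ j, ∫⁻ x in V, ENNReal.ofReal (Real.exp (β x -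
      (n * ψ x + m * Real.log (‖x - p‖ ^ 2 + ε ^ 2)))) * ‖db (b j) h x‖ₑ ^ 2 ∂μ ≤ 
      ENNReal.ofReal (Real.exp (- (n * (c - δ))) * R) := by
    have h1 : ∀ j, ∃ R : ℝ, 0 ≤ R ∧ ∀ n : ℕ, ∀ ε > 0, ∫⁻ x in V, ENNReal.ofReal (Real.exp (β x -
      (n * ψ x + m * Real.log (‖x - p‖ ^ 2 + ε ^ 2)))) * ‖db (b j) h x‖ₑ ^ 2 ∂μ ≤ 
      ENNReal.ofReal (Real.exp (- (n * (c - δ))) * R) := by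
      intro j
      obtain ⟨B, hB⟩ := (hT.image_of_continuousOn (hβ.mono hTV)).bddAbove
      have hB : ∀ x ∈ tsupport h, β x ≤ B := fun x hx => hB ⟨x, hx, rfl⟩
      obtain ⟨D, hD⟩ := hT.exists_bound_of_continuousOn (hdbc (b j)).continuousOn
      refine ⟨Real.exp B / (r1 ^ 2) ^ m * D ^ 2 * (μ (tsupport h)).toReal, by positivity, fun n ε hε => ?_⟩
      set Y := Real.exp (- (n * (c - δ))) * (Real.exp B / (r1 ^ 2) ^ m * D ^ 2) with hY
      calc _ ≤ ∫⁻ x, (tsupport h).indicator (fun _ => ENNReal.ofReal Y) x ∂μ := by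
            refine (setLIntegral_le_lintegral _ _).trans (lintegral_mono fun x => ?_)
            by_cases hx : x ∈ tsupport h
            · rw [indicator_of_mem hx]
              by_cases hx1 : x ∈ Metric.closedBall p r1
              · rw [hdb1 _ x (hr1O hx1)]; simp
              · rw [Metric.mem_closedBall, not_le, dist_eq_norm] at hx1
                rw [exp_Phi _ _ (by positivity), ← ofReal_norm_eq_enorm, ← ENNReal.ofReal_pow (norm_nonneg _),
                  ← ENNReal.ofReal_mul (by positivity)]
                refine ENNReal.ofReal_le_ofReal ?_
                rw [hY, ← mul_assoc, ← mul_div_assoc, ← Real.exp_add]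
                have hψx : c - δ ≤ ψ x := (hχs (hhs hx)).2.le
                gcongr
                · have := mul_le_mul_of_nonneg_left hψx (Nat.cast_nonneg (α := ℝ) n)
                  linarith [hB x hx]
                · nlinarith [sq_nonneg ε]
                · exact hD x hx
            · rw [hdb0 _ x hx]; simp
        _ = ENNReal.ofReal Y * μ (tsupport h) := lintegral_indicator_const hT.measurableSet _
        _ = ENNReal.ofReal (Y * (μ (tsupport h)).toReal) := by
            have hY0 : 0 ≤ Y := by positivity
            rw [ENNReal.ofReal_mul (p := Y) hY0, ENNReal.ofReal_toReal hT.measure_lt_top.ne]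
        _ = _ := by rw [hY]; congr 1; ring
    choose R hR0 hR using h1
    refine ⟨∑ j, R j, Finset.sum_nonneg fun j _ => hR0 j, fun n ε hε => ?_⟩
    rw [Finset.mul_sum, ENNReal.ofReal_sum_of_nonneg fun j _ => by have := hR0 j; positivity]
    exact Finset.sum_le_sum fun j _ => hR j n ε hε
  obtain ⟨R, hR0, hR⟩ := hR
  -- lower bounds for the weight
  set L := Metric.cthickening r K ∪ Metric.closedBall p r1 with hL
  have hLc : IsCompact L := hK'.union (isCompact_closedBall _ _)
  have hLV : L ⊆ V := union_subset (hrK.trans inter_subset_left) (hr1O.trans hO'V)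
  obtain ⟨a, ha⟩ := (hLc.image_of_continuousOn (hα.mono hLV)).bddBelow
  have ha : ∀ x ∈ L, a ≤ α x := fun x hx => ha ⟨x, hx, rfl⟩
  obtain ⟨c', hc'⟩ := (hLc.image_of_continuousOn (hψc.mono hLV)).bddAbove
  have hc' : ∀ x ∈ L, ψ x ≤ c' := fun x hx => hc' ⟨x, hx, rfl⟩
  obtain ⟨M, hM⟩ := (hLc.image (f := fun y => ‖y - p‖ ^ 2 + 1) (by fun_prop)).bddAbove
  have hM : ∀ x ∈ L, ‖x - p‖ ^ 2 + 1 ≤ M := fun x hx => hM ⟨x, hx, rfl⟩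
  have hMp : 0 < M := by
    have := hM p (Or.inr (Metric.mem_closedBall_self hr1p.le)); simp at this; linarith
  have hn : ∃ n : ℕ, C / r ^ d * (Real.exp (- (n * (c - δ))) * R / (Real.exp (a - n * (c - 3 * δ)) / M ^ m)) < 1 / 4 := by
    have e : ∀ n : ℕ, C / r ^ d * (Real.exp (- (n * (c - δ))) * R / (Real.exp (a - n * (c - 3 * δ)) / M ^ m)) =
        C / r ^ d * R * M ^ m * Real.exp (-a) * (Real.exp (-(2 * δ))) ^ n := by
      intro n
      have : Real.exp (- (n * (c - δ))) / Real.exp (a - n * (c - 3 * δ)) = Real.exp (-a) * (Real.exp (-(2 * δ))) ^ n := by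
        rw [← Real.exp_nat_mul, ← Real.exp_sub, ← Real.exp_add]; congr 1; ring
      rw [mul_assoc _ (Real.exp (-a)), ← this]; field_simp
    simp only [e]
    have ht := (tendsto_pow_atTop_nhds_zero_of_lt_one (Real.exp_pos (-(2 * δ))).le (by rw [Real.exp_lt_one_iff]; linarith)).const_mul
      (C / r ^ d * R * M ^ m * Real.exp (-a))
    rw [mul_zero] at ht
    exact (ht.eventually (gt_mem_nhds (show (0:ℝ) < 1 / 4 by norm_num))).exists
  obtain ⟨n, hn⟩ := hn
  set X := Real.exp (- (n * (c - δ))) * R with hX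
  have hX0 : 0 ≤ X := by positivity
  have hε : ∃ ε : ℝ, 0 < ε ∧ ε ≤ 1 ∧ ε ≤ r1 ∧ C / ε ^ d * (X / (Real.exp (a - n * c') / (2 * ε ^ 2) ^ m)) < 1 / 4 := by
    set Z := C * X / Real.exp (a - n * c') * 2 ^ m with hZ
    have e : ∀ ε : ℝ, 0 < ε → C / ε ^ d * (X / (Real.exp (a - n * c') / (2 * ε ^ 2) ^ m)) = Z * ε ^ (d + 2) := by
      intro ε hε
      rw [hZ, hm]
      have : (2 * ε ^ 2) ^ (d + 1) = 2 ^ (d + 1) * (ε ^ d * ε ^ (d + 2)) := by rw [mul_pow, ← pow_mul]; ring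
      rw [this]
      field_simp
    have ht : Tendsto (fun ε : ℝ => Z * ε ^ (d + 2)) (𝓝[>] 0) (𝓝 0) := by
      have : Continuous fun ε : ℝ => Z * ε ^ (d + 2) := by fun_prop
      have := this.tendsto 0
      simp at this
      exact this.mono_left nhdsWithin_le_nhds
    have := (ht.eventually (gt_mem_nhds (show (0:ℝ) < 1 / 4 by norm_num))).and
      ((Ioc_mem_nhdsGT (lt_min one_pos hr1p)) : ∀ᶠ ε in 𝓝[>] (0:ℝ), ε ∈ Ioc 0 (min 1 r1))
    obtain ⟨ε, h1, h2⟩ := this.exists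
    exact ⟨ε, h2.1, h2.2.trans (min_le_left _ _), h2.2.trans (min_le_right _ _), by rw [e ε h2.1]; exact h1⟩
  obtain ⟨ε, hε, hε1, hεr, hεl⟩ := hε
  obtain ⟨F, hF, hFi⟩ := HH _ (Phi_psh hψ n m p hε) h hhT
  have hFi := hFi.trans (hR n ε hε)
  have hFi' : ∫⁻ x in V, ENNReal.ofReal (Real.exp (α x - (n * ψ x + m * Real.log (‖x - p‖ ^ 2 + ε ^ 2)))) *
      ENNReal.ofReal ‖h x - F x‖ ^ 2 ∂μ ≤ ENNReal.ofReal X := by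
    simpa only [ofReal_norm_eq_enorm] using hFi
  refine ⟨F, hF, fun z hz => ?_, ?_⟩
  · have hB : Metric.closedBall z r ⊆ Metric.cthickening r K := Metric.closedBall_subset_cthickening hz r
    have hBV : Metric.closedBall z r ⊆ V := (hB.trans subset_union_left).trans hLV
    have := sub_est (V := V) μ hC (q := Real.exp (a - n * (c - 3 * δ)) / M ^ m) (by positivity) hr hX0 hBV
      (hsub V F H.hV hF r hr z hBV) (fun y hy => ⟨?_, ?_⟩) hFi'
    · have h2 : ‖F z‖ ^ 2 < (1 / 2) ^ 2 := this.trans_lt (hn.trans_eq (by norm_num))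
      exact lt_of_pow_lt_pow_left₀ 2 (by norm_num) h2
    · rw [exp_Phi _ _ (by positivity)]
      have hyL : y ∈ L := Or.inl (hB hy)
      have h1 := (hrK (hB hy)).2
      simp only [mem_preimage, mem_Iio] at h1
      gcongr
      · exact ha y hyL
      · have : ε ^ 2 ≤ 1 := pow_le_one₀ hε.le hε1
        linarith [hM y hyL]
    · have h1 := (hrK (hB hy)).2
      simp only [mem_preimage, mem_Iio] at h1
      have : h y = 0 := by
        by_contra h0
        have := (hχs (hhs (subset_tsupport _ h0))).2
        simp only [mem_preimage, mem_Ioi] at this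
        linarith
      rw [this, zero_sub, norm_neg, ofReal_norm_eq_enorm]
  · have hB : Metric.closedBall p ε ⊆ Metric.closedBall p r1 := Metric.closedBall_subset_closedBall hεr
    have hBV : Metric.closedBall p ε ⊆ V := (hB.trans subset_union_right).trans hLV
    have := sub_est (V := V) μ hC (q := Real.exp (a - n * c') / (2 * ε ^ 2) ^ m) (by positivity) hε hX0 hBV
      (hsub V (fun y => 1 - F y) H.hV (by fun_prop) ε hε p hBV) (fun y hy => ⟨?_, ?_⟩) hFi'
    · have h2 : ‖1 - F p‖ ^ 2 < (1 / 2) ^ 2 := this.trans_lt (hεl.trans_eq (by norm_num))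
      have h3 := lt_of_pow_lt_pow_left₀ 2 (by norm_num) h2
      have h4 := norm_sub_norm_le (1 : ℂ) (F p)
      rw [norm_one] at h4
      linarith
    · rw [exp_Phi _ _ (by positivity)]
      have hyL : y ∈ L := Or.inr (hB hy)
      rw [Metric.mem_closedBall, dist_eq_norm] at hy
      gcongr
      · exact ha y hyL
      · exact hc' y hyL
      · nlinarith [norm_nonneg (y - p)]
    · have : h y = 1 := by simp [hh, hχO y (hr1O (hB hy))]
      rw [this, ofReal_norm_eq_enorm]

end peak

end ModuleD4

section ModuleD5
open MeasureTheory Complex Filter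

section pshcalc
variable {E : Type*} [NormedAddCommGroup E] [NormedSpace ℂ E] {V : Set E} {u v : E → ℝ}

lemma PSH2.mono {V' : Set E} (h : PSH2 u V) (hV : V' ⊆ V) : PSH2 u V' := fun z hz => h z (hV hz)

lemma PSH2.cont (h : PSH2 u V) : ContinuousOn u V := fun z hz => (h z hz).1.continuousAt.continuousWithinAt

lemma PSH2.add (h : PSH2 u V) (h' : PSH2 v V) : PSH2 (fun z => u z + v z) V := fun z hz =>
  ⟨(h z hz).1.add (h' z hz).1, fun ξ => by
    rw [Levi_add (h z hz).1 (h' z hz).1]; exact add_nonneg ((h z hz).2 ξ) ((h' z hz).2 ξ)⟩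

lemma PSH2_const (c : ℝ) : PSH2 (fun _ : E => c) V := fun z _ => ⟨contDiffAt_const, fun ξ => by rw [Levi_const]⟩

lemma PSH2.const_mul (h : PSH2 u V) {c : ℝ} (hc : 0 ≤ c) : PSH2 (fun z => c * u z) V := fun z hz =>
  ⟨contDiffAt_const.mul (h z hz).1, fun ξ => by
    rw [Levi_const_mul _ (h z hz).1]; exact mul_nonneg hc ((h z hz).2 ξ)⟩

lemma PSH2.sum {ι : Type*} {t : Finset ι} {w : ι → E → ℝ} (h : ∀ i ∈ t, PSH2 (w i) V) : PSH2 (fun z => ∑ i ∈ t, w i z) V :=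
  fun z hz => ⟨ContDiffAt.sum fun i hi => (h i hi z hz).1, fun ξ => by
    rw [Levi_fsum _ fun i hi => (h i hi z hz).1]; exact Finset.sum_nonneg fun i hi => (h i hi z hz).2 ξ⟩

lemma PSH2.max (h : PSH2 u V) (h' : PSH2 v V) : PSH2 (fun z => v z + rp (u z - v z)) V := fun z hz =>
  ⟨(h' z hz).1.add (rp_C2f.contDiff.contDiffAt.comp z ((h z hz).1.sub (h' z hz).1)), fun ξ =>
    Levi_max (h z hz).1 (h' z hz).1 ξ ((h z hz).2 ξ) ((h' z hz).2 ξ)⟩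

lemma PSH2.comp {χ χ1 χ2 : ℝ → ℝ} (h : PSH2 u V) (hχ : C2f χ χ1 χ2) (h1 : ∀ t, 0 ≤ χ1 t) (h2 : ∀ t, 0 ≤ χ2 t) :
    PSH2 (fun z => χ (u z)) V := fun z hz =>
  ⟨hχ.contDiff.contDiffAt.comp z (h z hz).1, fun ξ => by
    rw [Levi_chain (h z hz).1 (Eventually.of_forall hχ.h1) (hχ.h2 _)]
    exact add_nonneg (mul_nonneg (h1 _) ((h z hz).2 ξ)) (mul_nonneg (h2 _) (Gsq_nonneg _ _ _))⟩

/-- local version -/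
def PSHat (u : E → ℝ) (z : E) : Prop := ContDiffAt ℝ 2 u z ∧ ∀ ξ, 0 ≤ Levi u z ξ


end pshcalc

section hulls
variable {E : Type*} [NormedAddCommGroup E] [InnerProductSpace ℂ E] [FiniteDimensional ℂ E]
variable {V K : Set E} {s : E → ℝ}

lemma PSHat.congr {u v : E → ℝ} {z : E} (h : PSHat u z) (e : v =ᶠ[𝓝 z] u) : PSHat v z :=
  ⟨h.1.congr_of_eventuallyEq e, fun ξ => by 
    have e2 : Levi v z ξ = Levi u z ξ := by simp only [Levi, e.fderiv.fderiv_eq]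
    rw [e2]; exact h.2 ξ⟩

lemma PSH2_normsq {f : E → ℂ} (hV : IsOpen V) (hf : DifferentiableOn ℂ f V) : PSH2 (fun z => ‖f z‖ ^ 2) V := fun z hz =>
  ⟨normsq_contDiff hV hf hz, fun ξ => by rw [Levi_normsq hV hf hz]; positivity⟩

lemma PSH2_distsq (p : E) : PSH2 (fun z => ‖z - p‖ ^ 2) V := fun z hz =>
  ⟨(distsq_contDiff p).contDiffAt, fun ξ => by rw [Levi_distsq]; positivity⟩

lemma peak_not_hull (H : Exh V s) {ψ : E → ℝ} (hψ : PSH2 ψ V) {p : E} (hp : p ∈ V) (hK : IsCompact K) (hKV : K ⊆ V)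
    (hlt : ∀ z ∈ K, ψ z < ψ p) : p ∉ hullO V K := by
  intro h
  obtain ⟨F, hF, h1, h2⟩ := peak H hψ hp hK hKV hlt
  have h3 := h.2 F hF
  have h4 : ⨆ w ∈ K, ‖F w‖ ≤ 1 / 2 :=
    Real.iSup_le (fun w => Real.iSup_le (fun hw => (h1 w hw).le) (by norm_num)) (by norm_num)
  linarith

lemma Exh.stein (H : Exh V s) : IsSteinOpen V := by
  refine ⟨H.hV, fun K hKV hK => ?_⟩
  have hs : PSH2 s V := fun z hz => ⟨H.hs z hz, fun ξ => le_trans (by positivity) (H.hL z hz ξ)⟩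
  obtain ⟨c, hc⟩ := (hK.image_of_continuousOn (hs.cont.mono hKV)).bddAbove
  have hc : ∀ x ∈ K, s x ≤ c := fun x hx => hc ⟨x, hx, rfl⟩
  have hsub : hullO V K ⊆ {z ∈ V | s z ≤ c} := fun z hz => ⟨hz.1, by
    by_contra h
    exact peak_not_hull H hs hz.1 hK hKV (fun w hw => (hc w hw).trans_lt (not_le.1 h)) hz⟩
  refine (H.hc c).of_isClosed_subset ?_ hsub
  have e : hullO V K = ⋂ (f : E → ℂ) (_ : DifferentiableOn ℂ f V), ({z ∈ V | s z ≤ c} ∩ (fun z => ‖f z‖) ⁻¹' Iic (⨆ w ∈ K, ‖f w‖)) := by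
    ext z
    simp only [mem_iInter]
    constructor
    · exact fun hz f hf => ⟨hsub hz, hz.2 f hf⟩
    · intro hz
      exact ⟨(hz (fun _ => 0) (differentiableOn_const _)).1.1, fun f hf => (hz f hf).2⟩
  rw [e]
  refine isClosed_iInter fun f => isClosed_iInter fun hf => ?_
  exact (hf.continuousOn.norm.mono fun z hz => hz.1).preimage_isClosed_of_isClosed (H.hc c).isClosed isClosed_Iic

lemma le_sup_of_mem (hK : IsCompact K) {f : E → ℂ} (hf : ContinuousOn f K) {w : E} (hw : w ∈ K) :
    ‖f w‖ ≤ ⨆ w ∈ K, ‖f w‖ := by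
  obtain ⟨M, hM⟩ := hK.exists_bound_of_continuousOn hf
  have hb : BddAbove (range fun w => ⨆ (_ : w ∈ K), ‖f w‖) := by
    refine ⟨max M 0, ?_⟩
    rintro _ ⟨w, rfl⟩
    exact Real.iSup_le (fun hw => (hM w hw).trans (le_max_left _ _)) (le_max_right _ _)
  have := le_ciSup hb w
  simpa [hw] using this

lemma sup_nonneg (f : E → ℂ) : 0 ≤ ⨆ w ∈ K, ‖f w‖ :=
  Real.iSup_nonneg fun _ => Real.iSup_nonneg fun _ => norm_nonneg _

lemma hull_sep {Ω S : Set E} (hS : IsCompact S) (hSΩ : S ⊆ Ω) (hh : hullO Ω S = S) {p : E} (hp : p ∈ Ω) (hpS : p ∉ S) :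
    ∃ f : E → ℂ, DifferentiableOn ℂ f Ω ∧ ∃ σ, 0 ≤ σ ∧ (∀ z ∈ S, ‖f z‖ ≤ σ) ∧ σ < ‖f p‖ := by
  by_contra hcon
  push Not at hcon
  refine hpS (hh ▸ ⟨hp, fun f hf => hcon f hf _ (sup_nonneg f) fun z hz => ?_⟩)
  exact le_sup_of_mem hS (hf.continuousOn.mono hSΩ) hz

lemma hull_sep2 {Ω S : Set E} (hS : IsCompact S) (hSΩ : S ⊆ Ω) (hh : hullO Ω S = S) {p : E} (hp : p ∈ Ω) (hpS : p ∉ S) :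
    ∃ f : E → ℂ, DifferentiableOn ℂ f Ω ∧ (∀ z ∈ S, ‖f z‖ ≤ 1 / 2) ∧ 2 < ‖f p‖ := by
  obtain ⟨f, hf, σ, h0, h1, h2⟩ := hull_sep hS hSΩ hh hp hpS
  obtain ⟨t, ht1, ht2⟩ := exists_between h2
  have htp : 0 < t := h0.trans_lt ht1
  have e1 : ∀ᶠ k : ℕ in atTop, (σ / t) ^ k < 1 / 2 :=
    (tendsto_pow_atTop_nhds_zero_of_lt_one (by positivity) ((div_lt_one htp).2 ht1)).eventually
      (gt_mem_nhds (by norm_num))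
  have e2 : ∀ᶠ k : ℕ in atTop, 2 < (‖f p‖ / t) ^ k :=
    (tendsto_pow_atTop_atTop_of_one_lt ((one_lt_div htp).2 ht2)).eventually_gt_atTop 2
  obtain ⟨k, hk1, hk2⟩ := (e1.and e2).exists
  refine ⟨fun z => (f z / t) ^ k, fun z hz => by
    simp only [div_eq_mul_inv]
    exact (((hf z hz).mul_const ((t:ℂ)⁻¹)).pow k), fun z hz => ?_, ?_⟩
  · rw [norm_pow, norm_div, Complex.norm_real, Real.norm_of_nonneg htp.le]
    refine le_trans ?_ hk1.le
    gcongr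
    exact h1 z hz
  · rw [norm_pow, norm_div, Complex.norm_real, Real.norm_of_nonneg htp.le]
    exact hk2

lemma sep_fn {Ω S C : Set E} (hΩ : IsOpen Ω) (hS : IsCompact S) (hSΩ : S ⊆ Ω) (hh : hullO Ω S = S) (hC : IsCompact C)
    (hCΩ : C ⊆ Ω) (hCS : Disjoint C S) {ε L : ℝ} (hε : 0 < ε) :
    ∃ φ : E → ℝ, PSH2 φ Ω ∧ (∀ z, 0 ≤ φ z) ∧ (∀ z ∈ S, φ z ≤ ε) ∧ ∀ z ∈ C, L ≤ φ z := by
  have h1 : ∀ p ∈ C, ∃ f : E → ℂ, DifferentiableOn ℂ f Ω ∧ (∀ z ∈ S, ‖f z‖ ≤ 1 / 2) ∧ 2 < ‖f p‖ := fun p hp =>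
    hull_sep2 hS hSΩ hh (hCΩ hp) fun h => hCS.le_bot ⟨hp, h⟩
  choose! f hf1 hf2 hf3 using h1
  obtain ⟨t, htC, ht⟩ := hC.elim_nhds_subcover (fun p => {z | 2 < ‖f p z‖}) (fun p hp =>
    ((hf1 p hp).continuousOn.continuousAt (hΩ.mem_nhds (hCΩ hp))).norm.eventually (lt_mem_nhds (hf3 p hp)))
  have e1 : ∀ᶠ n : ℕ in atTop, t.card * (1 / 4 : ℝ) ^ n < ε := by
    have := (tendsto_pow_atTop_nhds_zero_of_lt_one (show (0:ℝ) ≤ 1 / 4 by norm_num) (by norm_num)).const_mul (t.card : ℝ)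
    rw [mul_zero] at this
    exact this.eventually (gt_mem_nhds hε)
  have e2 : ∀ᶠ n : ℕ in atTop, L < (4 : ℝ) ^ n :=
    (tendsto_pow_atTop_atTop_of_one_lt (by norm_num : (1:ℝ) < 4)).eventually_gt_atTop L
  obtain ⟨n, hn1, hn2⟩ := (e1.and e2).exists
  refine ⟨fun z => ∑ p ∈ t, ‖(f p z) ^ n‖ ^ 2, PSH2.sum fun p hp => PSH2_normsq hΩ ((hf1 p (htC p hp)).pow n),
    fun z => by positivity, fun z hz => ?_, fun z hz => ?_⟩
  · refine le_trans ?_ hn1.le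
    rw [← nsmul_eq_mul]
    refine Finset.sum_le_card_nsmul _ _ _ fun p hp => ?_
    rw [norm_pow, ← pow_mul, mul_comm, pow_mul]
    gcongr
    have := hf2 p (htC p hp) z hz
    nlinarith [norm_nonneg (f p z)]
  · obtain ⟨p, hp, hpz⟩ := mem_iUnion₂.1 (ht hz)
    refine hn2.le.trans (le_trans ?_ (Finset.single_le_sum (f := fun p => ‖(f p z) ^ n‖ ^ 2) (fun _ _ => by positivity) hp))
    simp only [norm_pow]
    rw [← pow_mul, mul_comm, pow_mul]
    have : 2 < ‖f p z‖ := hpz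
    gcongr
    nlinarith
end hulls

end ModuleD5

section ModuleE1
open MeasureTheory Complex Filter

section patching
variable {E : Type*} [NormedAddCommGroup E] [InnerProductSpace ℂ E] [FiniteDimensional ℂ E]

open Classical in
/-- The patched function: `φ` on the small set, a smooth maximum of `φ` and `B τ` on `W`, and `B τ` elsewhere. -/
def patchQ (W W' : Set E) (τ φ : E → ℝ) (B : ℝ) (z : E) : ℝ :=
  if z ∈ W' then φ z else if z ∈ W then B * τ z + rp (φ z - B * τ z) else B * τ z

variable {Ω W W' D : Set E} {τ φ : E → ℝ} {B m : ℝ}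

lemma patchQ_in {z : E} (h : z ∈ W') : patchQ W W' τ φ B z = φ z := by simp [patchQ, h]

lemma patchQ_out {z : E} (hWW : W' ⊆ W) (h : z ∉ W) : patchQ W W' τ φ B z = B * τ z := by
  have : z ∉ W' := fun h' => h (hWW h')
  simp [patchQ, h, this]

lemma patchQ_ge {z : E} (h : z ∈ W) : φ z ≤ patchQ W W' τ φ B z := by
  by_cases h' : z ∈ W'
  · rw [patchQ_in h']
  · simp only [patchQ, h, h', if_true, if_false]
    linarith [(rp_props (φ z - B * τ z)).2.1]

lemma patchQ_psh (hW : IsOpen W) (hW' : IsOpen W') (hcl : closure W' ⊆ W) (hWΩ : W ⊆ Ω)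
    (hD : IsOpen D) (hτ : PSH2 τ univ) (h1 : ∀ z ∈ W', z ∈ D → τ z < -(1 / 4))
    (h2 : ∀ z ∈ D, z ∉ W → 1 / 2 < τ z) (hφ : PSH2 φ Ω) (h0 : ∀ z, 0 ≤ φ z) (hm : ∀ z ∈ W, φ z ≤ m)
    (hB : 4 ≤ B) (hB2 : 2 * (m + 1) ≤ B) : PSH2 (patchQ W W' τ φ B) (W' ∪ D) := by
  have hWW : W' ⊆ W := subset_closure.trans hcl
  have hBτ : PSH2 (fun z => B * τ z) univ := hτ.const_mul (by linarith)
  intro z hz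
  change PSHat _ z
  by_cases hz1 : z ∈ W'
  · refine PSHat.congr (u := φ) (hφ z (hWΩ (hWW hz1))) ?_
    filter_upwards [hW'.mem_nhds hz1] with y hy using patchQ_in hy
  have hzD : z ∈ D := hz.resolve_left hz1
  by_cases hz2 : z ∈ W
  · refine PSHat.congr (u := fun z => B * τ z + rp (φ z - B * τ z))
      ((hφ.max (hBτ.mono (subset_univ _))) z (hWΩ hz2)) ?_
    filter_upwards [hW.mem_nhds hz2, hD.mem_nhds hzD] with y hy1 hy2
    by_cases hy : y ∈ W'
    · rw [patchQ_in hy]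
      have := h1 y hy hy2
      rw [rp_ge]
      · ring
      · nlinarith [h0 y]
    · simp [patchQ, hy, hy1]
  · refine PSHat.congr (u := fun z => B * τ z) (hBτ z trivial) ?_
    have e1 : ∀ᶠ y in 𝓝 z, 1 / 2 < τ y :=
      (hτ z trivial).1.continuousAt.eventually (lt_mem_nhds (h2 z hzD hz2))
    have e2 : ∀ᶠ y in 𝓝 z, y ∉ closure W' :=
      isClosed_closure.isOpen_compl.mem_nhds fun h => hz2 (hcl h)
    filter_upwards [e1, e2] with y hy1 hy2
    have hy3 : y ∉ W' := fun h => hy2 (subset_closure h)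
    by_cases hy : y ∈ W
    · simp only [patchQ, hy, hy3, if_true, if_false]
      rw [rp_le]
      · ring
      · nlinarith [hm y hy]
    · exact patchQ_out hWW hy

lemma rho_psh {r : ℕ} {g : E → EuclideanSpace ℂ (Fin r)} (hg : Differentiable ℂ g) {Q : E → ℝ} {V : Set E}
    (hQ : PSH2 Q V) : PSH2 (fun z => ‖g z‖ ^ 2 * Real.exp (2 * Q z)) V := by
  have e : (fun z => ‖g z‖ ^ 2 * Real.exp (2 * Q z)) = fun z => ∑ i : Fin r, ‖g z i‖ ^ 2 * Real.exp (2 * Q z) := by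
    ext z
    rw [EuclideanSpace.norm_sq_eq, Finset.sum_mul]
  rw [e]
  refine PSH2.sum fun i _ z hz => ?_
  have hgi : DifferentiableOn ℂ (fun z => g z i) univ := by
    have := (differentiable_euclidean (𝕜 := ℂ)).1 hg i
    exact this.differentiableOn
  have h2 := (hQ.const_mul (c := 2) (by norm_num)) z hz
  refine ⟨(normsq_contDiff isOpen_univ hgi trivial).mul h2.1.exp, fun ξ => ?_⟩
  exact Levi_normsq_exp isOpen_univ hgi trivial ξ h2.1 (h2.2 ξ)

lemma exh_of_rho {ρ : E → ℝ} {D0 : Set E} (hD0 : IsOpen D0) (hρ : PSH2 ρ D0)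
    (hcl : ∀ z, z ∉ D0 → ∀ᶠ y in 𝓝 z, y ∈ D0 → 1 ≤ ρ y) :
    Exh {z ∈ D0 | ρ z < 1} (fun z => (1 - ρ z)⁻¹ + (‖z - 0‖ ^ 2 + 3)) := by
  have : ProperSpace E := FiniteDimensional.proper ℂ E
  have hcd : ∀ z ∈ D0, ρ z < 1 → ContDiffAt ℝ 2 (fun z => (1 - ρ z)⁻¹) z := fun z hz h =>
    (contDiffAt_const.sub (hρ z hz).1).inv (by linarith)
  have hcd2 : ∀ z : E, ContDiffAt ℝ 2 (fun z : E => ‖z - 0‖ ^ 2 + 3) z := fun z =>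
    (distsq_contDiff 0).contDiffAt.add contDiffAt_const
  refine ⟨?_, ?_, ?_, ?_, ?_⟩
  · rw [isOpen_iff_mem_nhds]
    rintro z ⟨h1, h2⟩
    filter_upwards [hD0.mem_nhds h1, (hρ z h1).1.continuousAt.eventually (gt_mem_nhds h2)] with y a b using ⟨a, b⟩
  · rintro z ⟨h1, h2⟩
    exact (hcd z h1 h2).add (hcd2 z)
  · rintro z ⟨h1, h2⟩
    have : 0 ≤ (1 - ρ z)⁻¹ := inv_nonneg.2 (by linarith)
    nlinarith [sq_nonneg ‖z - 0‖]
  · rintro z ⟨h1, h2⟩ ξ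
    have hL1 : 0 ≤ Levi (fun z => (1 - ρ z)⁻¹) z ξ := by
      have hd1 : ∀ t : ℝ, t < 1 → HasDerivAt (fun t : ℝ => (1 - t)⁻¹) (((1 - t) ^ 2)⁻¹) t := fun t ht => by
        have := ((hasDerivAt_id t).const_sub 1).inv (by simp; linarith)
        have e : ((1 - t) ^ 2)⁻¹ = - -1 / (1 - id t) ^ 2 := by simp
        rw [e]; exact this
      have hd2 : HasDerivAt (fun t : ℝ => ((1 - t) ^ 2)⁻¹) (2 * (1 - ρ z) / ((1 - ρ z) ^ 2) ^ 2) (ρ z) := by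
        have hne : (1 - ρ z) ^ 2 ≠ 0 := pow_ne_zero _ (by linarith)
        have := (((hasDerivAt_id (ρ z)).const_sub 1).pow 2).inv (by simpa using hne)
        have e : 2 * (1 - ρ z) / ((1 - ρ z) ^ 2) ^ 2 = -(((2 : ℕ) : ℝ) * (1 - id (ρ z)) ^ (2 - 1) * -1) / ((fun x : ℝ => 1 - id x) ^ 2) (ρ z) ^ 2 := by
          simp
        rw [e]; exact this
      have := Levi_chain (χ := fun t : ℝ => (1 - t)⁻¹) (hρ z h1).1
        (Filter.eventually_of_mem (gt_mem_nhds h2) hd1) hd2 ξ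
      rw [this]
      have h3 : 0 < 1 - ρ z := by linarith
      exact add_nonneg (mul_nonneg (by positivity) ((hρ z h1).2 ξ)) (mul_nonneg (by positivity) (Gsq_nonneg _ _ _))
    rw [Levi_add (hcd z h1 h2) (hcd2 z), Levi_add (distsq_contDiff 0).contDiffAt contDiffAt_const, Levi_distsq, Levi_const]
    linarith
  · intro c
    refine Metric.isCompact_of_isClosed_isBounded ?_ ?_
    · refine isClosed_of_closure_subset fun z hz => ?_
      rw [mem_closure_iff_frequently] at hz
      have hzD : z ∈ D0 := by
        by_contra h
        obtain ⟨y, hy1, hy2⟩ := (hz.and_eventually (hcl z h)).exists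
        exact absurd (hy2 hy1.1.1) (not_le.2 hy1.1.2)
      have key : ∀ y, y ∈ D0 → ρ y < 1 → (1 - ρ y)⁻¹ + (‖y - 0‖ ^ 2 + 3) ≤ c → 1 ≤ c * (1 - ρ y) := by
        intro y _ h1 h2
        have h3 : 0 < 1 - ρ y := by linarith
        have h4 : (1 - ρ y)⁻¹ ≤ c := by nlinarith [sq_nonneg ‖y - 0‖]
        rwa [inv_le_iff_one_le_mul₀ h3] at h4
      have hc1 : 1 ≤ c * (1 - ρ z) := by
        by_contra h
        have : ∀ᶠ y in 𝓝 z, c * (1 - ρ y) < 1 :=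
          (((hρ z hzD).1.continuousAt.const_sub 1).const_mul c).eventually (gt_mem_nhds (not_le.1 h))
        obtain ⟨y, hy1, hy2⟩ := (hz.and_eventually this).exists
        linarith [key y hy1.1.1 hy1.1.2 hy1.2]
      have hc3 : 3 ≤ c := by
        obtain ⟨y, hy1⟩ := hz.exists
        have : 0 < (1 - ρ y)⁻¹ := inv_pos.2 (by linarith [hy1.1.2])
        nlinarith [sq_nonneg ‖y - 0‖, hy1.2]
      have hz1 : ρ z < 1 := by
        by_contra h
        nlinarith
      refine ⟨⟨hzD, hz1⟩, ?_⟩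
      by_contra h
      have : ∀ᶠ y in 𝓝 z, c < (1 - ρ y)⁻¹ + (‖y - 0‖ ^ 2 + 3) :=
        ((hcd z hzD hz1).add (hcd2 z)).continuousAt.eventually (lt_mem_nhds (not_le.1 h))
      obtain ⟨y, hy1, hy2⟩ := (hz.and_eventually this).exists
      exact absurd hy1.2 (not_le.2 hy2)
    · refine (Metric.isBounded_closedBall (x := (0 : E)) (r := c + 1)).subset fun z hz => ?_
      have h1 : 0 < (1 - ρ z)⁻¹ := inv_pos.2 (by linarith [hz.1.2])
      have h2 := hz.2
      rw [mem_closedBall_zero_iff]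
      rw [sub_zero] at h2
      nlinarith [norm_nonneg z, sq_nonneg (‖z‖ - 1)]

end patching

end ModuleE1

section ModuleE2
open MeasureTheory Complex Filter

section patching2
variable {E : Type*} [NormedAddCommGroup E] [InnerProductSpace ℂ E] [FiniteDimensional ℂ E]

/-- A growth function for `log (1/‖g‖)` off `U`. -/
lemma exists_gamma {r : ℕ} {g : E → EuclideanSpace ℂ (Fin r)} (hg : Differentiable ℂ g) {U : Set E} (hU : IsOpen U)
    (hXU : {z | g z = 0} ⊆ U) (R : ℝ) :
    ∃ χ χ1 χ2 : ℝ → ℝ, C2f χ χ1 χ2 ∧ (∀ t, 0 ≤ χ t) ∧ (∀ t, 0 ≤ χ1 t) ∧ (∀ t, 0 ≤ χ2 t) ∧ (∀ t ≤ 0, χ t = 0) ∧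
      (∀ t, 3 ≤ t → 3 ≤ χ t) ∧ ∀ z, 3 ≤ ‖z‖ ^ 2 - R ^ 2 → z ∉ U → 1 - Real.log ‖g z‖ ≤ χ (‖z‖ ^ 2 - R ^ 2) := by
  have : ProperSpace E := FiniteDimensional.proper ℂ E
  have hm : ∀ k : ℕ, ∃ m : ℝ, 3 ≤ m ∧ ∀ z, ‖z‖ ^ 2 - R ^ 2 ≤ k + 1 → z ∉ U → 1 - Real.log ‖g z‖ ≤ m := by
    intro k
    have hT : IsCompact {z : E | ‖z‖ ^ 2 - R ^ 2 ≤ k + 1 ∧ z ∉ U} := by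
      refine Metric.isCompact_of_isClosed_isBounded ?_ ?_
      · exact (isClosed_le ((continuous_norm.pow 2).sub continuous_const) continuous_const).inter hU.isClosed_compl
      · refine (Metric.isBounded_closedBall (x := (0 : E)) (r := k + 1 + R ^ 2 + 1)).subset fun z hz => ?_
        rw [mem_closedBall_zero_iff]
        nlinarith [norm_nonneg z, sq_nonneg (‖z‖ - 1), hz.1]
    have hc : ContinuousOn (fun z => 1 - Real.log ‖g z‖) {z : E | ‖z‖ ^ 2 - R ^ 2 ≤ k + 1 ∧ z ∉ U} := by
      refine continuousOn_const.sub (ContinuousOn.log hg.continuous.norm.continuousOn fun z hz => ?_)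
      intro h0
      exact hz.2 (hXU (norm_eq_zero.1 h0))
    obtain ⟨m, hm⟩ := hT.bddAbove_image hc
    refine ⟨max m 3, le_max_right _ _, fun z h1 h2 => le_max_of_le_left (hm ⟨z, ⟨h1, h2⟩, rfl⟩)⟩
  choose m hm3 hm using hm
  obtain ⟨χ, χ1, χ2, h1, h2, h3, h4, h5, h6⟩ := growth m
  refine ⟨χ, χ1, χ2, h1, h2, h3, h4, h5, fun t ht => (hm3 _).trans (h6 t ht).1, fun z hz hzU => ?_⟩
  exact (hm ⌊‖z‖ ^ 2 - R ^ 2⌋₊ z (Nat.lt_floor_add_one _).le hzU).trans (h6 _ hz).1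

/-- A compact set disjoint from the zero set of `g` has a positive lower bound. -/
lemma low_bound {r : ℕ} {g : E → EuclideanSpace ℂ (Fin r)} (hg : Continuous g) {T : Set E} (hT : IsCompact T)
    (h : ∀ z ∈ T, g z ≠ 0) : ∃ η > 0, ∀ z ∈ T, η ≤ ‖g z‖ := by
  rcases T.eq_empty_or_nonempty with rfl | hne
  · exact ⟨1, one_pos, fun z hz => absurd hz (notMem_empty z)⟩
  · obtain ⟨z, hz, hmin⟩ := hT.exists_isMinOn hne hg.norm.continuousOn
    exact ⟨‖g z‖, norm_pos_iff.2 (h z hz), fun y hy => hmin hy⟩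

/-- All the choices. -/
lemma choices {r : ℕ} {g : E → EuclideanSpace ℂ (Fin r)} (hg : Differentiable ℂ g) {S Ω U : Set E} (hS : IsCompact S)
    (hΩ : IsOpen Ω) (hSΩ : S ⊆ Ω) (hSX : hullO univ (S ∩ {z | g z = 0}) = S ∩ {z | g z = 0})
    (hU : IsOpen U) (hSU : S ∪ {z | g z = 0} ⊆ U) :
    ∃ (W W' : Set E) (τ : E → ℝ) (η : ℝ), IsOpen W ∧ IsOpen W' ∧ S ⊆ W' ∧ closure W' ⊆ W ∧ IsCompact (closure W) ∧
      closure W ⊆ Ω ∧ W ⊆ U ∧ PSH2 τ univ ∧ 0 < η ∧ (∀ z ∈ W', ‖g z‖ < η → τ z < -(1 / 4)) ∧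
      (∀ z, ‖g z‖ < η → z ∉ W → 1 / 2 < τ z) ∧
      ∀ z, ‖g z‖ < η → z ∉ W → ‖g z‖ * Real.exp (τ z) < 1 → z ∈ U := by
  have : ProperSpace E := FiniteDimensional.proper ℂ E
  have hgc := hg.continuous
  have hXcl : IsClosed {z | g z = 0} := isClosed_eq hgc continuous_const
  obtain ⟨W, hW, hSW, hWcl, hWc⟩ := exists_open_between_and_isCompact_closure hS (hΩ.inter hU)
    (subset_inter hSΩ (subset_union_left.trans hSU))
  obtain ⟨R, hR⟩ : ∃ R : ℝ, ∀ z ∈ closure W, ‖z‖ ≤ R := by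
    obtain ⟨R, hR⟩ := hWc.isBounded.subset_closedBall (0 : E)
    exact ⟨R, fun z hz => mem_closedBall_zero_iff.1 (hR hz)⟩
  wlog hR1 : 1 ≤ R generalizing R
  · exact this (max R 1) (fun z hz => (hR z hz).trans (le_max_left _ _)) (le_max_right _ _)
  have hball : IsCompact (Metric.closedBall (0 : E) (R + 1)) := isCompact_closedBall _ _
  have hK : IsCompact (S ∩ {z | g z = 0}) := hS.inter_right hXcl
  have hC : IsCompact ((Metric.closedBall (0 : E) (R + 1) ∩ {z | g z = 0}) \ W) :=
    (hball.inter_right hXcl).diff hW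
  obtain ⟨h, hh, hh0, hhK, hhC⟩ := sep_fn (L := 3) (ε := 1 / 4) isOpen_univ hK (subset_univ _) hSX hC (subset_univ _)
    (Set.disjoint_left.2 fun z h1 h2 => h1.2 (hSW h2.1)) (by norm_num)
  obtain ⟨χ, χ1, χ2, c1, c2, c3, c4, c5, c6, c7⟩ := exists_gamma hg hU (subset_union_right.trans hSU) R
  set τ : E → ℝ := fun z => h z + χ (‖z - 0‖ ^ 2 + -R ^ 2) + -(3 / 4) with hτdef
  have hτ : PSH2 τ univ :=
    (hh.add (((PSH2_distsq 0).add (PSH2_const _)).comp c1 c3 c4)).add (PSH2_const _)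
  have hτe : ∀ z, τ z = h z + χ (‖z‖ ^ 2 - R ^ 2) - 3 / 4 := fun z => by
    simp only [hτdef, sub_zero]
    rw [← sub_eq_add_neg, ← sub_eq_add_neg]
  have hτc : Continuous τ := continuousOn_univ.1 hτ.cont
  -- first bound
  obtain ⟨η1, hη1, hb1⟩ := low_bound hgc (T := (Metric.closedBall (0 : E) (R + 1) \ W) ∩ ({z | τ z ≤ 1 / 2} ∪ Uᶜ))
    ((hball.diff hW).inter_right ((isClosed_le hτc continuous_const).union hU.isClosed_compl)) (by
      rintro z ⟨⟨h1, h2⟩, h3⟩ h0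
      have h4 := hhC z ⟨⟨h1, h0⟩, h2⟩
      rcases h3 with h3 | h3
      · have h5 : τ z ≤ 1 / 2 := h3
        rw [hτe] at h5
        linarith [c2 (‖z‖ ^ 2 - R ^ 2)]
      · exact h3 (hSU (Or.inr h0)))
  obtain ⟨η2, hη2, hb2⟩ := low_bound hgc (T := S ∩ {z | -(1 / 4) ≤ τ z})
    (hS.inter_right (isClosed_le continuous_const hτc)) (by
      rintro z ⟨h1, h2⟩ h0
      have h3 : -(1 / 4) ≤ τ z := h2
      have h4 := hhK z ⟨h1, h0⟩
      have h5 := hR z (subset_closure (hSW h1))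
      rw [hτe, c5 _ (by nlinarith [norm_nonneg z])] at h3
      linarith)
  set η := min η1 (η2 / 2)
  have hη : 0 < η := lt_min hη1 (by linarith)
  have hO : IsOpen ({z | η < ‖g z‖} ∪ {z | τ z < -(1 / 4)}) :=
    (isOpen_lt continuous_const hgc.norm).union (isOpen_lt hτc continuous_const)
  obtain ⟨W', hW', hSW', hcl', -⟩ := exists_open_between_and_isCompact_closure hS (hW.inter hO)
    (fun z hz => ⟨hSW hz, by
      by_cases h1 : τ z < -(1 / 4)
      · exact Or.inr h1
      · left
        have := hb2 z ⟨hz, not_lt.1 h1⟩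
        have h3 : η ≤ η2 / 2 := min_le_right _ _
        change η < ‖g z‖
        linarith⟩)
  -- far away points
  have hfar : ∀ z : E, z ∉ Metric.closedBall (0 : E) (R + 1) → 3 ≤ ‖z‖ ^ 2 - R ^ 2 := fun z hz => by
    rw [mem_closedBall_zero_iff, not_le] at hz
    nlinarith
  refine ⟨W, W', τ, η, hW, hW', hSW', fun z hz => (hcl' hz).1, hWc, fun z hz => (hWcl hz).1,
    fun z hz => (hWcl (subset_closure hz)).2, hτ, hη, ?_, ?_, ?_⟩
  · intro z hz hgz
    rcases (hcl' (subset_closure hz)).2 with h1 | h1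
    · exact absurd h1 (not_lt.2 hgz.le)
    · exact h1
  · intro z hgz hzW
    by_cases hz : z ∈ Metric.closedBall (0 : E) (R + 1)
    · by_contra hcon
      have := hb1 z ⟨⟨hz, hzW⟩, Or.inl (not_lt.1 hcon)⟩
      linarith [min_le_left η1 (η2 / 2)]
    · rw [hτe]
      linarith [c6 _ (hfar z hz), hh0 z]
  · intro z hgz hzW hlt
    by_contra hzU
    by_cases hz : z ∈ Metric.closedBall (0 : E) (R + 1)
    · have := hb1 z ⟨⟨hz, hzW⟩, Or.inr hzU⟩
      linarith [min_le_left η1 (η2 / 2)]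
    · have h1 := c7 z (hfar z hz) hzU
      have hpos : 0 < ‖g z‖ := norm_pos_iff.2 fun h0 => hzU (hSU (Or.inr h0))
      have h2 : -Real.log ‖g z‖ ≤ τ z := by
        rw [hτe]; linarith [hh0 z]
      have h3 := Real.exp_le_exp.2 h2
      rw [Real.exp_neg, Real.exp_log hpos] at h3
      have := mul_le_mul_of_nonneg_left h3 hpos.le
      rw [mul_inv_cancel₀ hpos.ne'] at this
      linarith

end patching2

end ModuleE2

section ModuleE3
open MeasureTheory Complex Filter

section core
variable {E : Type*} [NormedAddCommGroup E] [InnerProductSpace ℂ E] [FiniteDimensional ℂ E]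

lemma core {r : ℕ} {g : E → EuclideanSpace ℂ (Fin r)} (hg : Differentiable ℂ g) {S Ω U : Set E} (hS : IsCompact S)
    (hΩ : IsOpen Ω) (hSΩ : S ⊆ Ω) (hh : hullO Ω S = S)
    (hSX : hullO univ (S ∩ {z | g z = 0}) = S ∩ {z | g z = 0})
    (hU : IsOpen U) (hSU : S ∪ {z | g z = 0} ⊆ U) (hgS : ∀ z ∈ S, ‖g z‖ ≤ Real.exp (-2)) :
    ∃ V : Set E, IsSteinOpen V ∧ S ∪ {z | g z = 0} ⊆ V ∧ V ⊆ U ∧ hullO V S = S := by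
  obtain ⟨W, W', τ, η, hW, hW', hSW', hcl, hWc, hWΩ, hWU, hτ, hη, t1, t2, t3⟩ := choices hg hS hΩ hSΩ hSX hU hSU
  have hgc := hg.continuous
  have hWW : W' ⊆ W := subset_closure.trans hcl
  have hWΩ' : W ⊆ Ω := subset_closure.trans hWΩ
  set L := Real.log (2 / η) with hL
  have hLe : η / 2 * Real.exp L = 1 := by
    rw [hL, Real.exp_log (by positivity)]
    field_simp
  obtain ⟨φ, hφ, hφ0, hφS, hφC⟩ := sep_fn (L := L + 1) (ε := 1) hΩ hS hSΩ hh (hWc.diff hW') (diff_subset.trans hWΩ)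
    (Set.disjoint_left.2 fun z h1 h2 => h1.2 (hSW' h2)) one_pos
  have hbd : ∀ u : E → ℝ, PSH2 u Ω → ∃ m, ∀ z ∈ W, u z ≤ m := fun u hu => by
    obtain ⟨m, hm⟩ := hWc.bddAbove_image (hu.cont.mono hWΩ)
    exact ⟨m, fun z hz => hm ⟨z, subset_closure hz, rfl⟩⟩
  set D : Set E := {z | ‖g z‖ < η} with hDdef
  have hD : IsOpen D := isOpen_lt hgc.norm continuous_const
  have patch : ∀ (u : E → ℝ) (m B : ℝ), PSH2 u Ω → (∀ z, 0 ≤ u z) → (∀ z ∈ W, u z ≤ m) → 4 ≤ B → 2 * (m + 1) ≤ B →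
      PSH2 (patchQ W W' τ u B) (W' ∪ D) := fun u m B a1 a2 a3 a4 a5 =>
    patchQ_psh hW hW' hcl hWΩ' hD hτ t1 t2 a1 a2 a3 a4 a5
  obtain ⟨m, hm⟩ := hbd φ hφ
  obtain ⟨B, hB4, hBm, hBL⟩ : ∃ B : ℝ, 4 ≤ B ∧ 2 * (m + 1) ≤ B ∧ 2 * L ≤ B :=
    ⟨max 4 (max (2 * (m + 1)) (2 * L)), le_max_left _ _, (le_max_left _ _).trans (le_max_right _ _),
      (le_max_right _ _).trans (le_max_right _ _)⟩
  set Q := patchQ W W' τ φ B with hQdef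
  have hQ : PSH2 Q (W' ∪ D) := patch φ m B hφ hφ0 hm hB4 hBm
  set ρ : E → ℝ := fun z => ‖g z‖ ^ 2 * Real.exp (2 * Q z) with hρdef
  have hρe : ∀ z, ρ z = (‖g z‖ * Real.exp (Q z)) ^ 2 := fun z => by
    simp only [hρdef]
    rw [mul_pow, ← Real.exp_nat_mul]
    norm_num
  have hρ : PSH2 ρ (W' ∪ D) := rho_psh hg hQ
  have hQL : ∀ y, y ∈ D → y ∉ W' → L ≤ Q y := fun y hy hy' => by
    by_cases hyW : y ∈ W
    · have h1 := hφC y ⟨subset_closure hyW, hy'⟩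
      have h2 : φ y ≤ Q y := patchQ_ge hyW
      linarith
    · have h1 : Q y = B * τ y := patchQ_out hWW hyW
      rw [h1]
      nlinarith [t2 y hy hyW]
  have hge : ∀ y, η / 2 < ‖g y‖ → L ≤ Q y → 1 ≤ ρ y := fun y h1 h2 => by
    rw [hρe]
    have h3 : 1 ≤ ‖g y‖ * Real.exp (Q y) := by
      rw [← hLe]
      gcongr
    nlinarith
  have hclos : ∀ z, z ∉ W' ∪ D → ∀ᶠ y in 𝓝 z, y ∈ W' ∪ D → 1 ≤ ρ y := by
    intro z hz
    have hz1 : z ∉ W' := fun h => hz (Or.inl h)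
    have hz2 : η ≤ ‖g z‖ := not_lt.1 fun h => hz (Or.inr h)
    have e1 : ∀ᶠ y in 𝓝 z, η / 2 < ‖g y‖ :=
      hgc.norm.continuousAt.eventually (lt_mem_nhds (by linarith))
    by_cases hzW : z ∈ W
    · have e2 : ∀ᶠ y in 𝓝 z, L < φ y :=
        (hφ z (hWΩ' hzW)).1.continuousAt.eventually
          (lt_mem_nhds (by linarith [hφC z ⟨subset_closure hzW, hz1⟩]))
      filter_upwards [e1, e2, hW.mem_nhds hzW] with y h1 h2 h3 _
      exact hge y h1 (h2.le.trans (patchQ_ge h3))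
    · have e2 : ∀ᶠ y in 𝓝 z, y ∉ closure W' :=
        isClosed_closure.isOpen_compl.mem_nhds fun h => hzW (hcl h)
      filter_upwards [e1, e2] with y h1 h2 h3
      have hy : y ∉ W' := fun h => h2 (subset_closure h)
      exact hge y h1 (hQL y (h3.resolve_left hy) hy)
  have hExh := exh_of_rho (hW'.union hD) hρ hclos
  set V : Set E := {z ∈ W' ∪ D | ρ z < 1} with hVdef
  have hSV : S ⊆ V := fun z hz => by
    refine ⟨Or.inl (hSW' hz), ?_⟩
    rw [hρe]
    have h1 : Q z = φ z := patchQ_in (hSW' hz)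
    have h2 : ‖g z‖ * Real.exp (Q z) ≤ Real.exp (-1) := by
      calc ‖g z‖ * Real.exp (Q z) ≤ Real.exp (-2) * Real.exp 1 := by
            gcongr
            · exact hgS z hz
            · rw [h1]; exact hφS z hz
        _ = Real.exp (-1) := by rw [← Real.exp_add]; norm_num
    have h3 : Real.exp (-1) < 1 := by rw [Real.exp_lt_one_iff]; norm_num
    have h4 : 0 ≤ ‖g z‖ * Real.exp (Q z) := by positivity
    nlinarith
  refine ⟨V, hExh.stein, union_subset hSV fun z hz => ?_, fun z hz => ?_, ?_⟩
  · have hz0 : g z = 0 := hz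
    refine ⟨Or.inr ?_, ?_⟩
    · change ‖g z‖ < η
      rw [hz0, norm_zero]; exact hη
    · rw [hρe, hz0]; simp
  · by_cases hzW : z ∈ W
    · exact hWU hzW
    · have hzD : z ∈ D := hz.1.resolve_left fun h => hzW (hWW h)
      refine t3 z hzD hzW ?_
      have h1 : Q z = B * τ z := patchQ_out hWW hzW
      have h2 := t2 z hzD hzW
      have h3 : ‖g z‖ * Real.exp (τ z) ≤ ‖g z‖ * Real.exp (Q z) := by
        gcongr
        rw [h1]; nlinarith
      have h4 := hz.2
      rw [hρe] at h4
      have h5 : 0 ≤ ‖g z‖ * Real.exp (Q z) := by positivity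
      have h6 : ‖g z‖ * Real.exp (Q z) < 1 := by nlinarith
      linarith
  · refine Subset.antisymm (fun p hp => ?_) fun z hz => ⟨hSV hz, fun f hf =>
      le_sup_of_mem hS (hf.continuousOn.mono hSV) hz⟩
    by_contra hpS
    have hpV : p ∈ V := hp.1
    have hVD : V ⊆ W' ∪ D := fun z hz => hz.1
    by_cases hpW : p ∈ W
    · obtain ⟨f, hf, σ, s0, s1, s2⟩ := hull_sep hS hSΩ hh (hWΩ' hpW) hpS
      have hu : PSH2 (fun z => ‖f z‖ ^ 2) Ω := PSH2_normsq hΩ hf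
      obtain ⟨m', hm'⟩ := hbd _ hu
      have hψ := patch _ m' (max 4 (2 * (m' + 1))) hu (fun z => sq_nonneg _) hm' (le_max_left _ _) (le_max_right _ _)
      refine peak_not_hull hExh (hψ.mono hVD) hpV hS hSV (fun z hz => ?_) hp
      rw [patchQ_in (hSW' hz)]
      refine lt_of_lt_of_le ?_ (patchQ_ge hpW)
      have := s1 z hz
      have := norm_nonneg (f z)
      change ‖f z‖ ^ 2 < ‖f p‖ ^ 2
      nlinarith
    · have hpD : p ∈ D := hpV.1.resolve_left fun h => hpW (hWW h)
      have hψ := patch (fun _ => 0) 0 4 (PSH2_const _) (fun z => le_rfl) (fun z _ => le_rfl) le_rfl (by norm_num)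
      refine peak_not_hull hExh (hψ.mono hVD) hpV hS hSV (fun z hz => ?_) hp
      rw [patchQ_in (hSW' hz), patchQ_out hWW hpW]
      linarith [t2 p hpD hpW]

end core

end ModuleE3

/-- Theorem 2.2 (Forstnerič's generalization of Siu's theorem): if `X` is a closed Stein
subvariety of `ℂᴺ` (here the zero set of an entire map `g`), `S` is a compact set that is
`𝒪(Ω)`-convex in some Stein open set `Ω ⊇ S` and such that `S ∩ X` is `𝒪(ℂᴺ)`-convex,
then every open `U ⊇ S ∪ X` contains a Stein open `V ⊇ S ∪ X` in which `S` is
`𝒪(V)`-convex. -/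
theorem stein_neighborhood_of_union_with_subvariety {N r : ℕ}
    (g : EuclideanSpace ℂ (Fin N) → EuclideanSpace ℂ (Fin r))
    (hg : Differentiable ℂ g)
    (S : Set (EuclideanSpace ℂ (Fin N))) (hScpt : IsCompact S)
    (hSconv : ∃ Ω : Set (EuclideanSpace ℂ (Fin N)),
      IsSteinOpen Ω ∧ S ⊆ Ω ∧ hullO Ω S = S)
    (hSX : hullO univ (S ∩ {z | g z = 0}) = S ∩ {z | g z = 0}) :
    ∀ U : Set (EuclideanSpace ℂ (Fin N)), IsOpen U → S ∪ {z | g z = 0} ⊆ U →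
      ∃ V : Set (EuclideanSpace ℂ (Fin N)),
        IsSteinOpen V ∧ S ∪ {z | g z = 0} ⊆ V ∧ V ⊆ U ∧ hullO V S = S := by
  intro U hU hSU
  obtain ⟨Ω, hΩ, hSΩ, hh⟩ := hSconv
  obtain ⟨M, hM⟩ := hScpt.bddAbove_image hg.continuous.norm.continuousOn
  have hMp : 0 < |M| + 1 := by positivity
  set c : ℝ := Real.exp (-2) / (|M| + 1) with hc
  have hcp : 0 < c := by positivity
  have hcne : (c : ℂ) ≠ 0 := by exact_mod_cast hcp.ne'
  have hX : {z | ((c : ℂ) • g) z = 0} = {z | g z = 0} := by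
    ext z
    simp [hcp.ne']
  have := core (g := (c : ℂ) • g) (hg.const_smul _) hScpt hΩ.1 hSΩ hh (by rw [hX]; exact hSX) hU (by rw [hX]; exact hSU)
    (fun z hz => by
      have h1 : ‖g z‖ ≤ M := hM ⟨z, hz, rfl⟩
      rw [Pi.smul_apply, norm_smul, Complex.norm_real, Real.norm_of_nonneg hcp.le, hc, div_mul_eq_mul_div, div_le_iff₀ hMp]
      gcongr
      linarith [le_abs_self M])
  rwa [hX] at this
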